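/- arXiv:1908.10477 — 11 statements merged into one kernel-verified Lean document; each statement's English description precedes it below -/
import Mathlib

section
/- Let a = (a_1,…,a_m) be an m-tuple of positive integers with n = a_1+⋯+a_m, and let J_a be the m×m Jacobian matrix over ℂ[z_1,…,z_m] with (i,j)-entry ∂/∂z_i (p_a(z_j)). Then det J_a = (1/multinomial(n; a_1,…,a_m)) · (∏_{j=1}^m (−z_j)^{a_j}) · (∏_{j≠k, j,k ∈ [m]} (z_k − z_j)^{a_j}), where multinomial(n; a_1,…,a_m) = n!/(a_1!⋯a_m!). Consequently, for a point (z_1,…,z_m) ∈ ℂ^m, the matrix J_a is invertible if and only if z_1,…,z_m are distinct and nonzero. -/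
open Polynomial Finset

section JacobianDeterminant

variable {A : Type*} [CommRing A]

/-- The functional sending `f` to the value at `z` of its antiderivative without constant term. -/
noncomputable def integralTo [Algebra ℚ A] (z : A) : A[X] →ₗ[A] A :=
  Polynomial.lsum fun l => (algebraMap ℚ A (1 / ((l : ℚ) + 1)) * z ^ (l + 1)) • LinearMap.id

lemma integralTo_monomial [Algebra ℚ A] (z : A) (l : ℕ) (c : A) :
    integralTo z (monomial l c) = algebraMap ℚ A (1 / ((l : ℚ) + 1)) * z ^ (l + 1) * c := by
  simp [integralTo, Polynomial.lsum, Polynomial.sum_monomial_index]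

lemma integralTo_derivative [Algebra ℚ A] (z : A) (f : A[X]) :
    integralTo z (derivative f) = f.eval z - f.coeff 0 := by
  induction f using Polynomial.induction_on' with
  | add p q hp hq => simp only [map_add, hp, hq, eval_add, coeff_add]; ring
  | monomial n c =>
    rcases n with _ | n
    · simp
    · have h : algebraMap ℚ A (1 / ((n : ℚ) + 1)) * ((n : A) + 1) = 1 := by
        have h1 : ((n : A) + 1) = algebraMap ℚ A ((n : ℚ) + 1) := by simp
        rw [h1, ← map_mul, one_div_mul_cancel (by positivity), map_one]
      rw [derivative_monomial, Nat.add_sub_cancel, integralTo_monomial]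
      simp only [eval_monomial, coeff_monomial, Nat.succ_ne_zero, if_false]
      push_cast
      linear_combination (z ^ (n + 1) * c) * h

/-- A derivation of `A` extends to `A[X]` coefficientwise, and obeys the chain rule. -/
lemma exists_coeffwise_derivation {R : Type*} [CommRing R] [Algebra R A]
    (d : Derivation R A A) :
    ∃ D : Derivation ℤ A[X] A[X], (∀ p i, (D p).coeff i = d (p.coeff i)) ∧
      ∀ x p, d (p.eval x) = (D p).eval x + (derivative p).eval x * d x := by
  let : Differential A := ⟨d.restrictScalars ℤ⟩
  have : DifferentialAlgebra A A := ⟨fun _ => rfl⟩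
  refine ⟨Differential.mapCoeffs, Differential.coeff_mapCoeffs, fun x p => ?_⟩
  have h := Differential.deriv_aeval_eq (A := A) x p
  rw [coe_aeval_eq_eval] at h
  exact h

lemma derivative_comm_of_coeffwise {R : Type*} [CommRing R] [Algebra R A]
    {d : Derivation R A A} {D : Derivation ℤ A[X] A[X]}
    (hD : ∀ p i, (D p).coeff i = d (p.coeff i)) (p : A[X]) :
    derivative (D p) = D (derivative p) := by
  ext i
  have h : ((i : A) + 1) = ((i + 1 : ℕ) : A) := by push_cast; ring
  rw [coeff_derivative, hD, hD, coeff_derivative, h, Derivation.leibniz, Derivation.map_natCast]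
  simp [mul_comm]

variable {m : ℕ}

/-- The product of the linear factors `X - z l` over `l ≠ i`. -/
noncomputable def cofactorPoly (z : Fin m → A) (i : Fin m) : A[X] :=
  ∏ l ∈ univ.erase i, (X - C (z l))

lemma X_sub_C_mul_cofactorPoly (z : Fin m → A) (i : Fin m) :
    (X - C (z i)) * cofactorPoly z i = ∏ l, (X - C (z l)) :=
  mul_prod_erase univ (fun l => X - C (z l)) (mem_univ i)

lemma prod_erase_pow_succ_mul_pow (z : Fin m → A) (c : Fin m → ℕ) (i : Fin m) :
    (∏ l ∈ univ.erase i, (X - C (z l)) ^ (c l + 1)) * (X - C (z i)) ^ c i =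
      (∏ l, (X - C (z l)) ^ c l) * cofactorPoly z i := by
  rw [cofactorPoly, ← mul_prod_erase univ (fun l => (X - C (z l)) ^ c l) (mem_univ i)]
  simp only [pow_succ, prod_mul_distrib]
  ring

lemma derivative_prod_pow_succ (z : Fin m → A) (c : Fin m → ℕ) :
    derivative (∏ l, (X - C (z l)) ^ (c l + 1)) =
      ∑ i, C ((c i : A) + 1) * ((∏ l, (X - C (z l)) ^ c l) * cofactorPoly z i) := by
  rw [derivative_prod_finset]
  refine sum_congr rfl fun i _ => ?_
  rw [← prod_erase_pow_succ_mul_pow, derivative_pow]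
  simp
  ring

lemma coeffwise_prod_pow_succ {R : Type*} [CommRing R] [Algebra R A]
    {d : Derivation R A A} {D : Derivation ℤ A[X] A[X]}
    (hD : ∀ p i, (D p).coeff i = d (p.coeff i)) (z : Fin m → A) (c : Fin m → ℕ) (i : Fin m)
    (hd : ∀ l, d (z l) = if l = i then 1 else 0) :
    D (∏ l, (X - C (z l)) ^ (c l + 1)) =
      C (-((c i : A) + 1)) * ((∏ l, (X - C (z l)) ^ c l) * cofactorPoly z i) := by
  have hlin : ∀ l, D (X - C (z l)) = if l = i then -1 else 0 := by
    intro l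
    ext j
    rw [hD, coeff_sub, map_sub, coeff_X, coeff_C]
    split_ifs with h1 h2 h3 h4 <;> simp_all [coeff_one]
  rw [← mul_prod_erase univ (fun l => (X - C (z l)) ^ (c l + 1)) (mem_univ i),
    Derivation.leibniz, ← prod_erase_pow_succ_mul_pow]
  have h0 : D (∏ l ∈ univ.erase i, (X - C (z l)) ^ (c l + 1)) = 0 := by
    refine Finset.prod_induction _ (fun q => D q = 0) (fun p q hp hq => ?_) (by simp) ?_
    · rw [Derivation.leibniz, hp, hq]; simp
    · intro l hl
      rw [Derivation.leibniz_pow, hlin, if_neg (ne_of_mem_erase hl)]; simp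
  rw [h0, Derivation.leibniz_pow, hlin, if_pos rfl]
  simp
  ring

variable [Algebra ℚ A]

/-- The matrix of integrals `∫_0^{z j} ∏ l, (w - z l) ^ c l * ∏_{l ≠ i} (w - z l) dw`. -/
noncomputable def periodMatrix (z : Fin m → A) (c : Fin m → ℕ) : Matrix (Fin m) (Fin m) A :=
  Matrix.of fun i j => integralTo (z j) ((∏ l, (X - C (z l)) ^ c l) * cofactorPoly z i)

lemma periodMatrix_apply (z : Fin m → A) (c : Fin m → ℕ) (i j : Fin m) :
    periodMatrix z c i j = integralTo (z j) ((∏ l, (X - C (z l)) ^ c l) * cofactorPoly z i) := rfl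

/-- Integrating the exact form `d (w ∏ l, (w - z l) ^ (c l + 1))`. -/
lemma integralTo_prod_mul_prod (z : Fin m → A) (c : Fin m → ℕ) (j : Fin m) :
    (1 + ∑ l, ((c l : A) + 1)) *
        integralTo (z j) ((∏ l, (X - C (z l)) ^ c l) * ∏ l, (X - C (z l))) =
      -∑ l, ((c l : A) + 1) * z l * periodMatrix z c l j := by
  have h := integralTo_derivative (z j) (X * ∏ l, (X - C (z l)) ^ (c l + 1))
  have hz : (X * ∏ l, (X - C (z l)) ^ (c l + 1)).eval (z j) = 0 := by
    rw [eval_mul, eval_prod, prod_eq_zero (mem_univ j) (by simp), mul_zero]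
  set R : A[X] := ∏ l, (X - C (z l)) ^ c l with hR
  set Q : A[X] := ∏ l, (X - C (z l)) with hQ
  have hder : derivative (X * ∏ l, (X - C (z l)) ^ (c l + 1)) =
      (1 + ∑ l, ((c l : A) + 1)) • (R * Q) +
        ∑ l, (((c l : A) + 1) * z l) • (R * cofactorPoly z l) := by
    rw [derivative_mul, derivative_prod_pow_succ, derivative_X, one_mul, add_smul, one_smul,
      sum_smul, add_assoc, ← sum_add_distrib, mul_sum]
    congr 1
    · simp only [pow_succ, prod_mul_distrib, hR, hQ]
    · refine sum_congr rfl fun l _ => ?_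
      rw [hQ, ← X_sub_C_mul_cofactorPoly z l, ← hR, smul_eq_C_mul, smul_eq_C_mul, C_mul]
      ring
  rw [hz, mul_coeff_zero, coeff_X_zero, zero_mul, sub_zero, hder, map_add, map_smul, map_sum] at h
  simp only [map_smul, smul_eq_mul] at h
  simp only [periodMatrix_apply, ← hR]
  linear_combination h

/-- Raising one exponent multiplies the period matrix by a diagonal plus rank one matrix. -/
lemma det_periodMatrix_add_single (z : Fin m → A) (c : Fin m → ℕ) (k : Fin m) :
    (1 + ∑ l, ((c l : A) + 1)) * (periodMatrix z (c + Pi.single k 1)).det =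
      -((c k : A) + 1) * z k * (∏ l ∈ univ.erase k, (z l - z k)) * (periodMatrix z c).det := by
  obtain ⟨r, hr⟩ : ∃ r : A, r * (1 + ∑ l, ((c l : A) + 1)) = 1 := by
    refine ⟨algebraMap ℚ A (1 / (1 + ∑ l, ((c l : ℚ) + 1))), ?_⟩
    have h1 : (1 + ∑ l, ((c l : A) + 1)) = algebraMap ℚ A (1 + ∑ l, ((c l : ℚ) + 1)) := by simp
    rw [h1, ← map_mul, one_div_mul_cancel (by positivity), map_one]
  set N : A := 1 + ∑ l, ((c l : A) + 1) with hN
  let b : Fin m → A := fun l => -(r * (((c l : A) + 1) * z l))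
  let B : Matrix (Fin m) (Fin m) A := (Matrix.diagonal fun i => z i - z k).updateRow k b
  have hB : B.det = b k * ∏ l ∈ univ.erase k, (z l - z k) := by
    rw [← Matrix.cramer_transpose_apply, Matrix.cramer_eq_adjugate_mulVec,
      Matrix.diagonal_transpose, Matrix.adjugate_diagonal, Matrix.mulVec_diagonal, mul_comm]
  let T : Matrix (Fin m) (Fin m) A :=
    Matrix.of fun i l => B i l + (if i = k then 0 else 1) * B k l
  have hT : T.det = B.det :=
    Matrix.det_eq_of_forall_row_eq_smul_add_const (fun i => if i = k then 0 else 1) k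
      (if_pos rfl) fun _ _ => rfl
  have hTapp : ∀ i l, T i l = (if i = l then z i - z k else 0) + b l := by
    intro i l
    by_cases hi : i = k
    · subst hi; simp [T, B]
    · simp [T, B, hi, Matrix.diagonal_apply]
  have hmul : periodMatrix z (c + Pi.single k 1) = T * periodMatrix z c := by
    ext i j
    have hexact : integralTo (z j) ((∏ l, (X - C (z l)) ^ c l) * ∏ l, (X - C (z l))) =
        ∑ l, b l * periodMatrix z c l j := by
      have h := integralTo_prod_mul_prod z c j
      rw [← hN] at h
      simp only [b, neg_mul, sum_neg_distrib, mul_assoc, ← mul_sum] at h ⊢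
      linear_combination r * h - hr * integralTo (z j) _
    have hpow : ∏ l, (X - C (z l)) ^ ((c + Pi.single k 1 : Fin m → ℕ) l) =
        (∏ l, (X - C (z l)) ^ c l) * (X - C (z k)) := by
      simp only [Pi.add_apply, pow_add, prod_mul_distrib]
      congr 1
      rw [prod_eq_single k] <;> simp +contextual
    have hpoly : (∏ l, (X - C (z l)) ^ ((c + Pi.single k 1 : Fin m → ℕ) l)) * cofactorPoly z i =
        (z i - z k) • ((∏ l, (X - C (z l)) ^ c l) * cofactorPoly z i) +
          (∏ l, (X - C (z l)) ^ c l) * ∏ l, (X - C (z l)) := by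
      rw [hpow, ← X_sub_C_mul_cofactorPoly z i, smul_eq_C_mul, C_sub]
      ring
    rw [periodMatrix_apply, hpoly, map_add, map_smul, hexact, Matrix.mul_apply]
    simp [hTapp, add_mul, sum_add_distrib, periodMatrix_apply]
  rw [hmul, Matrix.det_mul, hT, hB]
  simp only [b]
  linear_combination (-((c k : A) + 1) * z k * (∏ l ∈ univ.erase k, (z l - z k)) *
    (periodMatrix z c).det) * hr

lemma det_periodMatrix_zero (z : Fin m → A) :
    (m.factorial : A) * (periodMatrix z 0).det =
      (∏ j, z j) * ∏ j, ∏ k ∈ univ \ {j}, (z k - z j) := by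
  let G : Matrix (Fin m) (Fin m) A := Matrix.of fun i l => (cofactorPoly z i).coeff l
  have hdeg : ∀ i, (cofactorPoly z i).natDegree < m := by
    intro i
    have h1 : (cofactorPoly z i).natDegree ≤ #(univ.erase i) := by
      refine (natDegree_prod_le _ _).trans ?_
      refine (sum_le_card_nsmul _ _ 1 fun l _ => natDegree_X_sub_C_le _).trans (by simp)
    have : 0 < m := i.pos
    rw [card_erase_of_mem (mem_univ i), card_univ, Fintype.card_fin] at h1
    omega
  have hG : G * (Matrix.vandermonde z).transpose =
      Matrix.diagonal fun i => ∏ k ∈ univ.erase i, (z i - z k) := by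
    ext i j
    have h : (G * (Matrix.vandermonde z).transpose) i j = (cofactorPoly z i).eval (z j) := by
      rw [eval_eq_sum_range' (hdeg i), ← Fin.sum_univ_eq_sum_range
        (fun l => (cofactorPoly z i).coeff l * z j ^ l), Matrix.mul_apply]
      rfl
    rw [h, cofactorPoly, eval_prod, Matrix.diagonal_apply]
    split_ifs with hij
    · simp [hij]
    · exact prod_eq_zero (mem_erase.2 ⟨Ne.symm hij, mem_univ j⟩) (by simp)
  have hP : periodMatrix z 0 = G * Matrix.diagonal (fun l : Fin m => algebraMap ℚ A (1 / (l + 1))) *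
      (Matrix.vandermonde z).transpose * Matrix.diagonal z := by
    ext i j
    rw [Matrix.mul_diagonal, Matrix.mul_apply, periodMatrix_apply]
    simp only [Matrix.mul_diagonal, Pi.zero_apply, pow_zero, prod_const_one, one_mul]
    conv_lhs => rw [as_sum_range' _ _ (hdeg i)]
    rw [map_sum, ← Fin.sum_univ_eq_sum_range
      (fun l => integralTo (z j) (monomial l ((cofactorPoly z i).coeff l))), sum_mul]
    refine sum_congr rfl fun l _ => ?_
    rw [integralTo_monomial]
    simp only [G, Matrix.of_apply, Matrix.transpose_apply, Matrix.vandermonde_apply]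
    ring
  have hfac : (m.factorial : A) * ∏ l : Fin m, algebraMap ℚ A (1 / ((l : ℕ) + 1)) = 1 := by
    rw [← prod_range_add_one_eq_factorial, ← Fin.prod_univ_eq_prod_range, Nat.cast_prod,
      ← prod_mul_distrib]
    refine prod_eq_one fun l _ => ?_
    have h1 : (((l : ℕ) + 1 : ℕ) : A) = algebraMap ℚ A (((l : ℕ) : ℚ) + 1) := by simp
    rw [h1, ← map_mul, mul_one_div_cancel (by positivity), map_one]
  have hGV : G.det * (Matrix.vandermonde z).transpose.det =
      ∏ j, ∏ k ∈ univ \ {j}, (z k - z j) := by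
    rw [← Matrix.det_mul, hG, Matrix.det_diagonal]
    simp only [← sdiff_singleton_eq_erase]
    exact prod_comm' (by simp [eq_comm])
  rw [hP, Matrix.det_mul, Matrix.det_mul, Matrix.det_mul, Matrix.det_diagonal, Matrix.det_diagonal,
    ← hGV]
  linear_combination (G.det * (Matrix.vandermonde z).transpose.det * ∏ j, z j) * hfac

/-- The determinant of the period matrix. -/
lemma det_periodMatrix (z : Fin m → A) (c : Fin m → ℕ) :
    ((∑ l, (c l + 1)).factorial : A) * (periodMatrix z c).det =
      (∏ l, ((c l).factorial : A)) * (∏ l, z l) * (∏ l, (-z l) ^ c l) *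
        ∏ j, ∏ k ∈ univ \ {j}, (z k - z j) ^ (c j + 1) := by
  induction hs : ∑ l, c l generalizing c with
  | zero =>
    have hc : c = 0 := by
      funext l
      exact (sum_eq_zero_iff.1 hs) l (mem_univ l)
    subst hc
    simpa using det_periodMatrix_zero z
  | succ s ih =>
    obtain ⟨k, hk⟩ : ∃ k, c k ≠ 0 := by
      by_contra! h
      simp [h] at hs
    obtain ⟨c', rfl⟩ : ∃ c' : Fin m → ℕ, c = c' + Pi.single k 1 := by
      refine ⟨Function.update c k (c k - 1), ?_⟩
      funext l
      by_cases hl : l = k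
      · subst hl; simp; omega
      · simp [hl]
    have hsum : ∑ l, (c' + Pi.single k 1 : Fin m → ℕ) l = ∑ l, c' l + 1 := by
      simp [sum_add_distrib]
    have hstep := det_periodMatrix_add_single z c' k
    have ih' := ih c' (by omega)
    have hfac : (∑ l, ((c' + Pi.single k 1 : Fin m → ℕ) l + 1)) = ∑ l, (c' l + 1) + 1 := by
      rw [sum_add_distrib, hsum, sum_add_distrib]; omega
    have h1 : ∏ l, (((c' + Pi.single k 1 : Fin m → ℕ) l).factorial : A) =
        ((c' k : A) + 1) * ∏ l, ((c' l).factorial : A) := by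
      rw [← mul_prod_erase univ _ (mem_univ k),
        ← mul_prod_erase univ (fun l => ((c' l).factorial : A)) (mem_univ k), ← mul_assoc]
      congr 1
      · simp [Nat.factorial_succ]
      · exact prod_congr rfl fun l hl => by simp [ne_of_mem_erase hl]
    have h2 : ∏ l, (-z l) ^ ((c' + Pi.single k 1 : Fin m → ℕ) l) =
        (-z k) * ∏ l, (-z l) ^ c' l := by
      simp only [Pi.add_apply, pow_add, prod_mul_distrib]
      rw [mul_comm]
      congr 1
      rw [prod_eq_single k] <;> simp +contextual
    have h3 : ∏ j, ∏ l ∈ univ \ {j}, (z l - z j) ^ ((c' + Pi.single k 1 : Fin m → ℕ) j + 1) =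
        (∏ l ∈ univ.erase k, (z l - z k)) *
          ∏ j, ∏ l ∈ univ \ {j}, (z l - z j) ^ (c' j + 1) := by
      simp only [Pi.add_apply, add_right_comm _ _ 1, pow_add _ (_ + 1), prod_mul_distrib]
      rw [mul_comm]
      congr 1
      rw [prod_eq_single k] <;> simp +contextual [sdiff_singleton_eq_erase]
    rw [hfac, Nat.factorial_succ, h1, h2, h3]
    push_cast at hstep ih' ⊢
    linear_combination ((∑ l, (c' l + 1)).factorial : A) * hstep -
      ((c' k : A) + 1) * z k * (∏ l ∈ univ.erase k, (z l - z k)) * ih'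

end JacobianDeterminant

/-- **Jacobian determinant factorization (Theorem B).**
For an `m`-tuple `a` of positive integers with `n = a 1 + ⋯ + a m`, and
`p_a(z) = ∫_0^z (w - z_1)^{a_1} ⋯ (w - z_m)^{a_m} dw` (characterized by having monic
derivative `∏ (w - z_i)^{a_i}` and no constant term), the Jacobian matrix `J` with
`(i,j)` entry `∂/∂z_i (p_a(z_j))` has determinant
`(1/multinomial(n; a)) ⬝ ∏_j (-z_j)^{a_j} ⬝ ∏_{j ≠ k} (z_k - z_j)^{a_j}`, and at a point
`z ∈ ℂ^m` the matrix is invertible iff the entries of `z` are distinct and nonzero. -/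
theorem jacobian_det_factorization_general
    (m n : ℕ) (a : Fin m → ℕ) (ha : ∀ i, 0 < a i) (hn : n = ∑ i, a i)
    (p : Polynomial (MvPolynomial (Fin m) ℂ))
    (hp : Polynomial.derivative p =
      ∏ i, (Polynomial.X - Polynomial.C (MvPolynomial.X i)) ^ a i)
    (hp0 : p.coeff 0 = 0)
    (J : Matrix (Fin m) (Fin m) (MvPolynomial (Fin m) ℂ))
    (hJ : ∀ i j, J i j = MvPolynomial.pderiv i (Polynomial.eval (MvPolynomial.X j) p)) :
    J.det = ((Nat.multinomial Finset.univ a : ℂ))⁻¹ •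
        ((∏ j, (-(MvPolynomial.X j : MvPolynomial (Fin m) ℂ)) ^ a j) *
          ∏ j, ∏ k ∈ Finset.univ \ {j},
            (MvPolynomial.X k - MvPolynomial.X j) ^ a j) ∧
    ∀ z : Fin m → ℂ,
      (Matrix.of fun i j => MvPolynomial.eval z (J i j)).det ≠ 0 ↔
        Function.Injective z ∧ ∀ i, z i ≠ 0 := by
  subst hn
  obtain ⟨c, rfl⟩ : ∃ c : Fin m → ℕ, a = fun i => c i + 1 :=
    ⟨fun i => a i - 1, funext fun i => (Nat.sub_add_cancel (ha i)).symm⟩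
  let x : Fin m → MvPolynomial (Fin m) ℂ := MvPolynomial.X
  have hJ' : J = Matrix.diagonal (fun i => -((c i : MvPolynomial (Fin m) ℂ) + 1)) *
      periodMatrix x c := by
    ext1 i j
    obtain ⟨D, hD, hchain⟩ :=
      exists_coeffwise_derivation (MvPolynomial.pderiv (R := ℂ) i)
    have hint := integralTo_derivative (x j) (D p)
    rw [derivative_comm_of_coeffwise hD, hp, hD, hp0, map_zero, sub_zero,
      coeffwise_prod_pow_succ hD x c i
        (fun l => by simp [x, MvPolynomial.pderiv_X, Pi.single_apply, eq_comm]),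
      ← smul_eq_C_mul, map_smul, smul_eq_mul] at hint
    have hcrit : (derivative p).eval (x j) = 0 := by
      rw [hp, eval_prod]
      exact Finset.prod_eq_zero (Finset.mem_univ j) (by simp [x])
    have h := hchain (x j) p
    rw [hcrit, zero_mul, add_zero, ← hint] at h
    rw [hJ, Matrix.diagonal_mul, periodMatrix_apply]
    exact h
  have hmul0 : (Nat.multinomial Finset.univ (fun i => c i + 1) : ℂ) ≠ 0 :=
    Nat.cast_ne_zero.2 (Nat.multinomial_pos _ _).ne'
  have hdet : J.det = ((Nat.multinomial Finset.univ fun i => c i + 1 : ℂ))⁻¹ •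
      ((∏ j, (-(MvPolynomial.X j : MvPolynomial (Fin m) ℂ)) ^ (c j + 1)) *
        ∏ j, ∏ k ∈ Finset.univ \ {j},
          (MvPolynomial.X k - MvPolynomial.X j) ^ (c j + 1)) := by
    have hfac0 : (∏ i, ((c i + 1).factorial : MvPolynomial (Fin m) ℂ)) ≠ 0 :=
      Finset.prod_ne_zero_iff.2 fun i _ => Nat.cast_ne_zero.2 (Nat.factorial_ne_zero _)
    rw [eq_inv_smul_iff₀ hmul0, MvPolynomial.smul_eq_C_mul, map_natCast]
    apply mul_left_cancel₀ hfac0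
    have hspec : (∏ i, ((c i + 1).factorial : MvPolynomial (Fin m) ℂ)) *
        (Nat.multinomial Finset.univ (fun i => c i + 1) : MvPolynomial (Fin m) ℂ) =
        ((∑ i, (c i + 1)).factorial : MvPolynomial (Fin m) ℂ) := by
      exact_mod_cast congrArg (Nat.cast (R := MvPolynomial (Fin m) ℂ))
        (Nat.multinomial_spec Finset.univ fun i => c i + 1)
    have hfac : (∏ i, ((c i + 1).factorial : MvPolynomial (Fin m) ℂ)) =
        (∏ i, ((c i : MvPolynomial (Fin m) ℂ) + 1)) *
          ∏ i, ((c i).factorial : MvPolynomial (Fin m) ℂ) := by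
      simp [Nat.factorial_succ, Finset.prod_mul_distrib]
    have hperiod := det_periodMatrix x c
    have hsign : (∏ i, -((c i : MvPolynomial (Fin m) ℂ) + 1)) * ∏ i, x i =
        (∏ i, ((c i : MvPolynomial (Fin m) ℂ) + 1)) * ∏ i, -x i := by
      simp only [← Finset.prod_mul_distrib, neg_mul, mul_neg]
    rw [← mul_assoc, hspec, hfac, hJ', Matrix.det_mul, Matrix.det_diagonal]
    change _ = _ * ((∏ i, (-x i) ^ (c i + 1)) *
      ∏ j, ∏ k ∈ Finset.univ \ {j}, (x k - x j) ^ (c j + 1))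
    simp only [pow_succ (-x _), Finset.prod_mul_distrib]
    linear_combination (∏ i, -((c i : MvPolynomial (Fin m) ℂ) + 1)) * hperiod +
      (∏ l, ((c l).factorial : MvPolynomial (Fin m) ℂ)) * (∏ l, (-x l) ^ c l) *
        (∏ j, ∏ k ∈ Finset.univ \ {j}, (x k - x j) ^ (c j + 1)) * hsign
  refine ⟨hdet, fun z => ?_⟩
  have heval : (Matrix.of fun i j => MvPolynomial.eval z (J i j)).det =
      MvPolynomial.eval z J.det := by
    rw [RingHom.map_det]
    rfl
  rw [heval, hdet, MvPolynomial.smul_eval]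
  simp only [map_mul, map_prod, map_pow, map_neg, map_sub, MvPolynomial.eval_X, ne_eq,
    mul_eq_zero, inv_eq_zero, hmul0, false_or, not_or, Finset.prod_eq_zero_iff,
    Finset.mem_univ, true_and, not_exists, pow_eq_zero_iff (Nat.succ_ne_zero _), neg_eq_zero,
    Finset.mem_sdiff, Finset.mem_singleton, sub_eq_zero, not_and]
  rw [and_comm]
  refine and_congr_left fun _ => ⟨fun h i j hij => ?_, fun h i j hij hz => hij (h hz)⟩
  by_contra hne
  exact h j i hne hij
end

section
/- Let z_1,…,z_n be commuting variables, let p(z) = ∫_0^z (w−z_1)⋯(w−z_n) dw, and let J be the n×n matrix over ℂ[z_1,…,z_n] with (i,j)-entry ∂/∂z_i (p(z_j)). Then det J = (1/n!) · (∏_{j=1}^n (−z_j)) · (∏_{j≠k, j,k ∈ [n]} (z_k − z_j)). Consequently, for a point (z_1,…,z_n) ∈ ℂ^n, the matrix J is invertible if and only if z_1,…,z_n are distinct and nonzero. -/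
theorem Derivation.apply_eval_eq_sum_range {R A : Type*} [CommSemiring R] [CommSemiring A]
    [Algebra R A] (D : Derivation R A A) {p : Polynomial A} {N : ℕ} (hN : p.natDegree < N)
    (x : A) :
    D (p.eval x) =
      ∑ m ∈ Finset.range N, D (p.coeff m) * x ^ m + p.derivative.eval x * D x := by
  have hd : p.derivative.eval x =
      ∑ m ∈ Finset.range N, p.coeff m * (m * x ^ (m - 1)) := by
    conv_lhs => rw [p.as_sum_range' N hN]
    simp only [Polynomial.derivative_sum, Polynomial.eval_finsetSum,
      Polynomial.derivative_monomial, Polynomial.eval_monomial, mul_assoc]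
  rw [Polynomial.eval_eq_sum_range' hN, map_sum, hd, Finset.sum_mul, ← Finset.sum_add_distrib]
  refine Finset.sum_congr rfl fun m _ => ?_
  simp only [Derivation.leibniz, Derivation.leibniz_pow, smul_eq_mul, nsmul_eq_mul]
  ring

open Polynomial in
/-- Differentiating the coefficients of `∏ (X - z_k)` with respect to `z_i` deletes the `i`-th
factor and changes the sign. -/
theorem pderiv_coeff_prod_X_sub_C {R σ : Type*} [CommRing R] [DecidableEq σ]
    [Fintype σ] (i : σ) (m : ℕ) :
    MvPolynomial.pderiv i
        ((∏ k : σ, (X - C (MvPolynomial.X k : MvPolynomial σ R))).coeff m) =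
      -(∏ k ∈ Finset.univ.erase i, (X - C (MvPolynomial.X k : MvPolynomial σ R))).coeff m := by
  have hq : ∀ m, MvPolynomial.pderiv i
      ((∏ k ∈ Finset.univ.erase i, (X - C (MvPolynomial.X k : MvPolynomial σ R))).coeff m)
        = 0 := by
    refine Finset.prod_induction _
      (fun q : (MvPolynomial σ R)[X] => ∀ m, MvPolynomial.pderiv i (q.coeff m) = 0) ?_ ?_ ?_
    · intro a b ha hb m
      simp [coeff_mul, Derivation.leibniz, ha, hb]
    · intro m
      rw [coeff_one]
      split_ifs <;> simp
    · intro k hk m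
      rw [coeff_sub, coeff_X, coeff_C]
      split_ifs <;> simp [MvPolynomial.pderiv_X_of_ne (Finset.ne_of_mem_erase hk)]
  rw [← Finset.mul_prod_erase _ _ (Finset.mem_univ i), sub_mul, coeff_sub, coeff_C_mul, map_sub,
    Derivation.leibniz, hq]
  cases m with
  | zero => simp
  | succ m => simp [coeff_X_mul, hq]

open Polynomial in
/-- The determinant of the matrix of coefficients of the polynomials `∏_{k ≠ i} (X - v_k)`,
multiplied by the Vandermonde determinant of `v`. -/
theorem Matrix.det_coeff_prod_erase_mul_det_vandermonde {R : Type*} [CommRing R] {n : ℕ}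
    (v : Fin n → R) :
    (Matrix.of fun i m : Fin n =>
        (∏ k ∈ Finset.univ.erase i, (X - C (v k))).coeff m).det * (vandermonde v).det =
      ∏ i, ∏ k ∈ Finset.univ.erase i, (v i - v k) := by
  rw [← det_transpose (vandermonde v), ← det_mul, ← det_diagonal]
  congr 1
  ext i j : 2
  have hdeg : (∏ k ∈ Finset.univ.erase i, (X - C (v k))).natDegree < n := by
    refine (natDegree_prod_le _ _).trans_lt ?_
    refine (Finset.sum_le_card_nsmul _ _ 1 fun k _ => natDegree_X_sub_C_le _).trans_lt ?_
    have := i.pos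
    simp
    omega
  trans (∏ k ∈ Finset.univ.erase i, (X - C (v k))).eval (v j)
  · rw [eval_eq_sum_range' hdeg, Matrix.mul_apply, Finset.sum_range]
    rfl
  · rw [eval_prod, diagonal_apply]
    split_ifs with h
    · simp [h]
    · exact Finset.prod_eq_zero (Finset.mem_erase.2 ⟨Ne.symm h, Finset.mem_univ j⟩) (by simp)

open Polynomial in
/-- The entries of the Jacobian matrix: `∂/∂z_i (p(z_j)) = -∫_0^{z_j} ∏_{k ≠ i} (w - z_k) dw`. -/
theorem pderiv_eval_antiderivative {n : ℕ} {p : (MvPolynomial (Fin n) ℂ)[X]}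
    (hp : derivative p = ∏ i, (X - C (MvPolynomial.X i))) (hp0 : p.coeff 0 = 0) (i j : Fin n) :
    MvPolynomial.pderiv i (p.eval (MvPolynomial.X j)) =
      ∑ m : Fin n,
        (∏ k ∈ Finset.univ.erase i, (X - C (MvPolynomial.X k : MvPolynomial (Fin n) ℂ))).coeff m *
          (MvPolynomial.C ((m : ℂ) + 1)⁻¹ * (-MvPolynomial.X j * MvPolynomial.X j ^ (m : ℕ))) := by
  have hdeg : p.natDegree < n + 2 := by
    have h : (derivative p).natDegree = n := by
      rw [hp, natDegree_prod_of_monic _ _ fun k _ => monic_X_sub_C _]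
      simp
    rw [natDegree_derivative] at h
    omega
  have hroot : (derivative p).eval (MvPolynomial.X j) = 0 := by
    rw [hp, eval_prod]
    exact Finset.prod_eq_zero (Finset.mem_univ j) (by simp)
  have hcoeff (m : ℕ) : MvPolynomial.pderiv i (p.coeff (m + 1)) =
      -((∏ k ∈ Finset.univ.erase i,
          (X - C (MvPolynomial.X k : MvPolynomial (Fin n) ℂ))).coeff m *
        MvPolynomial.C ((m : ℂ) + 1)⁻¹) := by
    have h := pderiv_coeff_prod_X_sub_C (R := ℂ) i m
    have hc : (m : MvPolynomial (Fin n) ℂ) + 1 = MvPolynomial.C ((m : ℂ) + 1) := by simp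
    rw [← hp, coeff_derivative, hc, Derivation.leibniz, MvPolynomial.pderiv_C, smul_zero,
      zero_add, smul_eq_mul] at h
    rw [← neg_mul, ← h, mul_right_comm, ← MvPolynomial.C_mul,
      mul_inv_cancel₀ (Nat.cast_add_one_ne_zero m), MvPolynomial.C_1, one_mul]
  have htop : (∏ k ∈ Finset.univ.erase i,
      (X - C (MvPolynomial.X k : MvPolynomial (Fin n) ℂ))).coeff n = 0 := by
    refine coeff_eq_zero_of_natDegree_lt ?_
    rw [natDegree_prod_of_monic _ _ fun k _ => monic_X_sub_C _]
    have := i.pos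
    simp
    omega
  rw [Derivation.apply_eval_eq_sum_range _ hdeg, hroot, zero_mul, add_zero,
    Finset.sum_range_succ', Finset.sum_range_succ, hp0, hcoeff n, htop, map_zero, zero_mul,
    zero_mul, neg_zero, zero_mul, add_zero, add_zero, Finset.sum_range]
  refine Finset.sum_congr rfl fun m _ => ?_
  rw [hcoeff]
  ring


/-- **Theorem A.** For commuting variables `z_1, …, z_n` and
`p(z) = ∫_0^z (w - z_1) ⋯ (w - z_n) dw` (characterized by having monic derivative
`∏ (w - z_i)` and no constant term), the Jacobian matrix `J` with `(i,j)` entry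
`∂/∂z_i (p(z_j))` has determinant `(1/n!) ⬝ ∏_j (-z_j) ⬝ ∏_{j ≠ k} (z_k - z_j)`, and at a
point `z ∈ ℂ^n` the matrix is invertible iff the entries of `z` are distinct and nonzero. -/
theorem jacobian_det_factorization
    (n : ℕ)
    (p : Polynomial (MvPolynomial (Fin n) ℂ))
    (hp : Polynomial.derivative p =
      ∏ i, (Polynomial.X - Polynomial.C (MvPolynomial.X i)))
    (hp0 : p.coeff 0 = 0)
    (J : Matrix (Fin n) (Fin n) (MvPolynomial (Fin n) ℂ))
    (hJ : ∀ i j, J i j = MvPolynomial.pderiv i (Polynomial.eval (MvPolynomial.X j) p)) :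
    J.det = ((n.factorial : ℂ))⁻¹ •
        ((∏ j, (-(MvPolynomial.X j : MvPolynomial (Fin n) ℂ))) *
          ∏ j, ∏ k ∈ Finset.univ \ {j},
            (MvPolynomial.X k - MvPolynomial.X j)) ∧
    ∀ z : Fin n → ℂ,
      (Matrix.of fun i j => MvPolynomial.eval z (J i j)).det ≠ 0 ↔
        Function.Injective z ∧ ∀ i, z i ≠ 0 := by
  have hdet : J.det = ((n.factorial : ℂ))⁻¹ •
      ((∏ j, (-(MvPolynomial.X j : MvPolynomial (Fin n) ℂ))) *
        ∏ j, ∏ k ∈ Finset.univ \ {j}, (MvPolynomial.X k - MvPolynomial.X j)) := by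
    have hfact : ∏ m : Fin n, (MvPolynomial.C ((m : ℂ) + 1)⁻¹ : MvPolynomial (Fin n) ℂ) =
        MvPolynomial.C ((n.factorial : ℂ))⁻¹ := by
      rw [← map_prod, Finset.prod_inv_distrib, ← Finset.prod_range_add_one_eq_factorial,
        Finset.prod_range]
      simp
    have hswap : ∏ j, ∏ k ∈ Finset.univ \ {j},
          (MvPolynomial.X k - MvPolynomial.X j : MvPolynomial (Fin n) ℂ) =
        ∏ i, ∏ k ∈ Finset.univ.erase i, (MvPolynomial.X i - MvPolynomial.X k) :=
      Finset.prod_comm' (by simp [eq_comm])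
    have hJ' : J = (Matrix.of fun i m : Fin n => (∏ k ∈ Finset.univ.erase i, (Polynomial.X -
          Polynomial.C (MvPolynomial.X k : MvPolynomial (Fin n) ℂ))).coeff m) *
        Matrix.of fun m j : Fin n => MvPolynomial.C ((m : ℂ) + 1)⁻¹ *
          (Matrix.of fun m j : Fin n => -MvPolynomial.X j *
            (Matrix.vandermonde MvPolynomial.X).transpose m j) m j := by
      ext1 i j
      rw [hJ, pderiv_eval_antiderivative hp hp0, Matrix.mul_apply]
      rfl
    rw [hJ', Matrix.det_mul, Matrix.det_mul_column, Matrix.det_mul_row, Matrix.det_transpose,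
      hfact, hswap, ← Matrix.det_coeff_prod_erase_mul_det_vandermonde, MvPolynomial.smul_eq_C_mul]
    ring
  refine ⟨hdet, fun z => ?_⟩
  have hz : (Matrix.of fun i j => MvPolynomial.eval z (J i j)).det =
      MvPolynomial.eval z J.det := ((MvPolynomial.eval z).map_det J).symm
  rw [hz, hdet, MvPolynomial.smul_eval]
  simp only [map_mul, map_prod, map_neg, map_sub, MvPolynomial.eval_X, ne_eq, mul_eq_zero,
    inv_eq_zero, Nat.cast_eq_zero, n.factorial_ne_zero, false_or, not_or, Finset.prod_eq_zero_iff,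
    neg_eq_zero, sub_eq_zero, Finset.mem_univ, Finset.mem_sdiff, Finset.mem_singleton, true_and,
    not_exists, not_and]
  rw [and_comm]
  refine and_congr_left' ⟨fun h a b hab => ?_, fun h a b hba hab => hba (h hab)⟩
  by_contra hne
  exact h b a hne hab
end

section
/- Let λ be a partition of [n] = {1,…,n}, let ℂ^λ = { z ∈ ℂ^n : z_i = z_j if and only if i and j lie in the same block of λ }, and let the closure of ℂ^λ be the linear subspace { z ∈ ℂ^n : z_i = z_j whenever i and j lie in the same block of λ }. Then the map θ, sending z = (z_1,…,z_n) to (p_z(z_1),…,p_z(z_n)) where p_z(z) = ∫_0^z (w−z_1)⋯(w−z_n) dw, maps ℂ^λ into the closure of ℂ^λ, and the restricted map θ_λ : ℂ^λ → closure(ℂ^λ) is a local homeomorphism at every point z ∈ ℂ^λ all of whose entries are nonzero; that is, there are an open neighborhood U of z in ℂ^λ and an open neighborhood V of θ(z) in closure(ℂ^λ) such that θ restricts to a homeomorphism from U onto V. -/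
/-- The stratum `ℂ^λ` of `ℂ^n` associated to a partition of `{1, …, n}` (encoded as a
setoid on `Fin n`, whose blocks are the equivalence classes): the points whose entries
`z i` and `z j` are equal exactly when `i` and `j` lie in the same block. -/
def stratum (n : ℕ) (s : Setoid (Fin n)) : Set (Fin n → ℂ) :=
  {z | ∀ i j, z i = z j ↔ s i j}

/-- The closure of the stratum `ℂ^λ`: the linear subspace of points whose entries `z i`
and `z j` are equal whenever `i` and `j` lie in the same block. -/
def stratumClosure (n : ℕ) (s : Setoid (Fin n)) : Set (Fin n → ℂ) :=
  {z | ∀ i j, s i j → z i = z j}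

open Polynomial in
/-- The antiderivative without constant term of the truncation of `p` to degrees below `N`. -/
noncomputable def truncPrimitive (N : ℕ) (p : Polynomial ℂ) : Polynomial ℂ :=
  ∑ k ∈ Finset.range N, monomial (k + 1) (p.coeff k / ((k : ℂ) + 1))

open Polynomial in
lemma derivative_truncPrimitive {N : ℕ} {p : ℂ[X]} (hp : p.natDegree < N) :
    derivative (truncPrimitive N p) = p := by
  conv_rhs => rw [p.as_sum_range' N hp]
  rw [truncPrimitive, derivative_sum]
  refine Finset.sum_congr rfl fun k _ => ?_
  rw [derivative_monomial]
  have : (k : ℂ) + 1 ≠ 0 := by exact_mod_cast k.succ_ne_zero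
  push_cast
  rw [div_mul_cancel₀ _ this]

open Polynomial in
lemma coeff_zero_truncPrimitive (N : ℕ) (p : ℂ[X]) : (truncPrimitive N p).coeff 0 = 0 := by
  simp [truncPrimitive, coeff_monomial]

open Polynomial in
lemma eval_truncPrimitive (N : ℕ) (p : ℂ[X]) (x : ℂ) :
    (truncPrimitive N p).eval x =
      ∑ k ∈ Finset.range N, p.coeff k / ((k : ℂ) + 1) * x ^ (k + 1) := by
  simp [truncPrimitive, eval_finsetSum]

open Polynomial in
lemma contDiff_coeff_prod_X_sub_C {ι : Type*} [Fintype ι] (S : Finset ι) (k : ℕ) :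
    ContDiff ℂ 1 fun z : ι → ℂ => (∏ i ∈ S, (X - C (z i))).coeff k := by
  classical
  induction S using Finset.induction_on generalizing k with
  | empty => simpa using contDiff_const
  | insert a S ha ih =>
    simp only [Finset.prod_insert ha, sub_mul, coeff_sub, coeff_C_mul]
    refine ContDiff.sub ?_ ((contDiff_apply ℂ ℂ a).mul (ih k))
    cases k with
    | zero => simpa using contDiff_const
    | succ k => simpa using ih k

open Polynomial in
lemma hasDerivAt_coeff_prod_X_sub_C {ι : Type*} [DecidableEq ι] (S : Finset ι) (z v : ι → ℂ)
    (k : ℕ) :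
    HasDerivAt (fun t : ℂ => (∏ i ∈ S, (X - C (z i + t * v i))).coeff k)
      ((∑ i ∈ S, C (-v i) * ∏ j ∈ S.erase i, (X - C (z j))).coeff k) 0 := by
  induction S using Finset.induction_on generalizing k with
  | empty => simpa using hasDerivAt_const (0 : ℂ) _
  | insert a S ha ih =>
    have hsum : ∑ i ∈ insert a S, C (-v i) * ∏ j ∈ (insert a S).erase i, (X - C (z j)) =
        C (-v a) * ∏ j ∈ S, (X - C (z j)) +
          (X - C (z a)) * ∑ i ∈ S, C (-v i) * ∏ j ∈ S.erase i, (X - C (z j)) := by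
      rw [Finset.sum_insert ha, Finset.erase_insert ha, Finset.mul_sum]
      congr 1
      refine Finset.sum_congr rfl fun i hi => ?_
      have hia : a ≠ i := fun h => ha (h ▸ hi)
      rw [Finset.erase_insert_of_ne hia,
        Finset.prod_insert (fun h => ha (Finset.mem_of_mem_erase h))]
      ring
    rw [hsum]
    simp only [Finset.prod_insert ha, sub_mul, coeff_sub, coeff_add, coeff_C_mul]
    have hX : HasDerivAt (fun t : ℂ => (X * ∏ i ∈ S, (X - C (z i + t * v i))).coeff k)
        ((X * ∑ i ∈ S, C (-v i) * ∏ j ∈ S.erase i, (X - C (z j))).coeff k) 0 := by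
      cases k with
      | zero => simpa using hasDerivAt_const (0 : ℂ) _
      | succ k => simpa only [coeff_X_mul] using ih k
    have hl : HasDerivAt (fun t : ℂ => z a + t * v a) (v a) 0 := by
      simpa using ((hasDerivAt_id (0 : ℂ)).mul_const (v a)).const_add (z a)
    refine (hX.sub (hl.mul (ih k))).congr_deriv ?_
    simp only [zero_mul, add_zero]
    ring

open Polynomial in
lemma rootMultiplicity_prod_X_sub_C {ι : Type*} (S : Finset ι) (z : ι → ℂ) (a : ℂ) :
    (∏ i ∈ S, (X - C (z i))).rootMultiplicity a = (S.val.map z).count a := by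
  have : ∏ i ∈ S, (X - C (z i)) = ((S.val.map z).map fun b => X - C b).prod := by
    rw [Multiset.map_map]; rfl
  rw [← count_roots, this, roots_multiset_prod_X_sub_C]

open Polynomial in
/-- A combination of the products omitting one factor `X - z i`, with weights depending only on
the value `z i`, vanishes only if all the weights do. -/
lemma eq_zero_of_sum_prod_erase_eq_zero {ι : Type*} [Fintype ι] [DecidableEq ι] {z v : ι → ℂ}
    (hv : ∀ i j, z i = z j → v i = v j)
    (h : ∑ i, C (v i) * ∏ j ∈ Finset.univ.erase i, (X - C (z j)) = 0) : v = 0 := by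
  funext a
  by_contra hva
  set m := (Finset.univ.val.map z).count (z a) with hm
  have hne : ∀ S : Finset ι, ∏ j ∈ S, (X - C (z j)) ≠ 0 := fun S =>
    Finset.prod_ne_zero_iff.2 fun j _ => X_sub_C_ne_zero _
  have herase : ∀ i, (X - C (z i)) * ∏ j ∈ Finset.univ.erase i, (X - C (z j)) =
      ∏ j, (X - C (z j)) := fun i => Finset.mul_prod_erase _ _ (Finset.mem_univ i)
  have hcount : ∀ i, (X - C (z i)).rootMultiplicity (z a) +
      (∏ j ∈ Finset.univ.erase i, (X - C (z j))).rootMultiplicity (z a) = m := fun i => by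
    rw [← rootMultiplicity_mul (by rw [herase]; exact hne _), herase,
      rootMultiplicity_prod_X_sub_C]
  rw [← Finset.sum_filter_add_sum_filter_not Finset.univ (fun i => z i = z a)] at h
  have hsame : ∑ i with z i = z a, C (v i) * ∏ j ∈ Finset.univ.erase i, (X - C (z j)) =
      C ((({i | z i = z a} : Finset ι).card : ℂ) * v a) *
        ∏ j ∈ Finset.univ.erase a, (X - C (z j)) := by
    rw [Finset.sum_congr rfl (g := fun _ => C (v a) * ∏ j ∈ Finset.univ.erase a, (X - C (z j)))]
    · simp [mul_assoc]
    · intro i hi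
      have hi : z i = z a := by simpa using hi
      rw [hv i a hi]
      congr 1
      refine mul_left_cancel₀ (X_sub_C_ne_zero (z a)) ?_
      rw [herase a, ← herase i, hi]
  have hother : (X - C (z a)) ^ m ∣
      ∑ i with ¬ z i = z a, C (v i) * ∏ j ∈ Finset.univ.erase i, (X - C (z j)) := by
    refine Finset.dvd_sum fun i hi => Dvd.dvd.mul_left ?_ _
    have hi : ¬ z i = z a := by simpa using hi
    refine (le_rootMultiplicity_iff (hne _)).1 ?_
    have := hcount i
    rw [rootMultiplicity_X_sub_C, if_neg (Ne.symm hi)] at this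
    omega
  have hdvd := (dvd_add_left hother).1 (h ▸ dvd_zero ((X - C (z a)) ^ m))
  have hc : (({i | z i = z a} : Finset ι).card : ℂ) * v a ≠ 0 := by
    refine mul_ne_zero ?_ hva
    exact_mod_cast (Finset.card_pos.2 ⟨a, by simp⟩).ne'
  rw [hsame, (isUnit_C.2 hc.isUnit).dvd_mul_left, ← le_rootMultiplicity_iff (hne _)] at hdvd
  have := hcount a
  rw [rootMultiplicity_X_sub_C_self] at this
  omega

open Polynomial in
lemma eq_zero_of_derivative_eq_sum_prod_erase {ι : Type*} [Fintype ι] [DecidableEq ι]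
    {z v : ι → ℂ} (hv : ∀ i j, z i = z j → v i = v j) (hz : ∀ i, z i ≠ 0) {Q : ℂ[X]}
    (hQ : derivative Q = ∑ i, C (v i) * ∏ j ∈ Finset.univ.erase i, (X - C (z j)))
    (hQ0 : Q.eval 0 = 0) (hQz : ∀ i, Q.eval (z i) = 0) : v = 0 := by
  by_contra hv0
  have hQ' : derivative Q ≠ 0 := fun h => hv0 (eq_zero_of_sum_prod_erase_eq_zero hv (hQ ▸ h))
  have hQne : Q ≠ 0 := by rintro rfl; simp at hQ'
  obtain ⟨a, -⟩ := Function.ne_iff.1 hv0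
  have hle : (0 : ℂ) ::ₘ Finset.univ.val.map z ≤ Q.roots := by
    rw [Multiset.le_iff_count]
    intro b
    rw [count_roots]
    by_cases hb : b = 0
    · subst hb
      have : (Finset.univ.val.map z).count 0 = 0 := Multiset.count_eq_zero.2 (by simpa using hz)
      rw [Multiset.count_cons_self, this]
      exact (rootMultiplicity_pos hQne).2 hQ0
    rw [Multiset.count_cons_of_ne hb]
    by_cases hbz : ∃ i, z i = b
    · obtain ⟨i, rfl⟩ := hbz
      have h1 := derivative_rootMultiplicity_of_root (p := Q) (t := z i) (hQz i)
      have h2 := (rootMultiplicity_pos hQne).2 (hQz i)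
      have h3 : (Finset.univ.val.map z).count (z i) - 1 ≤
          (derivative Q).rootMultiplicity (z i) := by
        rw [le_rootMultiplicity_iff hQ', hQ]
        refine Finset.dvd_sum fun k _ => Dvd.dvd.mul_left ?_ _
        have hne : ∏ j ∈ Finset.univ.erase k, (X - C (z j)) ≠ 0 :=
          Finset.prod_ne_zero_iff.2 fun j _ => X_sub_C_ne_zero _
        rw [← le_rootMultiplicity_iff hne, ← rootMultiplicity_prod_X_sub_C,
          ← Finset.mul_prod_erase _ _ (Finset.mem_univ k),
          rootMultiplicity_mul (mul_ne_zero (X_sub_C_ne_zero _) hne), rootMultiplicity_X_sub_C]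
        split_ifs <;> omega
      omega
    · rw [Multiset.count_eq_zero.2 (by simpa using hbz)]
      exact Nat.zero_le _
  have hcard := (Multiset.card_le_card hle).trans (card_roots' Q)
  simp only [Multiset.card_cons, Multiset.card_map, Finset.card_val, Finset.card_univ] at hcard
  have hdeg : (derivative Q).natDegree ≤ Fintype.card ι - 1 := by
    rw [hQ]
    refine natDegree_sum_le_of_forall_le _ _ fun i _ => (natDegree_C_mul_le _ _).trans ?_
    rw [natDegree_finsetProd_X_sub_C_eq_card, Finset.card_erase_of_mem (Finset.mem_univ i),
      Finset.card_univ]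
  rw [natDegree_derivative] at hdeg
  have := Fintype.card_pos_iff.2 ⟨a⟩
  omega

open Polynomial in
/-- The map `z ↦ (p_z(z_1), …, p_z(z_n))`. -/
noncomputable def thetaMap (n : ℕ) (z : Fin n → ℂ) (j : Fin n) : ℂ :=
  (truncPrimitive (n + 1) (∏ i, (X - C (z i)))).eval (z j)

open Polynomial in
lemma contDiff_thetaMap (n : ℕ) : ContDiff ℂ 1 (thetaMap n) := by
  refine contDiff_pi.2 fun j => ?_
  simp only [thetaMap, eval_truncPrimitive]
  refine ContDiff.sum fun k _ => ContDiff.mul ?_ ((contDiff_apply ℂ ℂ j).pow _)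
  exact (contDiff_coeff_prod_X_sub_C _ k).div_const _

open Polynomial in
lemma hasDerivAt_thetaMap_line {n : ℕ} (z v : Fin n → ℂ) (j : Fin n) :
    HasDerivAt (fun t : ℂ => thetaMap n (fun i => z i + t * v i) j)
      ((truncPrimitive (n + 1)
        (∑ i, C (-v i) * ∏ j ∈ Finset.univ.erase i, (X - C (z j)))).eval (z j)) 0 := by
  simp only [thetaMap, eval_truncPrimitive]
  have hl : HasDerivAt (fun t : ℂ => z j + t * v j) (v j) 0 := by
    simpa using ((hasDerivAt_id (0 : ℂ)).mul_const (v j)).const_add (z j)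
  refine (HasDerivAt.fun_sum fun k _ =>
    ((hasDerivAt_coeff_prod_X_sub_C Finset.univ z v k).div_const ((k : ℂ) + 1)).mul
      (hl.pow (k + 1))).congr_deriv ?_
  rw [Finset.sum_add_distrib]
  simp only [zero_mul, add_zero, Pi.pow_apply, add_eq_left]
  have hroot : (∏ i, (X - C (z i))).eval (z j) = 0 := by
    rw [eval_prod]
    exact Finset.prod_eq_zero (Finset.mem_univ j) (by simp)
  rw [eval_eq_sum_range' (n := n + 1) (by simp)] at hroot
  rw [← zero_mul (v j), ← hroot, Finset.sum_mul]
  refine Finset.sum_congr rfl fun k _ => ?_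
  have : (k : ℂ) + 1 ≠ 0 := by exact_mod_cast k.succ_ne_zero
  push_cast
  field_simp

/-- The map induced by `thetaMap` on families indexed by the blocks. -/
noncomputable def blockTheta {n : ℕ} (s : Setoid (Fin n)) (y : Quotient s → ℂ) :
    Quotient s → ℂ :=
  fun b => thetaMap n (fun i => y (Quotient.mk s i)) b.out

lemma contDiff_blockTheta {n : ℕ} (s : Setoid (Fin n)) [Fintype (Quotient s)] :
    ContDiff ℂ 1 (blockTheta s) := by
  refine contDiff_pi.2 fun b => ?_
  exact (contDiff_pi.1 (contDiff_thetaMap n) b.out).comp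
    (contDiff_pi.2 fun i => contDiff_apply ℂ ℂ (Quotient.mk s i))

lemma blockTheta_mk {n : ℕ} {s : Setoid (Fin n)} (y : Quotient s → ℂ) (i : Fin n) :
    blockTheta s y (Quotient.mk s i) = thetaMap n (fun i => y (Quotient.mk s i)) i := by
  simp only [blockTheta, thetaMap, Quotient.out_eq]

open Polynomial in
lemma fderiv_blockTheta_injective {n : ℕ} {s : Setoid (Fin n)} [Fintype (Quotient s)]
    {y : Quotient s → ℂ} (hy : Function.Injective y) (hy0 : ∀ b, y b ≠ 0) :
    Function.Injective (fderiv ℂ (blockTheta s) y) := by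
  rw [injective_iff_map_eq_zero]
  intro v hv
  set z : Fin n → ℂ := fun i => y (Quotient.mk s i)
  set u : Fin n → ℂ := fun i => v (Quotient.mk s i)
  set q : ℂ[X] := ∑ i, C (-u i) * ∏ j ∈ Finset.univ.erase i, (X - C (z j)) with hq
  have hline : HasDerivAt (fun t : ℂ => y + t • v) v 0 := by
    simpa using ((hasDerivAt_id (0 : ℂ)).smul_const v).const_add y
  have hF : HasFDerivAt (blockTheta s) (fderiv ℂ (blockTheta s) y) (y + (0 : ℂ) • v) := by
    simpa using ((contDiff_blockTheta s).differentiable one_ne_zero y).hasFDerivAt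
  have hd := hasDerivAt_pi.1 (hF.comp_hasDerivAt (0 : ℂ) hline)
  have hQz : ∀ i, (truncPrimitive (n + 1) q).eval (z i) = 0 := fun i => by
    have h1 := hd (Quotient.mk s i)
    simp only [Function.comp_apply, blockTheta_mk, hv, Pi.zero_apply] at h1
    exact (hasDerivAt_thetaMap_line z u i).unique h1
  have hdeg : q.natDegree < n + 1 := by
    refine Nat.lt_succ_of_le (natDegree_sum_le_of_forall_le _ _ fun i _ =>
      (natDegree_C_mul_le _ _).trans ?_)
    rw [natDegree_finsetProd_X_sub_C_eq_card]
    exact (Finset.card_le_univ _).trans_eq (Fintype.card_fin n)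
  have hu := eq_zero_of_derivative_eq_sum_prod_erase (z := z) (v := fun i => -u i)
    (fun i j hij => by simp only [u, hy hij]) (fun i => hy0 _)
    (derivative_truncPrimitive hdeg)
    (by rw [← coeff_zero_eq_eval_zero, coeff_zero_truncPrimitive]) hQz
  funext b
  induction b using Quotient.inductionOn with
  | h i => simpa [u] using congrFun hu i

lemma exists_openPartialHomeomorph_blockTheta {n : ℕ} {s : Setoid (Fin n)}
    {y : Quotient s → ℂ} (hy : Function.Injective y) (hy0 : ∀ b, y b ≠ 0) :
    ∃ e : OpenPartialHomeomorph (Quotient s → ℂ) (Quotient s → ℂ),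
      y ∈ e.source ∧ (∀ x, e x = blockTheta s x) ∧ ∀ x ∈ e.source, Function.Injective x := by
  classical
  have : Fintype (Quotient s) := Fintype.ofFinite _
  let L : (Quotient s → ℂ) ≃L[ℂ] (Quotient s → ℂ) :=
    (LinearEquiv.ofInjectiveEndo (fderiv ℂ (blockTheta s) y : (Quotient s → ℂ) →ₗ[ℂ] _)
      (fderiv_blockTheta_injective hy hy0)).toContinuousLinearEquiv
  have hL : HasStrictFDerivAt (blockTheta s) (L : (Quotient s → ℂ) →L[ℂ] _) y := by
    refine ((contDiff_blockTheta s).contDiffAt.hasStrictFDerivAt one_ne_zero).congr_fderiv ?_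
    ext1 v
    rfl
  have hopen : IsOpen {x : Quotient s → ℂ | Function.Injective x} := by
    have : {x : Quotient s → ℂ | Function.Injective x} =
        ⋂ (b) (c) (_ : b ≠ c), {x | x b ≠ x c} := by
      ext x
      simp only [Set.mem_iInter, Set.mem_ofPred_eq]
      exact ⟨fun h b c hbc => h.ne hbc, fun h b c => not_imp_not.1 (h b c)⟩
    rw [this]
    exact isOpen_iInter_of_finite fun b => isOpen_iInter_of_finite fun c =>
      isOpen_iInter_of_finite fun _ => isOpen_ne_fun (continuous_apply b) (continuous_apply c)
  refine ⟨(hL.toOpenPartialHomeomorph _).restrOpen _ hopen,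
    ⟨hL.mem_toOpenPartialHomeomorph_source, hy⟩,
    fun x => rfl, fun x hx => hx.2⟩

/-- **Theorem C.** Let `λ` be a partition of `{1, …, n}` (encoded as a setoid `s` on
`Fin n`). The map `θ`, sending `z` to `(p_z(z_1), …, p_z(z_n))` where `p_z` is the unique
polynomial with derivative `(w - z_1) ⋯ (w - z_n)` and no constant term, maps the stratum
`ℂ^λ` into its closure, and the restriction `θ_λ : ℂ^λ → closure(ℂ^λ)` is a local
homeomorphism at every point of `ℂ^λ` with all entries nonzero: there are relatively open
neighborhoods `U ∩ ℂ^λ` of `z` and `V ∩ closure(ℂ^λ)` of `θ z` on which `θ` restricts to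
a homeomorphism. -/
theorem theta_stratum_local_homeo
    (n : ℕ) (s : Setoid (Fin n))
    (θ : (Fin n → ℂ) → Fin n → ℂ)
    (hθ : ∀ z : Fin n → ℂ, ∀ p : Polynomial ℂ,
      Polynomial.derivative p = ∏ i, (Polynomial.X - Polynomial.C (z i)) →
      p.coeff 0 = 0 → ∀ j, θ z j = p.eval (z j)) :
    (∀ z ∈ stratum n s, θ z ∈ stratumClosure n s) ∧
    ∀ z ∈ stratum n s, (∀ i, z i ≠ 0) →
      ∃ U V : Set (Fin n → ℂ), IsOpen U ∧ IsOpen V ∧ z ∈ U ∧ θ z ∈ V ∧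
        ∃ h : ((U ∩ stratum n s : Set (Fin n → ℂ)) ≃ₜ
                (V ∩ stratumClosure n s : Set (Fin n → ℂ))),
          ∀ x : (U ∩ stratum n s : Set (Fin n → ℂ)), (h x : Fin n → ℂ) = θ x := by
  obtain rfl : θ = thetaMap n := by
    funext z j
    refine hθ z _ (derivative_truncPrimitive ?_) (coeff_zero_truncPrimitive _ _) j
    simp
  have hmem : ∀ z ∈ stratum n s, thetaMap n z ∈ stratumClosure n s := fun z hz i j hij => by
    simp only [thetaMap, (hz i j).2 hij]
  refine ⟨hmem, fun z hz hz0 => ?_⟩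
  let ι : (Quotient s → ℂ) → Fin n → ℂ := fun y i => y (Quotient.mk s i)
  let π : (Fin n → ℂ) → Quotient s → ℂ := fun x b => x b.out
  have hι : Continuous ι := by fun_prop
  have hπ : Continuous π := by fun_prop
  have hπι : ∀ y, π (ι y) = y := fun y => funext fun b => congrArg y b.out_eq
  have hιπ : ∀ x ∈ stratumClosure n s, ι (π x) = x := fun x hx =>
    funext fun i => hx _ _ (Quotient.mk_out i)
  have hsub : stratum n s ⊆ stratumClosure n s := fun x hx i j hij => (hx i j).2 hij
  have hinj : ∀ x ∈ stratum n s, Function.Injective (π x) := fun x hx b c hbc =>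
    Quotient.out_equiv_out.1 ((hx _ _).1 hbc)
  have hιmem : ∀ y, Function.Injective y → ι y ∈ stratum n s := fun y hy i j =>
    hy.eq_iff.trans Quotient.eq
  have hθι : ∀ y, thetaMap n (ι y) = ι (blockTheta s y) := fun y =>
    funext fun i => (blockTheta_mk y i).symm
  have hθπ : ∀ x ∈ stratum n s, π (thetaMap n x) = blockTheta s (π x) := fun x hx => by
    rw [← hπι (blockTheta s (π x)), ← hθι, hιπ x (hsub hx)]
  have hcont : Continuous (thetaMap n) := (contDiff_thetaMap n).continuous
  obtain ⟨e, hze, he, hesrc⟩ := exists_openPartialHomeomorph_blockTheta (hinj z hz)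
    (fun b => hz0 b.out)
  have hmaps : ∀ x ∈ stratum n s, π x ∈ e.source → π (thetaMap n x) ∈ e.target :=
    fun x hx hxe => by
      rw [hθπ x hx, ← he]
      exact e.map_source hxe
  refine ⟨π ⁻¹' e.source, π ⁻¹' e.target, e.open_source.preimage hπ, e.open_target.preimage hπ,
    hze, hmaps z hz hze, ?_⟩
  refine ⟨{ toFun := fun x => ⟨thetaMap n x, hmaps x x.2.2 x.2.1, hmem x x.2.2⟩
            invFun := fun x => ⟨ι (e.symm (π x)), ?_, hιmem _ (hesrc _ (e.map_target x.2.1))⟩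
            left_inv := fun x => Subtype.ext ?_
            right_inv := fun x => Subtype.ext ?_
            continuous_toFun := (hcont.comp continuous_subtype_val).subtype_mk _
            continuous_invFun := Continuous.subtype_mk (hι.comp ?_) _ }, fun x => rfl⟩
  · rw [Set.mem_preimage, hπι]
    exact e.map_target x.2.1
  · simp only
    rw [hθπ x x.2.2, ← he, e.left_inv x.2.1, hιπ _ (hsub x.2.2)]
  · simp only
    rw [hθι, ← he, e.right_inv x.2.1, hιπ _ x.2.2]
  · exact e.continuousOn_symm.comp_continuous (hπ.comp continuous_subtype_val) fun x => x.2.1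
end

section
/- Let a = (a_1,…,a_m) be an m-tuple of positive integers with n = a_1+⋯+a_m, let z_1,…,z_m be commuting variables, and fix j ∈ [m]. Define p̃_{a,j}(z) = Σ_{i=0}^{n−a_j} (−1)^i · ((z−z_j)^{a_j+i+1}/(a_j+i+1)!) · Σ_{b} multinomial(i; b_1,…,b_m) · ∏_{ℓ≠j} (z−z_ℓ)^{a_ℓ−b_ℓ}/(a_ℓ−b_ℓ)!, where the inner sum runs over all m-tuples (b_1,…,b_m) of nonnegative integers with b_1+⋯+b_m = i, b_j = 0, and b_ℓ ≤ a_ℓ for all ℓ. Then (d/dz) p̃_{a,j}(z) = ∏_{ℓ=1}^{m} (z−z_ℓ)^{a_ℓ}/a_ℓ!. -/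
/-- The explicit antiderivative `p̃_{a,j}` of `∏_ℓ (z - z_ℓ)^{a_ℓ}/a_ℓ!`:
`p̃_{a,j}(z) = Σ_{i=0}^{n-a_j} (-1)^i ((z-z_j)^{a_j+i+1}/(a_j+i+1)!) ⬝
Σ_b multinomial(i; b) ∏_{ℓ≠j} (z-z_ℓ)^{a_ℓ-b_ℓ}/(a_ℓ-b_ℓ)!`, the inner sum running over
`m`-tuples `b` of nonnegative integers with `Σ b = i`, `b j = 0`, and `b ≤ a`. -/
noncomputable def ptilde (m : ℕ) (a : Fin m → ℕ) (j : Fin m) :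
    Polynomial (MvPolynomial (Fin m) ℂ) :=
  ∑ i ∈ Finset.range ((∑ ℓ, a ℓ) - a j + 1),
    (-1 : Polynomial (MvPolynomial (Fin m) ℂ)) ^ i *
      ((((a j + i + 1).factorial : ℂ))⁻¹ •
        (Polynomial.X - Polynomial.C (MvPolynomial.X j)) ^ (a j + i + 1)) *
      ∑ b ∈ (Finset.Iic a).filter (fun b => (∑ ℓ, b ℓ) = i ∧ b j = 0),
        ((Nat.multinomial Finset.univ b : ℂ)) •
          ∏ ℓ ∈ Finset.univ \ {j},
            (((a ℓ - b ℓ).factorial : ℂ))⁻¹ •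
              (Polynomial.X - Polynomial.C (MvPolynomial.X ℓ)) ^ (a ℓ - b ℓ)

open Finset in
/-- The multinomial Leibniz rule for iterated derivatives of a finite product. -/
theorem Polynomial.iterate_derivative_prod_eq_sum_piAntidiag {ι R : Type*} [DecidableEq ι]
    [CommRing R] (s : Finset ι) (f : ι → Polynomial R) (n : ℕ) :
    derivative^[n] (∏ i ∈ s, f i) =
      ∑ b ∈ s.piAntidiag n, Nat.multinomial s b • ∏ i ∈ s, derivative^[b i] (f i) := by
  induction s using Finset.cons_induction generalizing n with
  | empty =>
    cases n with
    | zero => simp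
    | succ n => simp [piAntidiag_empty_of_ne_zero]
  | cons a s ha ih =>
    rw [piAntidiag_cons ha, sum_disjiUnion, prod_cons, mul_comm, iterate_derivative_mul,
      Nat.sum_antidiagonal_eq_sum_range_succ_mk]
    refine sum_congr rfl fun k hk => ?_
    have hkn : k ≤ n := Nat.lt_succ_iff.mp (mem_range.mp hk)
    rw [ih, sum_mul, smul_sum, sum_map]
    refine sum_congr rfl fun b hb => ?_
    obtain ⟨hsum, hsupp⟩ := mem_piAntidiag.mp hb
    have hba : b a = 0 := by
      by_contra h
      exact ha (hsupp a h)
    have heq : ∀ i ∈ s, (b + fun t => if t = a then k else 0) i = b i := fun i hi => by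
      simp [ne_of_mem_of_not_mem hi ha]
    have hat : (b + fun t => if t = a then k else 0) a = k := by simp [hba]
    simp only [addRightEmbedding_apply]
    rw [Nat.multinomial_cons, Nat.multinomial_congr heq, sum_congr rfl heq, prod_cons, hat,
      prod_congr rfl fun i hi => congrArg (fun l => derivative^[l] (f i)) (heq i hi), show s.sum b = n - k from hsum,
      Nat.add_sub_cancel' hkn, smul_mul_assoc, smul_smul, mul_comm (derivative^[k] (f a))]

section DividedPower

variable (K : Type*) {R : Type*} [Field K] [CharZero K] [CommRing R] [Algebra K R]

open Polynomial in
theorem Polynomial.derivative_inv_factorial_smul_X_sub_C_pow_succ (c : R) (n : ℕ) :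
    derivative (((n + 1).factorial : K)⁻¹ • (X - C c) ^ (n + 1)) =
      ((n.factorial : K))⁻¹ • (X - C c) ^ n := by
  have h : ((n + 1 : ℕ) : R[X]) = algebraMap K R[X] ((n + 1 : ℕ) : K) := (map_natCast _ _).symm
  have hn : ((n + 1 : ℕ) : K) ≠ 0 := Nat.cast_ne_zero.mpr n.succ_ne_zero
  rw [derivative_smul, derivative_X_sub_C_pow, Nat.add_sub_cancel, C_eq_natCast, h,
    ← Algebra.smul_def, smul_smul, Nat.factorial_succ, Nat.cast_mul, mul_inv_rev,
    inv_mul_cancel_right₀ hn]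

open Polynomial in
theorem Polynomial.iterate_derivative_inv_factorial_smul_X_sub_C_pow (c : R) (n k : ℕ) :
    derivative^[k] ((n.factorial : K)⁻¹ • (X - C c) ^ n) =
      if k ≤ n then (((n - k).factorial : K))⁻¹ • (X - C c) ^ (n - k) else 0 := by
  induction k generalizing n with
  | zero => simp
  | succ k ih =>
    rw [Function.iterate_succ_apply]
    cases n with
    | zero => simp
    | succ n =>
      rw [derivative_inv_factorial_smul_X_sub_C_pow_succ, ih]
      simp

end DividedPower

open Finset in
/-- The inner sum of `ptilde` is the `i`-th derivative of the product of the factors other than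
the `j`-th. -/
theorem sum_filter_multinomial_smul_prod_eq_iterate_derivative
    (m : ℕ) (a : Fin m → ℕ) (j : Fin m) (i : ℕ) :
    ∑ b ∈ (Finset.Iic a).filter (fun b => (∑ ℓ, b ℓ) = i ∧ b j = 0),
        ((Nat.multinomial Finset.univ b : ℂ)) •
          ∏ ℓ ∈ Finset.univ \ {j},
            (((a ℓ - b ℓ).factorial : ℂ))⁻¹ •
              ((Polynomial.X - Polynomial.C (MvPolynomial.X ℓ)) ^ (a ℓ - b ℓ) :
                Polynomial (MvPolynomial (Fin m) ℂ)) =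
      Polynomial.derivative^[i] (∏ ℓ ∈ Finset.univ \ {j}, (((a ℓ).factorial : ℂ))⁻¹ •
        (Polynomial.X - Polynomial.C (MvPolynomial.X ℓ)) ^ a ℓ) := by
  rw [Polynomial.iterate_derivative_prod_eq_sum_piAntidiag]
  simp only [Polynomial.iterate_derivative_inv_factorial_smul_X_sub_C_pow]
  have hsplit (b : Fin m → ℕ) (hb : b j = 0) : ∑ ℓ ∈ univ \ {j}, b ℓ = ∑ ℓ, b ℓ := by
    rw [← sum_sdiff (subset_univ {j}), sum_singleton, hb, add_zero]
  have hmult (b : Fin m → ℕ) (hb : b j = 0) :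
      Nat.multinomial (univ \ {j}) b = Nat.multinomial univ b := by
    rw [Nat.multinomial, Nat.multinomial, hsplit b hb, ← prod_sdiff (subset_univ {j}),
      prod_singleton, hb, Nat.factorial_zero, mul_one]
  have hsub : (Finset.Iic a).filter (fun b => (∑ ℓ, b ℓ) = i ∧ b j = 0) ⊆
      (univ \ {j}).piAntidiag i := by
    intro b hb
    obtain ⟨-, hsum, hbj⟩ := mem_filter.mp hb
    refine mem_piAntidiag.mpr ⟨(hsplit b hbj).trans hsum, fun ℓ hℓ => ?_⟩
    have : ℓ ≠ j := fun h => hℓ (h ▸ hbj)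
    simpa using this
  rw [← sum_subset hsub]
  · refine sum_congr rfl fun b hb => ?_
    obtain ⟨hle, -, hbj⟩ := mem_filter.mp hb
    rw [hmult b hbj, Nat.cast_smul_eq_nsmul]
    congr 1
    exact prod_congr rfl fun ℓ _ => (if_pos (mem_Iic.mp hle ℓ)).symm
  · intro b hb hnot
    obtain ⟨hsum, hsupp⟩ := mem_piAntidiag.mp hb
    have hbj : b j = 0 := by
      by_contra h
      simpa using hsupp j h
    obtain ⟨ℓ, hℓ⟩ : ∃ ℓ, ¬ b ℓ ≤ a ℓ := by
      by_contra! h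
      exact hnot (mem_filter.mpr ⟨mem_Iic.mpr h, (hsplit b hbj).symm.trans hsum, hbj⟩)
    have hmem : ℓ ∈ univ \ {j} := hsupp ℓ (by omega)
    rw [prod_eq_zero hmem (if_neg hℓ), smul_zero]

open Polynomial in
/-- Repeated integration by parts: alternating sums of products of iterated antiderivatives and
iterated derivatives have telescoping derivative. -/
theorem Polynomial.derivative_sum_neg_one_pow_mul_iterate_derivative {R : Type*} [CommRing R]
    (F : ℕ → R[X]) (hF : ∀ k, derivative (F (k + 1)) = F k) (G : R[X]) (N : ℕ) :
    derivative (∑ i ∈ Finset.range N, (-1) ^ i * F (i + 1) * derivative^[i] G) =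
      F 0 * G - (-1) ^ N * F N * derivative^[N] G := by
  induction N with
  | zero => simp
  | succ N ih =>
    have h : derivative ((-1 : R[X]) ^ N) = 0 := by
      simpa using derivative_C (a := (-1 : R) ^ N)
    rw [Finset.sum_range_succ, derivative_add, ih, derivative_mul, derivative_mul, h, hF,
      Function.iterate_succ_apply']
    ring

/-- The derivative of `p̃_{a,j}` is `∏_ℓ (z - z_ℓ)^{a_ℓ}/a_ℓ!`. -/
theorem derivative_ptilde
    (m : ℕ) (a : Fin m → ℕ) (ha : ∀ i, 0 < a i) (j : Fin m) :
    Polynomial.derivative (ptilde m a j) =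
      ∏ ℓ, (((a ℓ).factorial : ℂ))⁻¹ •
        (Polynomial.X - Polynomial.C (MvPolynomial.X ℓ)) ^ a ℓ := by
  set G : Polynomial (MvPolynomial (Fin m) ℂ) :=
    ∏ ℓ ∈ Finset.univ \ {j}, (((a ℓ).factorial : ℂ))⁻¹ •
      (Polynomial.X - Polynomial.C (MvPolynomial.X ℓ)) ^ a ℓ with hG
  have hsum : ∑ ℓ ∈ Finset.univ \ {j}, a ℓ = (∑ ℓ, a ℓ) - a j := by
    rw [← Finset.sum_sdiff (Finset.subset_univ {j}), Finset.sum_singleton, Nat.add_sub_cancel]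
  have hdeg : G.natDegree ≤ (∑ ℓ, a ℓ) - a j := by
    rw [← hsum]
    refine (Polynomial.natDegree_prod_le _ _).trans (Finset.sum_le_sum fun ℓ _ => ?_)
    refine (Polynomial.natDegree_smul_le _ _).trans ?_
    exact (Polynomial.natDegree_pow_le_of_le _ (Polynomial.natDegree_X_sub_C_le _)).trans_eq
      (mul_one _)
  have hzero : Polynomial.derivative^[(∑ ℓ, a ℓ) - a j + 1] G = 0 :=
    Polynomial.iterate_derivative_eq_zero (Nat.lt_succ_of_le hdeg)
  have key := Polynomial.derivative_sum_neg_one_pow_mul_iterate_derivative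
    (fun k => ((a j + k).factorial : ℂ)⁻¹ •
      (Polynomial.X - Polynomial.C (MvPolynomial.X j : MvPolynomial (Fin m) ℂ)) ^ (a j + k))
    (fun k => Polynomial.derivative_inv_factorial_smul_X_sub_C_pow_succ ℂ _ (a j + k))
    G ((∑ ℓ, a ℓ) - a j + 1)
  rw [hzero, mul_zero, sub_zero] at key
  simp only [ptilde, sum_filter_multinomial_smul_prod_eq_iterate_derivative, ← hG]
  refine key.trans ?_
  rw [← Finset.prod_sdiff (Finset.subset_univ {j}), Finset.prod_singleton, mul_comm]
  rfl
end

section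
/- Let a = (a_1,…,a_m) be an m-tuple of positive integers with n = a_1+⋯+a_m, let z_1,…,z_m be commuting variables, and fix j ∈ [m]. Define p̃_{a,j}(z) = Σ_{i=0}^{n−a_j} (−1)^i · ((z−z_j)^{a_j+i+1}/(a_j+i+1)!) · Σ_{b} multinomial(i; b_1,…,b_m) · ∏_{ℓ≠j} (z−z_ℓ)^{a_ℓ−b_ℓ}/(a_ℓ−b_ℓ)!, where the inner sum runs over all m-tuples (b_1,…,b_m) of nonnegative integers with b_1+⋯+b_m = i, b_j = 0, and b_ℓ ≤ a_ℓ for all ℓ. Then for every i ∈ [m] with i ≠ j, the evaluation p̃_{a,j}(z_i) ∈ ℂ[z_1,…,z_m] is divisible by (z_i − z_j)^{a_i+a_j+1}. -/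
/-- For `i ≠ j`, the evaluation `p̃_{a,j}(z_i)` is divisible by
`(z_i - z_j)^{a_i + a_j + 1}`. -/
theorem sub_pow_dvd_ptilde_eval
    (m : ℕ) (a : Fin m → ℕ) (ha : ∀ i, 0 < a i) (j : Fin m) :
    ∀ i, i ≠ j →
      (MvPolynomial.X i - MvPolynomial.X j : MvPolynomial (Fin m) ℂ) ^ (a i + a j + 1) ∣
        Polynomial.eval (MvPolynomial.X i) (ptilde m a j) := by
  intro i hij
  rw [ptilde, Polynomial.eval_finsetSum]
  refine Finset.dvd_sum fun k _ => ?_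
  rw [Polynomial.eval_mul, Polynomial.eval_finsetSum, Finset.mul_sum]
  refine Finset.dvd_sum fun b hb => ?_
  obtain ⟨hba, hsum, -⟩ := Finset.mem_filter.1 hb
  have hle : b i ≤ a i := Finset.mem_Iic.1 hba i
  rcases hle.lt_or_eq with hlt | heq
  · -- the factor `(X - z_i) ^ (a i - b i)` vanishes at `z_i`
    rw [Polynomial.eval_smul, Polynomial.eval_prod,
      Finset.prod_eq_zero (i := i) (by simpa using hij)
        (by simp [Polynomial.eval_smul, Nat.sub_ne_zero_of_lt hlt])]
    simp
  · -- `b i = a i` forces `a i ≤ k`, so the power of `z_i - z_j` is large enough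
    have hk : a i ≤ k := by
      rw [← heq, ← hsum]
      exact Finset.single_le_sum (fun _ _ => Nat.zero_le _) (Finset.mem_univ i)
    refine Dvd.dvd.mul_right ?_ _
    rw [Polynomial.eval_mul, Polynomial.eval_smul, Polynomial.eval_pow (p := _ - _), Polynomial.eval_sub,
      Polynomial.eval_X, Polynomial.eval_C]
    exact Dvd.dvd.mul_left (dvd_smul_of_dvd _ (pow_dvd_pow _ (by omega))) _
end

section
/- Let a = (a_1,…,a_m) be an m-tuple of positive integers with n = a_1+⋯+a_m, and let J_a be the m×m Jacobian matrix over ℂ[z_1,…,z_m] with (i,j)-entry ∂/∂z_i (p_a(z_j)). Then for every i, j ∈ [m], the entry (J_a)_{ij} is divisible by z_j^{a_j} in ℂ[z_1,…,z_m]; moreover, if i ≠ j, then (J_a)_{ij} is divisible by z_j^{a_j+1}. -/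
/-- If `p' = (X - c)^k * g` over a domain of characteristic zero, then `c ^ (k + 1)` divides
the difference `p(c) - p(0)`. -/
theorem pow_succ_dvd_eval_sub_eval_zero {R : Type*} [CommRing R] [IsDomain R] [CharZero R]
    {p g : Polynomial R} {c : R} {k : ℕ}
    (h : Polynomial.derivative p = (Polynomial.X - Polynomial.C c) ^ k * g) :
    c ^ (k + 1) ∣ p.eval c - p.eval 0 := by
  set q : Polynomial R := p.comp (Polynomial.X + Polynomial.C c) with hq
  have hq' : Polynomial.derivative q =
      Polynomial.X ^ k * g.comp (Polynomial.X + Polynomial.C c) := by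
    simp [hq, Polynomial.derivative_comp, h]
  have hdvd : Polynomial.X ^ (k + 1) ∣ q - Polynomial.C (q.coeff 0) := by
    rw [Polynomial.X_pow_dvd_iff]
    intro d hd
    cases d with
    | zero => simp
    | succ d =>
      have h1 : (Polynomial.derivative q).coeff d = 0 :=
        Polynomial.X_pow_dvd_iff.1 ⟨_, hq'⟩ d (by omega)
      rw [Polynomial.coeff_derivative] at h1
      have h2 : q.coeff (d + 1) = 0 :=
        (mul_eq_zero.1 h1).resolve_right (by exact_mod_cast d.succ_ne_zero)
      simp [h2]
  obtain ⟨r, hr⟩ := hdvd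
  have hev := congrArg (Polynomial.eval (-c)) hr
  have hc : q.coeff 0 = p.eval c := by
    rw [Polynomial.coeff_zero_eq_eval_zero]; simp [hq]
  rw [hc] at hev
  simp only [hq, Polynomial.eval_sub, Polynomial.eval_comp, Polynomial.eval_add,
    Polynomial.eval_X, Polynomial.eval_C, neg_add_cancel, Polynomial.eval_mul,
    Polynomial.eval_pow] at hev
  rw [dvd_sub_comm, hev, neg_pow]
  exact ⟨(-1) ^ (k + 1) * r.eval (-c), by ring⟩


/-- **Proposition (Columns).** Each entry of the `j`-th column of the Jacobian matrix
`J_a` is divisible by `z_j^{a_j}`; moreover the off-diagonal entries of the `j`-th column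
are divisible by `z_j^{a_j + 1}`. -/
theorem X_pow_dvd_jacobian_entry
    (m n : ℕ) (a : Fin m → ℕ) (ha : ∀ i, 0 < a i) (hn : n = ∑ i, a i)
    (p : Polynomial (MvPolynomial (Fin m) ℂ))
    (hp : Polynomial.derivative p =
      ∏ i, (Polynomial.X - Polynomial.C (MvPolynomial.X i)) ^ a i)
    (hp0 : p.coeff 0 = 0)
    (J : Matrix (Fin m) (Fin m) (MvPolynomial (Fin m) ℂ))
    (hJ : ∀ i j, J i j = MvPolynomial.pderiv i (Polynomial.eval (MvPolynomial.X j) p)) :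
    ∀ i j, ((MvPolynomial.X j : MvPolynomial (Fin m) ℂ) ^ a j ∣ J i j) ∧
      (i ≠ j → (MvPolynomial.X j : MvPolynomial (Fin m) ℂ) ^ (a j + 1) ∣ J i j) := by
  intro i j
  have hdvd : (MvPolynomial.X j : MvPolynomial (Fin m) ℂ) ^ (a j + 1) ∣
      p.eval (MvPolynomial.X j) := by
    have hfac := hp.trans (Finset.mul_prod_erase Finset.univ _ (Finset.mem_univ j)).symm
    simpa [← Polynomial.coeff_zero_eq_eval_zero, hp0] using
      pow_succ_dvd_eval_sub_eval_zero hfac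
  obtain ⟨r, hr⟩ := hdvd
  rw [hJ, hr, Derivation.leibniz, Derivation.leibniz_pow]
  simp only [smul_eq_mul, Nat.add_sub_cancel]
  refine ⟨dvd_add ((pow_dvd_pow _ (Nat.le_succ _)).mul_right _) ?_, fun hij => ?_⟩
  · exact (dvd_smul_of_dvd (a j + 1) (dvd_mul_right _ _)).mul_left r
  · rw [MvPolynomial.pderiv_X_of_ne hij.symm]
    simp
end

section
/- Let a = (a_1,…,a_m) be an m-tuple of positive integers with n = a_1+⋯+a_m, and let J_a be the m×m Jacobian matrix over ℂ[z_1,…,z_m] with (i,j)-entry ∂/∂z_i (p_a(z_j)). Then for every i, j, k ∈ [m] with j ≠ k, the difference (J_a)_{ik} − (J_a)_{ij} is divisible by (z_k − z_j)^{a_k + a_j} in ℂ[z_1,…,z_m]; moreover, if i ∉ {j, k}, then (J_a)_{ik} − (J_a)_{ij} is divisible by (z_k − z_j)^{a_k + a_j + 1}. -/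
open Polynomial in
/-- Over a `ℚ`-algebra, if a constant divides the derivative of `r`, it divides `r(1) - r(0)`. -/
theorem dvd_eval_one_sub_eval_zero {R : Type*} [CommRing R] [Algebra ℚ R] (r : R[X]) (e : R)
    (h : C e ∣ derivative r) : e ∣ r.eval 1 - r.eval 0 := by
  have hdiv : C e ∣ r.divX := by
    rw [C_dvd_iff_dvd_coeff] at h ⊢
    intro n
    have hn := h n
    rw [coeff_derivative] at hn
    have hu : IsUnit ((n : R) + 1) := by
      have h1 : IsUnit ((n : ℚ) + 1) := isUnit_iff_ne_zero.mpr (by positivity)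
      simpa using h1.map (algebraMap ℚ R)
    rw [coeff_divX]
    exact hu.dvd_mul_right.mp hn
  have hev : r.eval 1 - r.eval 0 = r.divX.eval 1 := by
    conv_lhs => rw [← divX_mul_X_add r]
    simp
  rw [hev]
  obtain ⟨q, hq⟩ := hdiv
  exact ⟨q.eval 1, by rw [hq]; simp⟩

open Polynomial in
/-- Over a `ℚ`-algebra, if `p'` is divisible by `(X - u)^a (X - v)^b`, then `p(v) - p(u)` is
divisible by `(v - u)^(a + b + 1)`. -/
theorem sub_pow_dvd_eval_sub_eval {R : Type*} [CommRing R] [Algebra ℚ R] (p : R[X]) (u v : R)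
    (a b : ℕ) (h : (X - C u) ^ a * (X - C v) ^ b ∣ derivative p) :
    (v - u) ^ (a + b + 1) ∣ p.eval v - p.eval u := by
  obtain ⟨g, hg⟩ := h
  have key := dvd_eval_one_sub_eval_zero (p.comp (C u + C (v - u) * X)) ((v - u) ^ (a + b + 1)) ?_
  · simpa [eval_comp] using key
  · refine ⟨X ^ a * (X - 1) ^ b * g.comp (C u + C (v - u) * X), ?_⟩
    have hu : C u + C (v - u) * X - C u = C (v - u) * X := by ring
    have hv : C u + C (v - u) * X - C v = C (v - u) * (X - 1) := by
      rw [C_sub]; ring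
    rw [derivative_comp, hg]
    simp only [mul_comp, pow_comp, sub_comp, X_comp, C_comp, hu, hv, derivative_add,
      derivative_C, derivative_C_mul, derivative_X, mul_pow, C_pow]
    ring


/-- **Proposition (Column differences).** For `j ≠ k`, the difference of the `(i,k)` and
`(i,j)` entries of the Jacobian matrix `J_a` is divisible by `(z_k - z_j)^{a_k + a_j}`;
moreover, if `i ∉ {j, k}`, it is divisible by `(z_k - z_j)^{a_k + a_j + 1}`. -/
theorem sub_pow_dvd_jacobian_entry_sub
    (m n : ℕ) (a : Fin m → ℕ) (ha : ∀ i, 0 < a i) (hn : n = ∑ i, a i)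
    (p : Polynomial (MvPolynomial (Fin m) ℂ))
    (hp : Polynomial.derivative p =
      ∏ i, (Polynomial.X - Polynomial.C (MvPolynomial.X i)) ^ a i)
    (hp0 : p.coeff 0 = 0)
    (J : Matrix (Fin m) (Fin m) (MvPolynomial (Fin m) ℂ))
    (hJ : ∀ i j, J i j = MvPolynomial.pderiv i (Polynomial.eval (MvPolynomial.X j) p)) :
    ∀ i j k, j ≠ k →
      (((MvPolynomial.X k - MvPolynomial.X j : MvPolynomial (Fin m) ℂ)) ^ (a k + a j) ∣
          J i k - J i j) ∧
      (i ≠ j → i ≠ k →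
        ((MvPolynomial.X k - MvPolynomial.X j : MvPolynomial (Fin m) ℂ)) ^ (a k + a j + 1) ∣
          J i k - J i j) := by
  intro i j k hjk
  have hdvd : (Polynomial.X - Polynomial.C (MvPolynomial.X j)) ^ a j *
      (Polynomial.X - Polynomial.C (MvPolynomial.X k)) ^ a k ∣ Polynomial.derivative p := by
    rw [hp, ← Finset.prod_pair (f := fun i => (Polynomial.X -
      Polynomial.C (MvPolynomial.X i : MvPolynomial (Fin m) ℂ)) ^ a i) hjk]
    exact Finset.prod_dvd_prod_of_subset _ _ _ (Finset.subset_univ _)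
  obtain ⟨q, hq⟩ := sub_pow_dvd_eval_sub_eval p _ _ _ _ hdvd
  rw [add_comm (a j)] at hq
  rw [hJ, hJ, ← map_sub, hq, Derivation.leibniz, Derivation.leibniz_pow, Nat.add_sub_cancel]
  simp only [smul_eq_mul, nsmul_eq_mul]
  refine ⟨dvd_add ?_ ?_, fun hij hik => dvd_add (dvd_mul_right _ _) ?_⟩
  · exact (pow_dvd_pow _ (Nat.le_succ _)).trans (dvd_mul_right _ _)
  · exact Dvd.dvd.mul_left (Dvd.dvd.mul_left (dvd_mul_right _ _) _) _
  · rw [map_sub, MvPolynomial.pderiv_X_of_ne hik.symm, MvPolynomial.pderiv_X_of_ne hij.symm]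
    simp
end

section
/- Let a = (a_1,…,a_m) be an m-tuple of positive integers with n = a_1+⋯+a_m, and let J_a be the m×m Jacobian matrix over ℂ[z_1,…,z_m] with (i,j)-entry ∂/∂z_i (p_a(z_j)). Then the degree in the variable z_m of the entry (J_a)_{ij} is: a_m if i < m and j < m; a_m − 1 if j < m and i = m; and n if j = m. -/
open Polynomial in
/-- The linear functional `F ↦ ∫₀¹ F(s) ds` on polynomials, defined coefficientwise. -/
noncomputable def unitIntegral (K A : Type*) [Field K] [CommRing A] [Algebra K A] :
    A[X] →ₗ[K] A :=
  lsum fun k => ((k : K) + 1)⁻¹ • LinearMap.id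

namespace unitIntegral

open Polynomial

variable {K A B : Type*} [Field K] [CommRing A] [Algebra K A] [CommRing B] [Algebra K B]

theorem apply_monomial (k : ℕ) (c : A) :
    unitIntegral K A (monomial k c) = ((k : K) + 1)⁻¹ • c := by
  simp [unitIntegral, lsum_apply, sum_monomial_index]

theorem C_mul (c : A) (F : A[X]) :
    unitIntegral K A (C c * F) = c * unitIntegral K A F := by
  induction F using Polynomial.induction_on' with
  | add p q hp hq => simp [mul_add, hp, hq]
  | monomial k x => simp [C_mul_monomial, apply_monomial]

theorem map (φ : A →ₐ[K] B) (F : A[X]) :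
    φ (unitIntegral K A F) = unitIntegral K B (F.map φ.toRingHom) := by
  induction F using Polynomial.induction_on' with
  | add p q hp hq => simp [hp, hq]
  | monomial k x => simp [apply_monomial]

theorem derivative [CharZero K] (F : A[X]) :
    unitIntegral K A (Polynomial.derivative F) = F.eval 1 - F.coeff 0 := by
  induction F using Polynomial.induction_on' with
  | add p q hp hq => simp [hp, hq]; ring
  | monomial k x =>
    cases k with
    | zero => simp
    | succ k =>
      have hk : ((k : K) + 1) ≠ 0 := by exact_mod_cast k.succ_ne_zero
      have h : x * ((k : A) + 1) = ((k : K) + 1) • x := by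
        simp [Algebra.smul_def, mul_comm]
      simp [apply_monomial, coeff_monomial, h, smul_smul, hk]

theorem eval_eq [CharZero K] (q : A[X]) (hq : q.coeff 0 = 0) (c : A) :
    q.eval c = c * unitIntegral K A ((Polynomial.derivative q).comp (C c * X)) := by
  have h := derivative (K := K) (q.comp (C c * X))
  rw [derivative_comp] at h
  simpa [C_mul, hq] using h.symm

theorem X_pow_mul_X_sub_one_pow_ne_zero [CharZero K] (u v : ℕ) :
    unitIntegral K K (X ^ u * (X - 1) ^ v) ≠ 0 := by
  induction v generalizing u with
  | zero =>
    rw [pow_zero, mul_one, ← monomial_one_right_eq_X_pow, apply_monomial]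
    have hu : ((u : K) + 1) ≠ 0 := by exact_mod_cast u.succ_ne_zero
    simpa using hu
  | succ v ih =>
    have hv : ((v : K) + 1) ≠ 0 := by exact_mod_cast v.succ_ne_zero
    have h := derivative (K := K) (X ^ (u + 1) * (X - 1 : K[X]) ^ (v + 1))
    have hd : Polynomial.derivative (X ^ (u + 1) * (X - 1 : K[X]) ^ (v + 1)) =
        C ((u : K) + 1) * (X ^ u * (X - 1) ^ (v + 1)) +
          C ((v : K) + 1) * (X ^ (u + 1) * (X - 1) ^ v) := by
      simp [derivative_mul, derivative_pow]
      ring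
    rw [hd, map_add, C_mul, C_mul] at h
    intro h0
    rw [h0] at h
    simp [hv, coeff_zero_eq_eval_zero] at h
    exact ih (u + 1) h

end unitIntegral

open Polynomial in
/-- Every coefficient of `F` has degree at most `d`, and the coefficients of degree `d` of the
coefficients of `F` are the coefficients of `G`. -/
def HasTopCoeff {A : Type*} [CommRing A] (F : A[X][X]) (d : ℕ) (G : A[X]) : Prop :=
  ∀ k, (F.coeff k).natDegree ≤ d ∧ (F.coeff k).coeff d = G.coeff k

namespace HasTopCoeff

open Polynomial

variable {A : Type*} [CommRing A]

theorem one : HasTopCoeff (1 : A[X][X]) 0 1 := by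
  intro k
  by_cases hk : k = 0 <;> simp [coeff_one, hk]

theorem mul {F F' : A[X][X]} {d d' : ℕ} {G G' : A[X]}
    (h : HasTopCoeff F d G) (h' : HasTopCoeff F' d' G') :
    HasTopCoeff (F * F') (d + d') (G * G') := by
  intro k
  rw [coeff_mul, coeff_mul]
  constructor
  · exact natDegree_sum_le_of_forall_le _ _ fun x _ =>
      natDegree_mul_le_of_le (h x.1).1 (h' x.2).1
  · rw [finsetSum_coeff]
    refine Finset.sum_congr rfl fun x _ => ?_
    rw [coeff_mul_add_eq_of_natDegree_le (h x.1).1 (h' x.2).1, (h x.1).2, (h' x.2).2]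

theorem pow {F : A[X][X]} {d : ℕ} {G : A[X]} (h : HasTopCoeff F d G) (n : ℕ) :
    HasTopCoeff (F ^ n) (n * d) (G ^ n) := by
  induction n with
  | zero => simpa using one
  | succ n ih => simpa [pow_succ, add_mul] using ih.mul h

theorem prod {ι : Type*} (s : Finset ι) {F : ι → A[X][X]} {d : ι → ℕ} {G : ι → A[X]}
    (h : ∀ i ∈ s, HasTopCoeff (F i) (d i) (G i)) :
    HasTopCoeff (∏ i ∈ s, F i) (∑ i ∈ s, d i) (∏ i ∈ s, G i) := by
  classical
  induction s using Finset.induction_on with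
  | empty => simpa using one
  | insert i s hi ih =>
    rw [Finset.prod_insert hi, Finset.prod_insert hi, Finset.sum_insert hi]
    exact (h i (by simp)).mul (ih fun j hj => h j (by simp [hj]))

theorem coeff_unitIntegral (K : Type*) [Field K] [Algebra K A]
    {F : A[X][X]} {d : ℕ} {G : A[X]} (h : HasTopCoeff F d G) :
    (unitIntegral K A[X] F).coeff d = unitIntegral K A G := by
  have hF : unitIntegral K A[X] F = F.sum fun k x => ((k : K) + 1)⁻¹ • x := by
    simp [unitIntegral, lsum_apply]
  have hG' : unitIntegral K A G = G.sum fun k x => ((k : K) + 1)⁻¹ • x := by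
    simp [unitIntegral, lsum_apply]
  have hlF : F.natDegree < max F.natDegree G.natDegree + 1 := by omega
  have hlG : G.natDegree < max F.natDegree G.natDegree + 1 := by omega
  rw [hF, hG', sum_over_range' _ (by simp) _ hlF, sum_over_range' _ (by simp) _ hlG,
    finsetSum_coeff]
  exact Finset.sum_congr rfl fun k _ => by rw [coeff_smul, (h k).2]

theorem natDegree_unitIntegral {K : Type*} [Field K] [Algebra K A]
    {F : A[X][X]} {d : ℕ} {G : A[X]} (h : HasTopCoeff F d G) (hG : unitIntegral K A G ≠ 0) :
    (unitIntegral K A[X] F).natDegree = d := by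
  refine natDegree_eq_of_le_of_coeff_ne_zero ?_ (by rwa [h.coeff_unitIntegral K])
  rw [unitIntegral, lsum_apply, sum_def]
  exact natDegree_sum_le_of_forall_le _ _ fun k _ => (natDegree_smul_le _ _).trans (h k).1

end HasTopCoeff

namespace CriticalPoint

open MvPolynomial hiding C X
open Polynomial (C X)

variable {σ K : Type*} [Field K]

/-- A multivariate polynomial regarded as a polynomial in the single variable `l`. -/
noncomputable def asPolynomialIn [DecidableEq σ] (l : σ) :
    MvPolynomial σ K →ₐ[K] Polynomial (MvPolynomial {b // b ≠ l} K) :=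
  (optionEquivLeft K {b // b ≠ l}).toAlgHom.comp (rename (Equiv.optionSubtypeNe l).symm)

theorem degreeOf_eq_natDegree_asPolynomialIn [DecidableEq σ] (l : σ) (p : MvPolynomial σ K) :
    degreeOf l p = (asPolynomialIn l p).natDegree :=
  degreeOf_eq_natDegree l p

theorem asPolynomialIn_X_self [DecidableEq σ] (l : σ) :
    asPolynomialIn l (MvPolynomial.X l : MvPolynomial σ K) = X := by
  simp [asPolynomialIn, optionEquivLeft_X_none]

theorem asPolynomialIn_X_of_ne [DecidableEq σ] {l k : σ} (h : k ≠ l) :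
    asPolynomialIn l (MvPolynomial.X k : MvPolynomial σ K) = C (MvPolynomial.X ⟨k, h⟩) := by
  simp [asPolynomialIn, Equiv.optionSubtypeNe_symm_of_ne h, optionEquivLeft_X_some]

theorem degreeOf_unitIntegral_prod [Fintype σ] [DecidableEq σ] [CharZero K] (l j : σ) (b : σ → ℕ) :
    let V := unitIntegral K (MvPolynomial σ K)
      (∏ k, (C (MvPolynomial.X j) * X - C (MvPolynomial.X k)) ^ b k)
    V ≠ 0 ∧ degreeOf l V = if j = l then ∑ k, b k else b l := by
  intro V
  obtain ⟨d, G, hF, hd, hG⟩ : ∃ (d : σ → ℕ) (G : σ → Polynomial (MvPolynomial {b // b ≠ l} K)),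
      (∀ k, HasTopCoeff (Polynomial.map (asPolynomialIn (K := K) l).toRingHom
        (C (MvPolynomial.X j : MvPolynomial σ K) * X - C (MvPolynomial.X k))) (d k) (G k)) ∧
      (∑ k, b k * d k = if j = l then ∑ k, b k else b l) ∧
      ∃ e : {b // b ≠ l} → K, ∀ k,
        (G k).map (aeval (R := K) e).toRingHom ∈ ({-1, X, X - 1} : Set (Polynomial K)) := by
    by_cases hj : j = l
    · subst hj
      refine ⟨fun _ => 1, fun k => if k = j then X - 1 else X, fun k n => ?_, by simp, 0,
        fun k => ?_⟩
      · by_cases hk : k = j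
        · subst hk
          rcases n with _ | _ | n <;>
            simp [asPolynomialIn_X_self, Polynomial.coeff_X, Polynomial.coeff_C,
              Polynomial.coeff_one]
        · rcases n with _ | _ | n <;>
            simp [asPolynomialIn_X_self, asPolynomialIn_X_of_ne hk, hk, Polynomial.coeff_X,
              Polynomial.coeff_C]
      · by_cases hk : k = j <;> simp [hk]
    · refine ⟨fun k => if k = l then 1 else 0,
        fun k => if h : k = l then -1 else
          C (MvPolynomial.X ⟨j, hj⟩) * X - C (MvPolynomial.X ⟨k, h⟩), fun k n => ?_,
        by simp [hj], fun k => if k.1 = j then 1 else 0, fun k => ?_⟩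
      · by_cases hk : k = l
        · subst hk
          rcases n with _ | _ | n <;>
            simp [asPolynomialIn_X_self, asPolynomialIn_X_of_ne hj, Polynomial.coeff_X,
              Polynomial.coeff_C, Polynomial.coeff_one]
        · rcases n with _ | _ | n <;>
            simp [asPolynomialIn_X_of_ne hj, asPolynomialIn_X_of_ne hk, hk, Polynomial.coeff_X,
              Polynomial.coeff_C]
      · by_cases hk : k = l
        · simp [hk]
        · by_cases hkj : k = j <;> simp [hk, hkj, hj]
  have hmap : asPolynomialIn l V = unitIntegral K _ (∏ k, (Polynomial.map
      (asPolynomialIn (K := K) l).toRingHom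
        (C (MvPolynomial.X j : MvPolynomial σ K) * X - C (MvPolynomial.X k))) ^ b k) := by
    rw [unitIntegral.map, Polynomial.map_prod]
    exact congrArg _ (Finset.prod_congr rfl fun k _ => Polynomial.map_pow _ _)
  have htop := HasTopCoeff.prod Finset.univ fun k _ => (hF k).pow (b k)
  have hne : unitIntegral K _ (∏ k, G k ^ b k) ≠ 0 := by
    obtain ⟨e, he⟩ := hG
    obtain ⟨n, u, v, h⟩ : ∃ n u v : ℕ, (∏ k, G k ^ b k).map (aeval (R := K) e).toRingHom =
        C ((-1) ^ n) * (X ^ u * (X - 1) ^ v) := by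
      rw [Polynomial.map_prod]
      refine Finset.prod_induction _ (fun P : Polynomial K => ∃ n u v : ℕ,
        P = C ((-1) ^ n) * (X ^ u * (X - 1) ^ v)) ?_ ⟨0, 0, 0, by simp⟩ fun k _ => ?_
      · rintro _ _ ⟨n, u, v, rfl⟩ ⟨n', u', v', rfl⟩
        exact ⟨n + n', u + u', v + v', by simp only [pow_add, map_mul]; ring⟩
      · rw [Polynomial.map_pow]
        rcases he k with h | h | h
        · exact ⟨b k, 0, 0, by rw [h]; simp⟩
        · exact ⟨0, b k, 0, by rw [h]; simp⟩
        · exact ⟨0, 0, b k, by rw [h]; simp⟩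
    intro h0
    have h1 := unitIntegral.map (aeval (R := K) e) (∏ k, G k ^ b k)
    rw [h0, map_zero] at h1
    rw [h, unitIntegral.C_mul] at h1
    exact unitIntegral.X_pow_mul_X_sub_one_pow_ne_zero u v (by simpa using h1.symm)
  constructor
  · intro h0
    rw [h0, map_zero] at hmap
    exact hne (by rw [← htop.coeff_unitIntegral K, ← hmap, Polynomial.coeff_zero])
  · rw [degreeOf_eq_natDegree_asPolynomialIn, hmap, htop.natDegree_unitIntegral hne, hd]

/-- Differentiation of the coefficients of a univariate polynomial with respect to the
variable `i`. -/
noncomputable def coeffPderiv (i : σ) :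
    Derivation K (Polynomial (MvPolynomial σ K)) (Polynomial (MvPolynomial σ K)) :=
  PolynomialModule.equivPolynomialSelf.toLinearMap.compDer (pderiv i).mapCoeffs

theorem coeff_coeffPderiv (i : σ) (p : Polynomial (MvPolynomial σ K)) (k : ℕ) :
    (coeffPderiv i p).coeff k = pderiv i (p.coeff k) := rfl

theorem derivative_coeffPderiv (i : σ) (p : Polynomial (MvPolynomial σ K)) :
    Polynomial.derivative (coeffPderiv i p) = coeffPderiv i (Polynomial.derivative p) := by
  ext1 k
  have h : pderiv i ((k : MvPolynomial σ K) + 1) = 0 := by simp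
  rw [Polynomial.coeff_derivative, coeff_coeffPderiv, coeff_coeffPderiv,
    Polynomial.coeff_derivative, Derivation.leibniz, h]
  simp [mul_comm]

theorem pderiv_eval (i : σ) (p : Polynomial (MvPolynomial σ K)) (c : MvPolynomial σ K) :
    pderiv i (p.eval c) =
      (coeffPderiv i p).eval c + (Polynomial.derivative p).eval c * pderiv i c := by
  induction p using Polynomial.induction_on' with
  | add p q hp hq =>
    simp only [map_add, Polynomial.eval_add, hp, hq]
    ring
  | monomial k x =>
    have h : coeffPderiv i (Polynomial.monomial k x) = Polynomial.monomial k (pderiv i x) := by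
      ext1 n
      rw [coeff_coeffPderiv, Polynomial.coeff_monomial, Polynomial.coeff_monomial]
      split_ifs <;> simp
    rw [h, Polynomial.eval_monomial, Polynomial.eval_monomial, Polynomial.derivative_monomial,
      Polynomial.eval_monomial, Derivation.leibniz, Derivation.leibniz_pow]
    simp
    ring

theorem coeffPderiv_prod [Fintype σ] [DecidableEq σ] (i : σ) (a : σ → ℕ) :
    coeffPderiv i (∏ k, (X - C (MvPolynomial.X k : MvPolynomial σ K)) ^ a k) =
      C (-(a i : MvPolynomial σ K)) *
        ∏ k, (X - C (MvPolynomial.X k)) ^ Function.update a i (a i - 1) k := by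
  have hX : ∀ k, coeffPderiv i (X - C (MvPolynomial.X k : MvPolynomial σ K)) =
      if k = i then -1 else 0 := by
    intro k
    ext1 n
    rw [coeff_coeffPderiv]
    by_cases hk : k = i <;> rcases n with _ | _ | n <;>
      simp [hk, Polynomial.coeff_X, Polynomial.coeff_C, Polynomial.coeff_one]
  have hrest : coeffPderiv i
      (∏ k ∈ Finset.univ.erase i, (X - C (MvPolynomial.X k : MvPolynomial σ K)) ^ a k) = 0 := by
    refine Finset.prod_induction _ (fun P => coeffPderiv i P = 0) ?_ (by simp) fun k hk => ?_
    · intro P Q hP hQ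
      simp [hP, hQ]
    · rw [Derivation.leibniz_pow, hX, if_neg (Finset.ne_of_mem_erase hk)]
      simp
  have hupd : ∏ k ∈ Finset.univ.erase i, (X - C (MvPolynomial.X k : MvPolynomial σ K)) ^
      Function.update a i (a i - 1) k =
      ∏ k ∈ Finset.univ.erase i, (X - C (MvPolynomial.X k : MvPolynomial σ K)) ^ a k :=
    Finset.prod_congr rfl fun k hk => by rw [Function.update_of_ne (Finset.ne_of_mem_erase hk)]
  rw [← Finset.mul_prod_erase _ _ (Finset.mem_univ i),
    ← Finset.mul_prod_erase Finset.univ (fun k => (X - C (MvPolynomial.X k)) ^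
      Function.update a i (a i - 1) k) (Finset.mem_univ i), hupd, Derivation.leibniz, hrest,
    Derivation.leibniz_pow, hX]
  simp
  ring

theorem pderiv_eval_X_eq [Fintype σ] [DecidableEq σ] [CharZero K] (a : σ → ℕ) (ha : ∀ k, 0 < a k)
    (p : Polynomial (MvPolynomial σ K))
    (hp : Polynomial.derivative p = ∏ k, (X - C (MvPolynomial.X k)) ^ a k)
    (hp0 : p.coeff 0 = 0) (i j : σ) :
    pderiv i (p.eval (MvPolynomial.X j)) =
      MvPolynomial.C (-(a i : K)) * (MvPolynomial.X j * unitIntegral K (MvPolynomial σ K)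
        (∏ k, (C (MvPolynomial.X j) * X - C (MvPolynomial.X k)) ^
          Function.update a i (a i - 1) k)) := by
  have hz : (Polynomial.derivative p).eval (MvPolynomial.X j) = 0 := by
    rw [hp, Polynomial.eval_prod]
    exact Finset.prod_eq_zero (Finset.mem_univ j) (by simp [(ha j).ne'])
  rw [pderiv_eval, hz, zero_mul, add_zero, unitIntegral.eval_eq (K := K) _
    (by rw [coeff_coeffPderiv, hp0, map_zero]), derivative_coeffPderiv, hp, coeffPderiv_prod,
    Polynomial.mul_comp, Polynomial.C_comp, unitIntegral.C_mul, Polynomial.prod_comp]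
  simp
  ring

theorem degreeOf_pderiv_eval_X [Fintype σ] [DecidableEq σ] [CharZero K] (a : σ → ℕ) (ha : ∀ k, 0 < a k)
    (p : Polynomial (MvPolynomial σ K))
    (hp : Polynomial.derivative p = ∏ k, (X - C (MvPolynomial.X k)) ^ a k)
    (hp0 : p.coeff 0 = 0) (i j l : σ) :
    degreeOf l (pderiv i (p.eval (MvPolynomial.X j))) =
      if j = l then ∑ k, a k else if i = l then a l - 1 else a l := by
  obtain ⟨hV, hdeg⟩ := degreeOf_unitIntegral_prod (K := K) l j (Function.update a i (a i - 1))
  have hai : (-(a i : K)) ≠ 0 := by simpa using (ha i).ne'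
  have hsum : 1 + ∑ k, Function.update a i (a i - 1) k = ∑ k, a k := by
    rw [Finset.sum_update_of_mem (Finset.mem_univ i),
      ← Finset.add_sum_erase _ a (Finset.mem_univ i), Finset.sdiff_singleton_eq_erase]
    have := ha i
    omega
  rw [pderiv_eval_X_eq a ha p hp hp0, degreeOf_mul_eq (by simpa using hai)
    (mul_ne_zero (X_ne_zero j) hV), degreeOf_mul_eq (X_ne_zero j) hV, degreeOf_C, degreeOf_X,
    hdeg]
  by_cases hj : j = l
  · simp [hj, hsum]
  · by_cases hi : i = l
    · subst hi
      simp [hj, Ne.symm hj]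
    · simp [hj, Ne.symm hj, hi, Ne.symm hi, Function.update_of_ne]

end CriticalPoint

/-- **Lemma (Exponents of `z_m`).** For an `(m+1)`-tuple `a` of positive integers with
sum `n`, the degree in the last variable `z_m` of the entry `(J_a)_{ij}` of the Jacobian
matrix is: `a_m` if `i, j < m`; `a_m - 1` if `j < i = m`; and `n` if `j = m`. -/
theorem degreeOf_last_jacobian_entry
    (m n : ℕ) (a : Fin (m + 1) → ℕ) (ha : ∀ i, 0 < a i) (hn : n = ∑ i, a i)
    (p : Polynomial (MvPolynomial (Fin (m + 1)) ℂ))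
    (hp : Polynomial.derivative p =
      ∏ i, (Polynomial.X - Polynomial.C (MvPolynomial.X i)) ^ a i)
    (hp0 : p.coeff 0 = 0)
    (J : Matrix (Fin (m + 1)) (Fin (m + 1)) (MvPolynomial (Fin (m + 1)) ℂ))
    (hJ : ∀ i j, J i j = MvPolynomial.pderiv i (Polynomial.eval (MvPolynomial.X j) p)) :
    (∀ i j, i ≠ Fin.last m → j ≠ Fin.last m →
      MvPolynomial.degreeOf (Fin.last m) (J i j) = a (Fin.last m)) ∧
    (∀ j, j ≠ Fin.last m →
      MvPolynomial.degreeOf (Fin.last m) (J (Fin.last m) j) = a (Fin.last m) - 1) ∧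
    (∀ i, MvPolynomial.degreeOf (Fin.last m) (J i (Fin.last m)) = n) := by
  have h i j := (congrArg (MvPolynomial.degreeOf (Fin.last m)) (hJ i j)).trans
    (CriticalPoint.degreeOf_pderiv_eval_X a ha p hp hp0 i j (Fin.last m))
  refine ⟨fun i j hi hj => ?_, fun j hj => ?_, fun i => ?_⟩
  · rw [h, if_neg hj, if_neg hi]
  · rw [h, if_neg hj, if_pos rfl]
  · rw [h, if_pos rfl, hn]
end

section
/- Let m ≥ 2, let a = (a_1,…,a_m) be an m-tuple of positive integers with n = a_1+⋯+a_m, let a′ = (a_1,…,a_{m−1}), and let J_a and J_{a′} be the corresponding Jacobian matrices of sizes m×m and (m−1)×(m−1), respectively, over ℂ[z_1,…,z_m] and ℂ[z_1,…,z_{m−1}]. With monomials of ℂ[z_1,…,z_m] ordered lexicographically with z_1 < ⋯ < z_m, the leading term of det J_a satisfies lt(det J_a) = (−z_m)^{a_m(m−1)} · lt(det J_{a′}) · lt((J_a)_{mm}). -/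
/-- The strict lexicographic order on monomials of `ℂ[z_1, …, z_k]` determined by
`z_1 < ⋯ < z_k`: one first compares the exponent of the last variable, then the
next-to-last, and so on.  Thus `d < e` iff at the highest index where the exponents
differ, `e` has the larger exponent. -/
def MonLexLT {k : ℕ} (d e : Fin k →₀ ℕ) : Prop :=
  ∃ i, d i < e i ∧ ∀ j, i < j → d j = e j

/-- `t` is the leading term of `f`: `t = monomial D c` where `D` is the largest monomial
of the support of `f` in the lexicographic order with `z_1 < ⋯ < z_k` and `c` is its
coefficient. -/
def IsLeadingTerm {k : ℕ} (f t : MvPolynomial (Fin k) ℂ) : Prop :=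
  ∃ D ∈ f.support, (∀ E ∈ f.support, E = D ∨ MonLexLT E D) ∧
    t = MvPolynomial.monomial D (MvPolynomial.coeff D f)

open Polynomial in
theorem exists_derivative_eq_and_coeff_zero (K : Type*) {R : Type*} [Field K] [CharZero K]
    [CommRing R] [Algebra K R] (g : R[X]) : ∃ G : R[X], derivative G = g ∧ G.coeff 0 = 0 := by
  induction g using Polynomial.induction_on' with
  | add p q hp hq =>
    obtain ⟨P, hP, hP0⟩ := hp
    obtain ⟨Q, hQ, hQ0⟩ := hq
    exact ⟨P + Q, by simp [hP, hQ], by simp [hP0, hQ0]⟩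
  | monomial n r =>
    refine ⟨monomial (n + 1) (((n + 1 : ℕ) : K)⁻¹ • r), ?_, ?_⟩
    · have h : ((n + 1 : ℕ) : K) ≠ 0 := by exact_mod_cast n.succ_ne_zero
      rw [derivative_monomial, Nat.add_sub_cancel, mul_comm, ← nsmul_eq_mul,
        ← Nat.cast_smul_eq_nsmul K, smul_smul, mul_inv_cancel₀ h, one_smul]
    · simp

open Polynomial in
theorem eq_of_derivative_eq_of_coeff_zero_eq {R : Type*} [CommRing R] [IsDomain R] [CharZero R]
    {p q : R[X]} (h : derivative p = derivative q) (h0 : p.coeff 0 = q.coeff 0) : p = q := by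
  ext k
  cases k with
  | zero => exact h0
  | succ k =>
    have := congrArg (coeff · k) h
    simp only [coeff_derivative] at this
    exact mul_right_cancel₀ (by exact_mod_cast k.succ_ne_zero) this

open Polynomial in
/-- The alternating sum is the Beta-type integral `∫₀¹ t ^ N (t - 1) ^ b dt`. -/
theorem sum_choose_div_ne_zero (K : Type*) [Field K] [CharZero K] (b N : ℕ) :
    ∑ l ∈ Finset.range (b + 1), (-1 : K) ^ (b - l) * (b.choose l) / ((l + N + 1 : ℕ) : K) ≠ 0 := by
  intro h0
  let v : K[X] := ∑ l ∈ Finset.range (b + 1),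
    C ((-1 : K) ^ (b - l) * (b.choose l) / ((l + N + 1 : ℕ) : K)) * X ^ l
  have hd : derivative (X ^ (N + 1) * v) = X ^ N * (X - 1) ^ b := by
    rw [sub_eq_add_neg, add_pow, Finset.mul_sum, Finset.mul_sum, derivative_sum]
    refine Finset.sum_congr rfl fun l _ => ?_
    have h : ((l + N + 1 : ℕ) : K) ≠ 0 := by exact_mod_cast (l + N).succ_ne_zero
    have e : X ^ (N + 1) * (C ((-1 : K) ^ (b - l) * (b.choose l) / ((l + N + 1 : ℕ) : K)) * X ^ l)
        = C ((-1 : K) ^ (b - l) * (b.choose l) / ((l + N + 1 : ℕ) : K)) * X ^ (l + N + 1) := by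
      ring
    rw [e, derivative_C_mul, derivative_X_pow, ← mul_assoc, ← C_mul, div_mul_cancel₀ _ h]
    simp only [C_mul, C_pow, C_neg, C_1, map_natCast, Nat.add_sub_cancel]
    ring
  have hd0 : (X : K[X]) ^ N * (X - 1) ^ b ≠ 0 :=
    mul_ne_zero (pow_ne_zero _ X_ne_zero) (pow_ne_zero _ (X_sub_C_ne_zero 1))
  have hu0 : X ^ (N + 1) * v ≠ 0 := by
    intro h
    rw [h, derivative_zero] at hd
    exact hd0 hd.symm
  have hv0 : v ≠ 0 := right_ne_zero_of_mul hu0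
  have hroot : (X ^ (N + 1) * v).IsRoot 1 := by
    simpa [v, eval_finsetSum, IsRoot.def] using h0
  have hdvd' : (X - C (1 : K)) ^ b ∣ X ^ N * (X - 1) ^ b := by
    rw [C_1]; exact dvd_mul_left _ _
  have hmul : b + 1 ≤ (X ^ (N + 1) * v).rootMultiplicity 1 := by
    have h1 := derivative_rootMultiplicity_of_root hroot
    have h2 := (le_rootMultiplicity_iff hd0).2 hdvd'
    have h3 := (rootMultiplicity_pos hu0).2 hroot
    rw [hd] at h1
    omega
  have hdvd : (X - C (1 : K)) ^ (b + 1) ∣ v := by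
    refine IsCoprime.dvd_of_dvd_mul_left ?_ ((le_rootMultiplicity_iff hu0).1 hmul)
    refine IsCoprime.pow ?_
    exact ⟨-1, 1, by simp⟩
  have hdeg := natDegree_le_of_dvd hdvd hv0
  rw [natDegree_pow, natDegree_X_sub_C, mul_one] at hdeg
  have : v.natDegree ≤ b := natDegree_sum_le_of_forall_le _ _ fun l hl =>
    (natDegree_C_mul_X_pow_le _ _).trans (Nat.lt_succ_iff.1 (Finset.mem_range.1 hl))
  omega

open Polynomial in
theorem eq_sum_of_derivative_eq_map_mul_pow {R : Type*} [CommRing R] [IsDomain R]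
    [CharZero R] {g : R[X]} {b : ℕ} {Q : R[X][X]}
    (hQ : derivative Q = g.map C * (X - C X) ^ b) (hQ0 : Q.coeff 0 = 0) {H : ℕ → R[X]}
    (hH : ∀ l, derivative (H l) = X ^ l * g) (hH0 : ∀ l, (H l).coeff 0 = 0) :
    Q = ∑ l ∈ Finset.range (b + 1), (H l).map C * C ((-X) ^ (b - l) * (b.choose l : R[X])) := by
  refine eq_of_derivative_eq_of_coeff_zero_eq ?_ ?_
  · rw [hQ, sub_eq_add_neg, add_pow, Finset.mul_sum, derivative_sum]
    refine Finset.sum_congr rfl fun l _ => ?_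
    rw [derivative_mul, derivative_C, mul_zero, add_zero, derivative_map, hH]
    simp only [Polynomial.map_mul, Polynomial.map_pow, map_X, C_mul, C_pow, C_neg, map_natCast]
    ring
  · simp [hQ0, coeff_map, hH0, mul_coeff_zero]

open Polynomial in
theorem natDegree_le_and_coeff_eval_C {K R : Type*} [Field K] [CharZero K] [CommRing R]
    [IsDomain R] [CharZero R] [Algebra K R] {g G : R[X]} {b : ℕ} {Q : R[X][X]}
    (hQ : derivative Q = g.map C * (X - C X) ^ b) (hQ0 : Q.coeff 0 = 0)
    (hG : derivative G = g) (hG0 : G.coeff 0 = 0) (r : R) :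
    (Q.eval (C r)).natDegree ≤ b ∧ (Q.eval (C r)).coeff b = (-1) ^ b * G.eval r := by
  choose H hH hH0 using fun l => exists_derivative_eq_and_coeff_zero K (X ^ l * g)
  have hHG : H 0 = G := eq_of_derivative_eq_of_coeff_zero_eq (by simp [hH, hG]) (by simp [hH0, hG0])
  have hev : Q.eval (C r) = ∑ l ∈ Finset.range (b + 1),
      C ((-1) ^ (b - l) * b.choose l * (H l).eval r) * X ^ (b - l) := by
    rw [eq_sum_of_derivative_eq_map_mul_pow hQ hQ0 hH hH0, eval_finsetSum]
    refine Finset.sum_congr rfl fun l _ => ?_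
    rw [eval_mul, eval_C, eval_map, eval₂_at_apply, neg_pow]
    simp only [C_mul, C_pow, C_neg, C_1, map_natCast]
    ring
  refine ⟨?_, ?_⟩
  · rw [hev]
    exact natDegree_sum_le_of_forall_le _ _ fun l _ =>
      (natDegree_C_mul_X_pow_le _ _).trans (Nat.sub_le _ _)
  · rw [hev, finsetSum_coeff, Finset.sum_eq_single 0]
    · rw [coeff_C_mul, Nat.sub_zero, coeff_X_pow_self, hHG]
      simp
    · intro l hl hl0
      rw [coeff_C_mul_X_pow, if_neg]
      have := Finset.mem_range.1 hl
      omega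
    · simp

open Polynomial in
theorem natDegree_le_and_coeff_eval_X {K R : Type*} [Field K] [CharZero K] [CommRing R]
    [IsDomain R] [CharZero R] [Algebra K R] {g : R[X]} {b N : ℕ} {Q : R[X][X]}
    (hQ : derivative Q = g.map C * (X - C X) ^ b) (hQ0 : Q.coeff 0 = 0) (hg : g.natDegree ≤ N)
    {κ : K} (hκ : κ ≠ 0) (hgN : g.coeff N = algebraMap K R κ) :
    (Q.eval X).natDegree ≤ b + N + 1 ∧
      ∃ c : K, c ≠ 0 ∧ (Q.eval X).coeff (b + N + 1) = algebraMap K R c := by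
  choose H hH hH0 using fun l => exists_derivative_eq_and_coeff_zero K (X ^ l * g)
  have hcoeff (l k : ℕ) : (H l).coeff (k + 1) * ((k + 1 : ℕ) : R) = (X ^ l * g).coeff k := by
    rw [← hH, coeff_derivative, Nat.cast_succ]
  have hne (k : ℕ) : ((k + 1 : ℕ) : R) ≠ 0 := by exact_mod_cast k.succ_ne_zero
  have hdeg (l : ℕ) : (H l).natDegree ≤ l + N + 1 := by
    refine natDegree_le_iff_coeff_eq_zero.2 fun k hk => ?_
    obtain ⟨k, rfl⟩ := Nat.exists_eq_succ_of_ne_zero (by omega : k ≠ 0)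
    have h := hcoeff l k
    rw [coeff_eq_zero_of_natDegree_lt (natDegree_mul_le.trans_lt ?_)] at h
    · exact (mul_eq_zero.1 h).resolve_right (hne k)
    · rw [natDegree_X_pow]; omega
  have htop (l : ℕ) : (H l).coeff (l + N + 1) =
      algebraMap K R (κ * ((l + N + 1 : ℕ) : K)⁻¹) := by
    have h := hcoeff l (l + N)
    rw [coeff_X_pow_mul', if_pos (Nat.le_add_right l N), Nat.add_sub_cancel_left, hgN] at h
    have hK : ((l + N + 1 : ℕ) : K) ≠ 0 := by exact_mod_cast (l + N).succ_ne_zero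
    refine mul_right_cancel₀ (hne (l + N)) ?_
    rw [h, ← map_natCast (algebraMap K R), ← map_mul, inv_mul_cancel_right₀ hK]
  have hev : Q.eval X = ∑ l ∈ Finset.range (b + 1),
      C ((-1 : R) ^ (b - l) * (b.choose l : R)) * (H l * X ^ (b - l)) := by
    rw [eq_sum_of_derivative_eq_map_mul_pow hQ hQ0 hH hH0, eval_finsetSum]
    refine Finset.sum_congr rfl fun l _ => ?_
    rw [eval_mul, eval_C, eval_map, eval₂_C_X, neg_pow]
    simp only [C_mul, C_pow, C_neg, C_1, map_natCast]
    ring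
  refine ⟨?_, _, mul_ne_zero hκ (sum_choose_div_ne_zero K b N), ?_⟩
  · rw [hev]
    refine natDegree_sum_le_of_forall_le _ _ fun l hl => ?_
    refine (natDegree_C_mul_le _ _).trans (natDegree_mul_le.trans ?_)
    have := Finset.mem_range.1 hl
    have := hdeg l
    rw [natDegree_X_pow]
    omega
  · rw [hev, finsetSum_coeff, Finset.mul_sum, map_sum]
    refine Finset.sum_congr rfl fun l hl => ?_
    have := Finset.mem_range.1 hl
    rw [coeff_C_mul, show b + N + 1 = (l + N + 1) + (b - l) by omega,
      coeff_mul_X_pow, htop, div_eq_mul_inv]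
    simp only [map_mul, map_pow, map_neg, map_one, map_natCast]
    ring

open Polynomial in
theorem Matrix.coeff_det_sum {n R : Type*} [Fintype n] [DecidableEq n] [CommRing R]
    {A : Matrix n n R[X]} {s : n → ℕ} (h : ∀ i j, (A i j).natDegree ≤ s j) :
    A.det.natDegree ≤ ∑ j, s j ∧
      A.det.coeff (∑ j, s j) = (Matrix.of fun i j => (A i j).coeff (s j)).det := by
  have hprod (t : Finset n) (σ : Equiv.Perm n) :
      (∏ j ∈ t, A (σ j) j).natDegree ≤ ∑ j ∈ t, s j ∧
      (∏ j ∈ t, A (σ j) j).coeff (∑ j ∈ t, s j) = ∏ j ∈ t, (A (σ j) j).coeff (s j) := by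
    induction t using Finset.induction_on with
    | empty => simp
    | insert j t hj ih =>
      rw [Finset.prod_insert hj, Finset.sum_insert hj, Finset.prod_insert hj,
        coeff_mul_add_eq_of_natDegree_le (h _ _) ih.1, ih.2]
      exact ⟨natDegree_mul_le.trans (add_le_add (h _ _) ih.1), rfl⟩
  simp only [det_apply, Matrix.of_apply, finsetSum_coeff]
  refine ⟨natDegree_sum_le_of_forall_le _ _ fun σ _ => ?_, Finset.sum_congr rfl fun σ _ => ?_⟩
  · rw [Units.smul_def, zsmul_eq_mul, ← C_eq_intCast]
    exact (natDegree_C_mul_le _ _).trans (hprod _ σ).1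
  · rw [Units.smul_def, Units.smul_def, coeff_smul, (hprod _ σ).2]

theorem Matrix.det_of_lastRow_castSucc_eq_zero {m : ℕ} {R : Type*} [CommRing R]
    {A : Matrix (Fin (m + 1)) (Fin (m + 1)) R} (h : ∀ j : Fin m, A (Fin.last m) j.castSucc = 0) :
    A.det = A (Fin.last m) (Fin.last m) *
      (A.submatrix Fin.castSucc Fin.castSucc).det := by
  rw [det_succ_row A (Fin.last m), Fin.sum_univ_castSucc]
  simp [h, Even.neg_one_pow ⟨m, rfl⟩]

open Polynomial in
/-- The derivation of `A[X]` extending `d` coefficientwise. -/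
noncomputable def Derivation.mapCoeffsSelf {K A : Type*} [CommRing K] [CommRing A] [Algebra K A]
    (d : Derivation K A A) : Derivation K A[X] A[X] :=
  ((PolynomialModule.equivPolynomialSelf (R := A)).toLinearMap).compDer d.mapCoeffs

open Polynomial in
theorem Derivation.coeff_mapCoeffsSelf {K A : Type*} [CommRing K] [CommRing A] [Algebra K A]
    (d : Derivation K A A) (P : A[X]) (k : ℕ) :
    (d.mapCoeffsSelf P).coeff k = d (P.coeff k) := rfl

open Polynomial in
theorem Derivation.eval_mapCoeffsSelf {K A : Type*} [CommRing K] [CommRing A] [Algebra K A]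
    (d : Derivation K A A) (P : A[X]) (x : A) :
    d (P.eval x) = (d.mapCoeffsSelf P).eval x + (derivative P).eval x * d x := by
  induction P using Polynomial.induction_on' with
  | add p q hp hq => simp only [eval_add, map_add, hp, hq]; ring
  | monomial n a =>
    have : d.mapCoeffsSelf (monomial n a) = monomial n (d a) := by
      ext k
      rw [coeff_mapCoeffsSelf, coeff_monomial, coeff_monomial]
      split_ifs <;> simp
    rw [this, eval_monomial, eval_monomial, derivative_monomial, eval_monomial, d.leibniz,
      d.leibniz_pow]
    simp only [smul_eq_mul, nsmul_eq_mul]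
    ring

open Polynomial in
theorem Derivation.derivative_mapCoeffsSelf {K A : Type*} [CommRing K] [CommRing A] [Algebra K A]
    (d : Derivation K A A) (P : A[X]) :
    derivative (d.mapCoeffsSelf P) = d.mapCoeffsSelf (derivative P) := by
  ext k
  rw [coeff_derivative, coeff_mapCoeffsSelf, coeff_mapCoeffsSelf, coeff_derivative, d.leibniz]
  have : d ((k : A) + 1) = 0 := by exact_mod_cast d.map_natCast (k + 1)
  rw [this, smul_zero, zero_add, smul_eq_mul, mul_comm]

/-- Entries of the Jacobian matrix: differentiation under the integral sign. -/
theorem exists_pderiv_eval_X_eq {σ K : Type*} [Fintype σ] [DecidableEq σ] [CommRing K]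
    {a : σ → ℕ} (ha : ∀ i, 0 < a i) {p : Polynomial (MvPolynomial σ K)}
    (hp : Polynomial.derivative p =
      ∏ i, (Polynomial.X - Polynomial.C (MvPolynomial.X i)) ^ a i)
    (hp0 : p.coeff 0 = 0) (i : σ) :
    ∃ q : Polynomial (MvPolynomial σ K),
      Polynomial.derivative q = Polynomial.C (MvPolynomial.C (-(a i : K))) *
        ∏ k, (Polynomial.X - Polynomial.C (MvPolynomial.X k)) ^ (a - Pi.single i 1 : σ → ℕ) k ∧
      q.coeff 0 = 0 ∧
      ∀ j, MvPolynomial.pderiv i (Polynomial.eval (MvPolynomial.X j) p) =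
        Polynomial.eval (MvPolynomial.X j) q := by
  let D := (MvPolynomial.pderiv (R := K) i).mapCoeffsSelf
  have hD (k : σ) : D (Polynomial.X - Polynomial.C (MvPolynomial.X k)) =
      if k = i then -1 else 0 := by
    ext1 l
    rw [Derivation.coeff_mapCoeffsSelf, Polynomial.coeff_sub, Polynomial.coeff_X,
      Polynomial.coeff_C]
    by_cases hl : l = 0
    · subst hl
      by_cases hk : k = i <;> simp [hk, MvPolynomial.pderiv_X]
    · by_cases hk : k = i <;> by_cases hl1 : 1 = l <;>
        simp [hk, hl, hl1, Polynomial.coeff_one]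
  refine ⟨D p, ?_, ?_, fun j => ?_⟩
  · rw [Derivation.derivative_mapCoeffsSelf, hp]
    change D _ = _
    have hrest : D (∏ k ∈ Finset.univ.erase i,
        (Polynomial.X - Polynomial.C (MvPolynomial.X k)) ^ a k) = 0 := by
      refine Finset.prod_induction _ (fun f => D f = 0) ?_ D.map_one_eq_zero ?_
      · intro f g hf hg
        rw [D.leibniz, hf, hg, smul_zero, smul_zero, add_zero]
      · intro k hk
        rw [D.leibniz_pow, hD, if_neg (Finset.ne_of_mem_erase hk), smul_zero, smul_zero]
    rw [← Finset.mul_prod_erase _ _ (Finset.mem_univ i), D.leibniz, hrest, smul_zero, zero_add,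
      D.leibniz_pow, hD, if_pos rfl, ← Finset.mul_prod_erase _ _ (Finset.mem_univ i)]
    have herase : ∏ k ∈ Finset.univ.erase i,
          (Polynomial.X - Polynomial.C (MvPolynomial.X (R := K) k)) ^ (a - Pi.single i 1 : σ → ℕ) k =
        ∏ k ∈ Finset.univ.erase i,
          (Polynomial.X - Polynomial.C (MvPolynomial.X k)) ^ a k :=
      Finset.prod_congr rfl fun k hk => by simp [Finset.ne_of_mem_erase hk]
    rw [herase]
    simp only [Pi.sub_apply, Pi.single_eq_same, smul_eq_mul, nsmul_eq_mul, map_neg, map_natCast]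
    ring
  · rw [Derivation.coeff_mapCoeffsSelf, hp0, map_zero]
  · rw [Derivation.eval_mapCoeffsSelf, hp, Polynomial.eval_prod,
      Finset.prod_eq_zero (Finset.mem_univ j) (by simp [(ha j).ne']), zero_mul, add_zero]

theorem MonLexLT.asymm {k : ℕ} {d e : Fin k →₀ ℕ} (h : MonLexLT d e) : ¬ MonLexLT e d := by
  rintro ⟨j, hj, hj'⟩
  obtain ⟨i, hi, hi'⟩ := h
  rcases lt_trichotomy i j with hij | rfl | hij
  · exact hj.ne (hi' j hij).symm
  · exact lt_asymm hi hj
  · exact hi.ne (hj' i hij).symm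

theorem IsLeadingTerm.unique {k : ℕ} {f s t : MvPolynomial (Fin k) ℂ}
    (hs : IsLeadingTerm f s) (ht : IsLeadingTerm f t) : s = t := by
  obtain ⟨D, hD, hD', rfl⟩ := hs
  obtain ⟨E, hE, hE', rfl⟩ := ht
  rcases hD' E hE with rfl | h
  · rfl
  · rcases hE' D hD with rfl | h'
    · rfl
    · exact absurd h' h.asymm

theorem IsLeadingTerm.C_mul {k : ℕ} {f t : MvPolynomial (Fin k) ℂ} (h : IsLeadingTerm f t)
    {c : ℂ} (hc : c ≠ 0) : IsLeadingTerm (MvPolynomial.C c * f) (MvPolynomial.C c * t) := by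
  obtain ⟨D, hD, hD', rfl⟩ := h
  simp only [MvPolynomial.mem_support_iff] at hD hD'
  refine ⟨D, ?_, fun E hE => hD' E ?_, ?_⟩
  · simpa [hc] using hD
  · simpa [hc] using hE
  · rw [MvPolynomial.coeff_C_mul, MvPolynomial.C_mul_monomial]

theorem isLeadingTerm_C {k : ℕ} {c : ℂ} (hc : c ≠ 0) :
    IsLeadingTerm (MvPolynomial.C c : MvPolynomial (Fin k) ℂ) (MvPolynomial.C c) := by
  refine ⟨0, by simpa using hc, fun E hE => ?_, by rw [MvPolynomial.coeff_zero_C, MvPolynomial.C_apply]⟩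
  left
  by_contra h
  simp [MvPolynomial.coeff_C, Ne.symm h] at hE

/-- Regard a polynomial in `z_1, …, z_{m+1}` as a polynomial in `z_{m+1}`. -/
noncomputable def polynomialInLast (m : ℕ) :
    MvPolynomial (Fin (m + 1)) ℂ ≃ₐ[ℂ] Polynomial (MvPolynomial (Fin m) ℂ) :=
  (MvPolynomial.renameEquiv ℂ finSuccEquivLast).trans (MvPolynomial.optionEquivLeft ℂ (Fin m))

theorem polynomialInLast_X_castSucc {m : ℕ} (i : Fin m) :
    polynomialInLast m (MvPolynomial.X i.castSucc) = Polynomial.C (MvPolynomial.X i) := by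
  simp [polynomialInLast]

theorem polynomialInLast_X_last (m : ℕ) :
    polynomialInLast m (MvPolynomial.X (Fin.last m)) = Polynomial.X := by
  simp [polynomialInLast]

theorem coeff_coeff_polynomialInLast {m : ℕ} (f : MvPolynomial (Fin (m + 1)) ℂ)
    (E : Fin (m + 1) →₀ ℕ) :
    ((polynomialInLast m f).coeff (E (Fin.last m))).coeff
      (E.comapDomain Fin.castSucc (Fin.castSucc_injective m).injOn) = f.coeff E := by
  rw [← MvPolynomial.coeff_rename_mapDomain finSuccEquivLast finSuccEquivLast.injective f E,
    ← MvPolynomial.optionEquivLeft_coeff_some_coeff_none]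
  have h1 : E.mapDomain finSuccEquivLast none = E (Fin.last m) := by
    rw [← finSuccEquivLast_last, Finsupp.mapDomain_apply finSuccEquivLast.injective]
  have h2 : (E.mapDomain finSuccEquivLast).some =
      E.comapDomain Fin.castSucc (Fin.castSucc_injective m).injOn := by
    ext i
    rw [Finsupp.some_apply, ← finSuccEquivLast_castSucc,
      Finsupp.mapDomain_apply finSuccEquivLast.injective, Finsupp.comapDomain_apply]
  rw [h1, h2]
  rfl

theorem IsLeadingTerm.of_coeff_polynomialInLast {m K : ℕ} {f : MvPolynomial (Fin (m + 1)) ℂ}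
    {s : MvPolynomial (Fin m) ℂ} (hdeg : (polynomialInLast m f).natDegree ≤ K)
    (hs : IsLeadingTerm ((polynomialInLast m f).coeff K) s) :
    IsLeadingTerm f (MvPolynomial.X (Fin.last m) ^ K * MvPolynomial.rename Fin.castSucc s) := by
  obtain ⟨D, hD, hD', rfl⟩ := hs
  have hinj := Fin.castSucc_injective m
  let E : Fin (m + 1) →₀ ℕ := Finsupp.single (Fin.last m) K + D.mapDomain Fin.castSucc
  have hElast : E (Fin.last m) = K := by
    simp only [E, Finsupp.add_apply, Finsupp.single_eq_same]
    rw [Finsupp.mapDomain_of_notMem_range _ _ (by simp), add_zero]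
  have hEcast (i : Fin m) : E i.castSucc = D i := by
    simp only [E, Finsupp.add_apply, Finsupp.mapDomain_apply hinj]
    rw [Finsupp.single_eq_of_ne (Fin.castSucc_ne_last i), zero_add]
  have hE : E.comapDomain Fin.castSucc hinj.injOn = D := by
    ext i
    rw [Finsupp.comapDomain_apply, hEcast]
  have hcoeff : f.coeff E = ((polynomialInLast m f).coeff K).coeff D := by
    rw [← coeff_coeff_polynomialInLast, hElast, hE]
  refine ⟨E, ?_, fun F hF => ?_, ?_⟩
  · rwa [MvPolynomial.mem_support_iff, hcoeff, ← MvPolynomial.mem_support_iff]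
  · rw [MvPolynomial.mem_support_iff, ← coeff_coeff_polynomialInLast] at hF
    have hle : F (Fin.last m) ≤ K := by
      by_contra! h
      rw [Polynomial.coeff_eq_zero_of_natDegree_lt (hdeg.trans_lt h), MvPolynomial.coeff_zero] at hF
      exact hF rfl
    rcases hle.lt_or_eq with hlt | heq
    · exact Or.inr ⟨Fin.last m, hlt.trans_eq hElast.symm,
        fun j hj => absurd hj (Fin.le_last j).not_gt⟩
    · rw [heq, ← MvPolynomial.mem_support_iff] at hF
      rcases hD' _ hF with h | ⟨i, hi, hi'⟩
      · left
        ext j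
        refine Fin.lastCases (heq.trans hElast.symm) (fun j => ?_) j
        rw [hEcast, ← h, Finsupp.comapDomain_apply]
      · right
        refine ⟨i.castSucc, by rwa [hEcast, ← Finsupp.comapDomain_apply _ _ hinj.injOn], fun j => ?_⟩
        refine Fin.lastCases (fun _ => heq.trans hElast.symm) (fun j hj => ?_) j
        rw [hEcast, ← hi' j (Fin.castSucc_lt_castSucc_iff.1 hj), Finsupp.comapDomain_apply]
  · rw [hcoeff, MvPolynomial.rename_monomial, MvPolynomial.X_pow_eq_monomial,
      MvPolynomial.monomial_mul, one_mul]

/-- **Lemma (Leading term of `det J_a`).** For an `(m+1)`-tuple `a` of positive integers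
(`m ≥ 1`, so the tuple has length at least `2`), with `a' = (a_1, …, a_m)` the truncated
tuple and `J_a`, `J_{a'}` the corresponding Jacobian matrices, the leading terms with
respect to the lexicographic order `z_1 < ⋯ < z_{m+1}` satisfy
`lt(det J_a) = (-z_{m+1})^{a_{m+1} ⬝ m} ⬝ lt(det J_{a'}) ⬝ lt((J_a)_{m+1,m+1})`. -/
theorem leadingTerm_det_jacobian_recursion
    (m : ℕ) (hm : 1 ≤ m)
    (a : Fin (m + 1) → ℕ) (ha : ∀ i, 0 < a i)
    (p : Polynomial (MvPolynomial (Fin (m + 1)) ℂ))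
    (hp : Polynomial.derivative p =
      ∏ i, (Polynomial.X - Polynomial.C (MvPolynomial.X i)) ^ a i)
    (hp0 : p.coeff 0 = 0)
    (J : Matrix (Fin (m + 1)) (Fin (m + 1)) (MvPolynomial (Fin (m + 1)) ℂ))
    (hJ : ∀ i j, J i j = MvPolynomial.pderiv i (Polynomial.eval (MvPolynomial.X j) p))
    (p' : Polynomial (MvPolynomial (Fin m) ℂ))
    (hp' : Polynomial.derivative p' =
      ∏ i : Fin m, (Polynomial.X - Polynomial.C (MvPolynomial.X i)) ^ a i.castSucc)
    (hp0' : p'.coeff 0 = 0)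
    (J' : Matrix (Fin m) (Fin m) (MvPolynomial (Fin m) ℂ))
    (hJ' : ∀ i j, J' i j = MvPolynomial.pderiv i (Polynomial.eval (MvPolynomial.X j) p'))
    (t1 t3 : MvPolynomial (Fin (m + 1)) ℂ) (t2 : MvPolynomial (Fin m) ℂ)
    (h1 : IsLeadingTerm J.det t1)
    (h2 : IsLeadingTerm J'.det t2)
    (h3 : IsLeadingTerm (J (Fin.last m) (Fin.last m)) t3) :
    t1 = (-(MvPolynomial.X (Fin.last m) : MvPolynomial (Fin (m + 1)) ℂ)) ^
        (a (Fin.last m) * m) *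
      MvPolynomial.rename Fin.castSucc t2 * t3 := by
  classical
  choose q hq hq0 hJq using exists_pderiv_eval_X_eq ha hp hp0
  choose q' hq' hq0' hJq' using exists_pderiv_eval_X_eq (fun i : Fin m => ha i.castSucc) hp' hp0'
  let Φ := polynomialInLast m
  let Q (i : Fin (m + 1)) : Polynomial (Polynomial (MvPolynomial (Fin m) ℂ)) :=
    (q i).map (Φ : MvPolynomial (Fin (m + 1)) ℂ →+* Polynomial (MvPolynomial (Fin m) ℂ))
  let r (i : Fin (m + 1)) : Fin (m + 1) → ℕ := a - Pi.single i 1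
  let g (i : Fin (m + 1)) : Polynomial (MvPolynomial (Fin m) ℂ) :=
    Polynomial.C (MvPolynomial.C (-(a i : ℂ))) *
      ∏ k : Fin m, (Polynomial.X - Polynomial.C (MvPolynomial.X k)) ^ r i k.castSucc
  have hΦJ (i j : Fin (m + 1)) :
      Φ (J i j) = (Q i).eval (Φ (MvPolynomial.X j)) := by
    rw [hJ, hJq, Polynomial.eval_map]
    exact (Polynomial.eval₂_at_apply (RingHomClass.toRingHom Φ) _).symm
  have hQ0 (i : Fin (m + 1)) : (Q i).coeff 0 = 0 := by
    rw [Polynomial.coeff_map, hq0, map_zero]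
  have hQ (i : Fin (m + 1)) : Polynomial.derivative (Q i) =
      (g i).map Polynomial.C * (Polynomial.X - Polynomial.C Polynomial.X) ^ r i (Fin.last m) := by
    rw [Polynomial.derivative_map, hq, Fin.prod_univ_castSucc]
    simp [g, r, Φ, Polynomial.map_prod, polynomialInLast_X_castSucc, polynomialInLast_X_last,
      mul_assoc]
  have hmonic (i : Fin (m + 1)) :
      (∏ k : Fin m, (Polynomial.X - Polynomial.C (MvPolynomial.X (R := ℂ) k)) ^
        r i k.castSucc).Monic :=
    Polynomial.monic_prod_of_monic _ _ fun k _ => (Polynomial.monic_X_sub_C _).pow _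
  have hmonicdeg (i : Fin (m + 1)) :
      (∏ k : Fin m, (Polynomial.X - Polynomial.C (MvPolynomial.X (R := ℂ) k)) ^
        r i k.castSucc).natDegree = ∑ k : Fin m, r i k.castSucc := by
    rw [Polynomial.natDegree_prod_of_monic _ _ fun k _ => (Polynomial.monic_X_sub_C _).pow _]
    simp
  have hsum (i : Fin (m + 1)) :
      r i (Fin.last m) + ∑ k : Fin m, r i k.castSucc + 1 = ∑ k, a k := by
    rw [add_comm (r i (Fin.last m)), ← Fin.sum_univ_castSucc,
      ← Finset.add_sum_erase _ _ (Finset.mem_univ i),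
      ← Finset.add_sum_erase _ a (Finset.mem_univ i)]
    have : ∑ k ∈ Finset.univ.erase i, r i k = ∑ k ∈ Finset.univ.erase i, a k :=
      Finset.sum_congr rfl fun k hk => by simp [r, Finset.ne_of_mem_erase hk]
    have hi : r i i = a i - 1 := by simp [r]
    have := ha i
    omega
  have hcastSucc (i : Fin (m + 1)) (j : Fin m) {G : Polynomial (MvPolynomial (Fin m) ℂ)}
      (hG : Polynomial.derivative G = g i) (hG0 : G.coeff 0 = 0) :
      (Φ (J i j.castSucc)).natDegree ≤ r i (Fin.last m) ∧
      (Φ (J i j.castSucc)).coeff (r i (Fin.last m)) =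
        (-1) ^ r i (Fin.last m) * G.eval (MvPolynomial.X j) := by
    rw [hΦJ, polynomialInLast_X_castSucc]
    exact natDegree_le_and_coeff_eval_C (K := ℂ) (hQ i) (hQ0 i) hG hG0 _
  have hlast (i : Fin (m + 1)) : (Φ (J i (Fin.last m))).natDegree ≤ ∑ k, a k ∧
      ∃ c : ℂ, c ≠ 0 ∧ (Φ (J i (Fin.last m))).coeff (∑ k, a k) = MvPolynomial.C c := by
    rw [hΦJ, polynomialInLast_X_last, ← hsum i]
    refine natDegree_le_and_coeff_eval_X (hQ i) (hQ0 i) ?_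
      (neg_ne_zero.2 (Nat.cast_ne_zero.2 (ha i).ne')) ?_
    · exact (Polynomial.natDegree_C_mul_le _ _).trans (hmonicdeg i).le
    · rw [Polynomial.coeff_C_mul, ← hmonicdeg, (hmonic i).coeff_natDegree, mul_one]
      rfl
  have hrle (i : Fin (m + 1)) : r i (Fin.last m) ≤ a (Fin.last m) := Nat.sub_le _ _
  let s : Fin (m + 1) → ℕ := Fin.snoc (α := fun _ => ℕ) (fun _ : Fin m => a (Fin.last m)) (∑ k, a k)
  have hsc (j : Fin m) : s j.castSucc = a (Fin.last m) := by simp [s]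
  have hsl : s (Fin.last m) = ∑ k, a k := by simp [s]
  have hssum : ∑ j, s j = a (Fin.last m) * m + ∑ k, a k := by
    rw [Fin.sum_univ_castSucc, hsl]
    simp [hsc, mul_comm]
  have hdeg (i j : Fin (m + 1)) : (Φ (J i j)).natDegree ≤ s j := by
    refine Fin.lastCases ?_ (fun j => ?_) j
    · rw [hsl]
      exact (hlast i).1
    · obtain ⟨G, hG, hG0⟩ := exists_derivative_eq_and_coeff_zero ℂ (g i)
      rw [hsc]
      exact (hcastSucc i j hG hG0).1.trans (hrle i)
  obtain ⟨hcl, c, hc, hcc⟩ := hlast (Fin.last m)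
  have hblock (i j : Fin m) : (Φ (J i.castSucc j.castSucc)).coeff (a (Fin.last m)) =
      (-1) ^ a (Fin.last m) * J' i j := by
    have hrl : r i.castSucc (Fin.last m) = a (Fin.last m) := by
      simp [r, (Fin.castSucc_ne_last i).symm]
    have hG : Polynomial.derivative (q' i) = g i.castSucc := by
      rw [hq']
      refine congrArg _ (Finset.prod_congr rfl fun k _ => ?_)
      simp [r, Pi.single_apply]
    rw [hJ', hJq', ← hrl]
    exact (hcastSucc _ j hG (hq0' i)).2
  have hrow (j : Fin m) : (Φ (J (Fin.last m) j.castSucc)).coeff (a (Fin.last m)) = 0 := by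
    obtain ⟨G, hG, hG0⟩ := exists_derivative_eq_and_coeff_zero ℂ (g (Fin.last m))
    refine Polynomial.coeff_eq_zero_of_natDegree_lt ((hcastSucc _ j hG hG0).1.trans_lt ?_)
    have := ha (Fin.last m)
    simp only [r, Pi.sub_apply, Pi.single_eq_same]
    omega
  have hdet : Φ J.det = (J.map Φ).det := Φ.map_det J
  obtain ⟨hdetdeg, hdetcoeff⟩ := Matrix.coeff_det_sum (A := J.map Φ) (s := s) hdeg
  rw [Matrix.det_of_lastRow_castSucc_eq_zero
    (A := Matrix.of fun i j => (J.map Φ i j).coeff (s j))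
    (fun j => by simpa [hsc] using hrow j)] at hdetcoeff
  have hsub : (Matrix.of fun i j => (J.map Φ i j).coeff (s j)).submatrix
      Fin.castSucc Fin.castSucc = ((-1 : MvPolynomial (Fin m) ℂ) ^ a (Fin.last m)) • J' := by
    ext1 i j
    simpa [hsc] using hblock i j
  rw [hsub, Matrix.det_smul, Fintype.card_fin, Matrix.of_apply, hsl,
    Matrix.map_apply, hcc, ← hdet, hssum, ← mul_assoc] at hdetcoeff
  rw [← hdet, hssum] at hdetdeg
  have hconst : MvPolynomial.C c * ((-1 : MvPolynomial (Fin m) ℂ) ^ a (Fin.last m)) ^ m =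
      MvPolynomial.C (c * ((-1) ^ a (Fin.last m)) ^ m) := by simp
  have ht3 := h3.unique (.of_coeff_polynomialInLast hcl (hcc ▸ isLeadingTerm_C hc))
  have ht1 := h1.unique (.of_coeff_polynomialInLast hdetdeg (by
    rw [hdetcoeff, hconst]
    exact h2.C_mul (mul_ne_zero hc (pow_ne_zero _ (pow_ne_zero _ (neg_ne_zero.2 one_ne_zero))))))
  rw [ht1, ht3, hcc, ← hconst, neg_pow (MvPolynomial.X (Fin.last m) : MvPolynomial _ ℂ)]
  simp only [map_mul, map_pow, map_neg, map_one, MvPolynomial.rename_C]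
  ring
end

section
/- Let a = (a_1,…,a_m) be an m-tuple of positive integers with n = a_1+⋯+a_m, and let J_a be the m×m Jacobian matrix over ℂ[z_1,…,z_m] with (i,j)-entry ∂/∂z_i (p_a(z_j)). With monomials ordered lexicographically with z_1 < ⋯ < z_m, the coefficient of the leading term of det J_a is (−1)^{a_1 + 2a_2 + ⋯ + m·a_m} · (a_1!⋯a_m!)/n!, i.e., (−1)^{Σ_{i=1}^m i·a_i} divided by the multinomial coefficient multinomial(n; a_1,…,a_m). -/
open Polynomial in
/-- The definite integral `∫₀ᶻ Q(w) dw` of a polynomial over a `K`-algebra. -/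
noncomputable def integralZeroTo (K : Type*) {R : Type*} [Field K] [CommRing R] [Algebra K R]
    (z : R) : R[X] →ₗ[R] R :=
  Polynomial.lsum fun n => (algebraMap K R ((n : K) + 1)⁻¹ * z ^ (n + 1)) • LinearMap.id

section Integral

open Polynomial

variable {K R S : Type*} [Field K] [CommRing R] [Algebra K R] [CommRing S] [Algebra K S]

theorem integralZeroTo_monomial (z : R) (n : ℕ) (c : R) :
    integralZeroTo K z (monomial n c) = algebraMap K R ((n : K) + 1)⁻¹ * z ^ (n + 1) * c := by
  simp [integralZeroTo, lsum]

theorem integralZeroTo_C_mul (z c : R) (Q : R[X]) :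
    integralZeroTo K z (C c * Q) = c * integralZeroTo K z Q := by
  rw [← smul_eq_C_mul, map_smul, smul_eq_mul]

theorem algebraMap_inv_add_one_mul [CharZero K] (n : ℕ) :
    algebraMap K R ((n : K) + 1)⁻¹ * ((n : R) + 1) = 1 := by
  have : ((n : R) + 1) = algebraMap K R ((n : K) + 1) := by simp
  rw [this, ← map_mul, inv_mul_cancel₀ (Nat.cast_add_one_ne_zero n), map_one]

theorem integralZeroTo_derivative [CharZero K] (z : R) (P : R[X]) :
    integralZeroTo K z (derivative P) = P.eval z - P.eval 0 := by
  induction P using Polynomial.induction_on' with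
  | add p q hp hq => simp only [map_add, hp, hq, eval_add]; ring
  | monomial n c =>
    rw [derivative_monomial, integralZeroTo_monomial]
    cases n with
    | zero => simp
    | succ n =>
      have h := algebraMap_inv_add_one_mul (K := K) (R := R) n
      simp only [Nat.add_sub_cancel, Nat.cast_add, Nat.cast_one, eval_monomial, ne_eq,
        Nat.add_eq_zero_iff, one_ne_zero, and_false, not_false_eq_true, zero_pow, mul_zero,
        sub_zero]
      linear_combination z ^ (n + 1) * c * h

theorem map_integralZeroTo (f : R →ₐ[K] S) (z : R) (Q : R[X]) :
    f (integralZeroTo K z Q) = integralZeroTo K (f z) (Q.map (f : R →+* S)) := by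
  induction Q using Polynomial.induction_on' with
  | add p q hp hq => simp only [map_add, hp, hq, Polynomial.map_add]
  | monomial n c => simp [integralZeroTo_monomial, AlgHom.commutes]

/-- The beta integral `∫₀ˣ wᴺ (w - x)ᵇ dw`. -/
theorem integralZeroTo_X_pow_mul_X_sub_C_pow [CharZero K] (x : R) (N b : ℕ) :
    integralZeroTo K x (X ^ N * (X - C x) ^ b) =
      algebraMap K R ((-1) ^ b * (N.factorial * b.factorial) / (N + b + 1).factorial) *
        x ^ (N + b + 1) := by
  induction b generalizing N with
  | zero =>
    have h : ((N : K) + 1)⁻¹ = (-1) ^ 0 * (N.factorial * (Nat.factorial 0)) /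
        (N + 0 + 1).factorial := by
      rw [add_zero, Nat.factorial_succ]
      have := Nat.cast_add_one_ne_zero (R := K) N
      have := Nat.cast_ne_zero (R := K).2 N.factorial_ne_zero
      push_cast
      field_simp
      simp
    rw [← h, pow_zero, mul_one, X_pow_eq_monomial, integralZeroTo_monomial]
    simp
  | succ b ih =>
    have hparts := integralZeroTo_derivative (K := K) x (X ^ (N + 1) * (X - C x) ^ (b + 1))
    have hd : derivative (X ^ (N + 1) * (X - C x) ^ (b + 1)) =
        C ((N : R) + 1) * (X ^ N * (X - C x) ^ (b + 1)) +
          C ((b : R) + 1) * (X ^ (N + 1) * (X - C x) ^ b) := by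
      simp [derivative_mul, derivative_pow]
      ring
    rw [hd, map_add, integralZeroTo_C_mul, integralZeroTo_C_mul, ih] at hparts
    simp only [eval_mul, eval_pow, eval_X, eval_sub, eval_C, sub_self, ne_eq,
      Nat.add_eq_zero_iff, one_ne_zero, and_false, not_false_eq_true, zero_pow, mul_zero,
      zero_mul] at hparts
    have hN := Nat.cast_add_one_ne_zero (R := K) N
    have hinv := algebraMap_inv_add_one_mul (K := K) (R := R) N
    have hc : (-1 : K) ^ (b + 1) * (N.factorial * (b + 1).factorial) /
          (N + (b + 1) + 1).factorial =
        -(((N : K) + 1)⁻¹ * ((b : K) + 1) * ((-1) ^ b * ((N + 1).factorial * b.factorial) /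
          (N + 1 + b + 1).factorial)) := by
      have h1 : N + (b + 1) + 1 = N + 1 + b + 1 := by ring
      have := Nat.cast_ne_zero (R := K).2 (N + 1 + b + 1).factorial_ne_zero
      rw [h1, Nat.factorial_succ b, Nat.factorial_succ N]
      push_cast
      field_simp
      ring
    rw [hc, map_neg, map_mul (algebraMap K R), map_mul (algebraMap K R), map_add (algebraMap K R),
      map_natCast, map_one,
      show N + (b + 1) + 1 = N + 1 + b + 1 by ring]
    linear_combination algebraMap K R ((N : K) + 1)⁻¹ * hparts -
      integralZeroTo K x (X ^ N * (X - C x) ^ (b + 1)) * hinv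

/-- A factor `(w - X)ᵇ` of the integrand, with `X` the polynomial variable, contributes
degree at most `b` to an integral with constant endpoints. -/
theorem natDegree_le_and_coeff_integralZeroTo_C (z : S) (Q : S[X]) (b : ℕ) :
    (integralZeroTo K (C z) (Q.map C * (X - C X) ^ b)).natDegree ≤ b ∧
      (integralZeroTo K (C z) (Q.map C * (X - C X) ^ b)).coeff b =
        (-1) ^ b * integralZeroTo K z Q := by
  induction b generalizing Q with
  | zero =>
    have h := map_integralZeroTo (CAlgHom : S →ₐ[K] S[X]) z Q
    have h' : integralZeroTo K (C z) (Q.map C) = C (integralZeroTo K z Q) := h.symm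
    simp [h']
  | succ b ih =>
    have hrec : integralZeroTo K (C z) (Q.map C * (X - C X) ^ (b + 1)) =
        integralZeroTo K (C z) ((Q * X).map C * (X - C X) ^ b) -
          X * integralZeroTo K (C z) (Q.map C * (X - C X) ^ b) := by
      rw [← integralZeroTo_C_mul, ← map_sub]
      congr 1
      simp only [Polynomial.map_mul, map_X]
      ring
    obtain ⟨h1, -⟩ := ih (Q * X)
    obtain ⟨h2, h3⟩ := ih Q
    rw [hrec]
    constructor
    · refine (natDegree_sub_le _ _).trans (max_le (h1.trans b.le_succ) ?_)
      refine natDegree_mul_le.trans ?_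
      have := natDegree_X_le (R := S)
      omega
    · rw [coeff_sub, coeff_X_mul, coeff_eq_zero_of_natDegree_lt (Nat.lt_succ_of_le h1), h3]
      ring

theorem natDegree_le_and_coeff_integralZeroTo_X [CharZero K] (Q : S[X]) (N b : ℕ)
    (hQ : Q.natDegree ≤ N) :
    (integralZeroTo K X (Q.map C * (X - C X) ^ b)).natDegree ≤ N + b + 1 ∧
      (integralZeroTo K X (Q.map C * (X - C X) ^ b)).coeff (N + b + 1) =
        algebraMap K S ((-1) ^ b * (N.factorial * b.factorial) / (N + b + 1).factorial) *
          Q.coeff N := by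
  refine Polynomial.induction_with_natDegree_le
    (fun Q : S[X] => (integralZeroTo K X (Q.map C * (X - C X) ^ b)).natDegree ≤ N + b + 1 ∧
      (integralZeroTo K X (Q.map C * (X - C X) ^ b)).coeff (N + b + 1) =
        algebraMap K S ((-1) ^ b * (N.factorial * b.factorial) / (N + b + 1).factorial) *
          Q.coeff N) N ?_ (fun n r hr hn => ?_)
    (fun f g hfg hg hf hg' => ?_) Q hQ
  · simp
  · have h : integralZeroTo K X ((C r * X ^ n).map C * (X - C X) ^ b) =
        C (algebraMap K S ((-1) ^ b * (n.factorial * b.factorial) / (n + b + 1).factorial) * r) *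
          X ^ (n + b + 1) := by
      rw [Polynomial.map_mul, map_C, Polynomial.map_pow, map_X, mul_assoc,
        integralZeroTo_C_mul, integralZeroTo_X_pow_mul_X_sub_C_pow, C_mul,
        IsScalarTower.algebraMap_apply K S S[X], algebraMap_eq]
      ring
    rw [h]
    refine ⟨(natDegree_C_mul_X_pow_le _ _).trans (by omega), ?_⟩
    by_cases hnN : N = n
    · rw [hnN, coeff_C_mul_X_pow, if_pos rfl, coeff_C_mul_X_pow, if_pos rfl]
    · rw [coeff_C_mul_X_pow, if_neg (by omega), coeff_C_mul_X_pow, if_neg hnN, mul_zero]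
  · obtain ⟨f1, f2⟩ := hf
    obtain ⟨g1, g2⟩ := hg'
    rw [Polynomial.map_add, add_mul, map_add]
    refine ⟨natDegree_add_le_of_degree_le f1 g1, ?_⟩
    rw [coeff_add, f2, g2, coeff_add]
    ring

/-- The derivation of `R[X]` acting on coefficients. -/
noncomputable def coeffDerivation (D : Derivation K R R) : Derivation K R[X] R[X] :=
  PolynomialModule.equivPolynomialSelf.compDer D.mapCoeffs

theorem coeffDerivation_monomial (D : Derivation K R R) (n : ℕ) (c : R) :
    coeffDerivation D (monomial n c) = monomial n (D c) := by
  simp [coeffDerivation]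

theorem derivation_integralZeroTo [CharZero K] (D : Derivation K R R) (z : R) (Q : R[X]) :
    D (integralZeroTo K z Q) = integralZeroTo K z (coeffDerivation D Q) + Q.eval z * D z := by
  induction Q using Polynomial.induction_on' with
  | add p q hp hq => simp only [map_add, hp, hq, eval_add]; ring
  | monomial n c =>
    have h := algebraMap_inv_add_one_mul (K := K) (R := R) n
    rw [coeffDerivation_monomial, integralZeroTo_monomial, integralZeroTo_monomial, D.leibniz,
      D.leibniz, D.leibniz_pow, D.map_algebraMap, eval_monomial]
    simp only [smul_eq_mul, nsmul_eq_mul, Nat.add_sub_cancel, Nat.cast_add, Nat.cast_one]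
    linear_combination z ^ n * c * D z * h

end Integral

section Determinant

open Polynomial

variable {R : Type*} [CommRing R]

theorem Polynomial.natDegree_prod_le_and_coeff_prod {ι : Type*} (s : Finset ι) (f : ι → R[X])
    (d : ι → ℕ) (h : ∀ i ∈ s, (f i).natDegree ≤ d i) :
    (∏ i ∈ s, f i).natDegree ≤ ∑ i ∈ s, d i ∧
      (∏ i ∈ s, f i).coeff (∑ i ∈ s, d i) = ∏ i ∈ s, (f i).coeff (d i) := by
  classical
  induction s using Finset.induction_on with
  | empty => simp
  | insert i s hi ih =>
    obtain ⟨h1, h2⟩ := ih fun j hj => h j (Finset.mem_insert_of_mem hj)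
    have hfi := h i (Finset.mem_insert_self i s)
    rw [Finset.prod_insert hi, Finset.sum_insert hi, Finset.prod_insert hi,
      coeff_mul_add_eq_of_natDegree_le hfi h1, h2]
    exact ⟨natDegree_mul_le_of_le hfi h1, rfl⟩

theorem Matrix.natDegree_det_le_and_coeff_det {ι : Type*} [Fintype ι] [DecidableEq ι]
    (M : Matrix ι ι R[X]) (d : ι → ℕ) (h : ∀ i j, (M i j).natDegree ≤ d j) :
    M.det.natDegree ≤ ∑ j, d j ∧
      M.det.coeff (∑ j, d j) = (Matrix.of fun i j => (M i j).coeff (d j)).det := by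
  have key (σ : Equiv.Perm ι) := natDegree_prod_le_and_coeff_prod Finset.univ
    (fun j => M (σ j) j) d fun j _ => h _ _
  rw [Matrix.det_apply]
  constructor
  · refine natDegree_sum_le_of_forall_le _ _ fun σ _ => ?_
    exact (natDegree_smul_le _ _).trans (key σ).1
  · rw [finsetSum_coeff, Matrix.det_apply]
    refine Finset.sum_congr rfl fun σ _ => ?_
    rw [coeff_smul, (key σ).2]
    rfl

theorem Matrix.det_eq_mul_of_last_row_eq_zero {k : ℕ} (M : Matrix (Fin (k + 1)) (Fin (k + 1)) R)
    (h : ∀ j : Fin k, M (Fin.last k) j.castSucc = 0) :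
    M.det = M (Fin.last k) (Fin.last k) * (M.submatrix Fin.castSucc Fin.castSucc).det := by
  rw [Matrix.det_succ_row M (Fin.last k), Fin.sum_univ_castSucc]
  simp [h, ← two_mul, Fin.succAbove_last]

end Determinant

section LeadingTerm

open MvPolynomial

/-- `c` is the coefficient of a monomial of `f` that dominates the support of `f`. -/
def HasLexLeadingCoeff {k : ℕ} {R : Type*} [CommSemiring R] (f : MvPolynomial (Fin k) R)
    (c : R) : Prop :=
  ∃ D, coeff D f = c ∧ ∀ E ∈ f.support, E = D ∨ MonLexLT E D

/-- Polynomials in `z_1, …, z_{k+1}` as polynomials in the last variable. -/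
noncomputable def finSuccLastEquiv (K : Type*) [CommSemiring K] (k : ℕ) :
    MvPolynomial (Fin (k + 1)) K ≃ₐ[K] Polynomial (MvPolynomial (Fin k) K) :=
  (renameEquiv K finSuccEquivLast).trans (optionEquivLeft K (Fin k))

variable {K : Type*} {k : ℕ}

theorem finSuccLastEquiv_X_castSucc [CommSemiring K] (i : Fin k) :
    finSuccLastEquiv K k (X i.castSucc) = Polynomial.C (X i) := by
  simp [finSuccLastEquiv]

theorem finSuccLastEquiv_X_last [CommSemiring K] :
    finSuccLastEquiv K k (X (Fin.last k)) = Polynomial.X := by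
  simp [finSuccLastEquiv]

theorem coeff_coeff_finSuccLastEquiv [CommSemiring K] (f : MvPolynomial (Fin (k + 1)) K)
    (E : Fin (k + 1) →₀ ℕ) :
    coeff (E.comapDomain Fin.castSucc (Fin.castSucc_injective k).injOn)
      ((finSuccLastEquiv K k f).coeff (E (Fin.last k))) = coeff E f := by
  rw [← coeff_rename_mapDomain _ finSuccEquivLast.injective f E,
    ← optionEquivLeft_coeff_some_coeff_none, ← Finsupp.equivMapDomain_eq_mapDomain]
  have h1 : (Finsupp.equivMapDomain finSuccEquivLast E).some =
      E.comapDomain Fin.castSucc (Fin.castSucc_injective k).injOn := by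
    ext i; simp
  have h2 : Finsupp.equivMapDomain finSuccEquivLast E none = E (Fin.last k) := by simp
  rw [h1, h2]
  rfl

theorem HasLexLeadingCoeff.of_finSuccLastEquiv [Field K]
    {f : MvPolynomial (Fin (k + 1)) K} {N : ℕ} {b c : K} {g : MvPolynomial (Fin k) K}
    (hN : (finSuccLastEquiv K k f).natDegree ≤ N)
    (hb : (finSuccLastEquiv K k f).coeff N = C b * g) (hg : HasLexLeadingCoeff g c) :
    HasLexLeadingCoeff f (b * c) := by
  obtain ⟨D, hD, hmax⟩ := hg
  refine ⟨Finsupp.equivFunOnFinite.symm (Fin.snoc D N), ?_, fun E hE => ?_⟩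
  · rw [← coeff_coeff_finSuccLastEquiv, ← hD, ← coeff_C_mul, ← hb]
    congr 1
    · ext i; simp
    · simp
  · rw [mem_support_iff, ← coeff_coeff_finSuccLastEquiv] at hE
    rcases lt_trichotomy (E (Fin.last k)) N with hlt | heq | hgt
    · exact Or.inr ⟨Fin.last k, by simpa using hlt, fun j hj => absurd hj (Fin.le_last j).not_gt⟩
    · rw [heq, hb, coeff_C_mul] at hE
      rcases hmax _ (mem_support_iff.2 (right_ne_zero_of_mul hE)) with h | ⟨i, hi, hij⟩
      · left
        ext j
        induction j using Fin.lastCases with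
        | last => simpa using heq
        | cast j => simp [← h]
      · right
        refine ⟨i.castSucc, by simpa using hi, fun j hj => ?_⟩
        induction j using Fin.lastCases with
        | last => simpa using heq
        | cast j => simpa using hij j (by simpa using hj)
    · rw [Polynomial.coeff_eq_zero_of_natDegree_lt (hN.trans_lt hgt)] at hE
      simp at hE

end LeadingTerm

section Jacobian

open Polynomial

variable {K R S : Type*} [Field K] [CommRing R] [Algebra K R] [CommRing S] [Algebra K S]

/-- The integral formula for the Jacobian matrix, over an arbitrary algebra:
the `(i, j)`-entry is `-aᵢ ∫₀^{zⱼ} (w - zᵢ)^{aᵢ - 1} ∏_{l ≠ i} (w - z_l)^{a_l} dw`. -/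
noncomputable def jacobianIntegral (K : Type*) {R : Type*} [Field K] [CommRing R] [Algebra K R]
    {k : ℕ} (a : Fin k → ℕ) (z : Fin k → R) : Matrix (Fin k) (Fin k) R :=
  Matrix.of fun i j => -(a i : R) *
    integralZeroTo K (z j) (∏ l, (X - C (z l)) ^ Function.update a i (a i - 1) l)

theorem jacobianIntegral_apply {k : ℕ} (a : Fin k → ℕ) (z : Fin k → R) (i j : Fin k) :
    jacobianIntegral K a z i j = -(a i : R) *
      integralZeroTo K (z j) (∏ l, (X - C (z l)) ^ Function.update a i (a i - 1) l) := rfl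

theorem map_jacobianIntegral {k : ℕ} (f : R →ₐ[K] S) (a : Fin k → ℕ) (z : Fin k → R) :
    f.mapMatrix (jacobianIntegral K a z) = jacobianIntegral K a (f ∘ z) := by
  ext i j
  simp only [AlgHom.mapMatrix_apply, Matrix.map_apply, jacobianIntegral_apply, map_mul, map_neg,
    map_natCast, map_integralZeroTo, Polynomial.map_prod, Polynomial.map_pow,
    Polynomial.map_sub, map_X, map_C, Function.comp_apply, RingHom.coe_coe]

theorem coeffDerivation_eq_zero_of_prod {ι : Type*} (D : Derivation K R R) (s : Finset ι)
    (f : ι → R[X]) (h : ∀ i ∈ s, coeffDerivation D (f i) = 0) :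
    coeffDerivation D (∏ i ∈ s, f i) = 0 :=
  Finset.prod_induction f (fun Q => coeffDerivation D Q = 0)
    (fun p q hp hq => by rw [Derivation.leibniz, hp, hq, smul_zero, smul_zero, add_zero])
    (Derivation.map_one_eq_zero _) h

theorem coeffDerivation_X_sub_C (D : Derivation K R R) (c : R) :
    coeffDerivation D (X - C c) = -C (D c) := by
  rw [map_sub, ← monomial_zero_left, ← monomial_one_one_eq_X, coeffDerivation_monomial,
    coeffDerivation_monomial]
  simp

theorem coeffDerivation_prod_X_sub_C {k : ℕ} (a : Fin k → ℕ) (i : Fin k) :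
    coeffDerivation (MvPolynomial.pderiv (R := K) i)
        (∏ l, (X - C (MvPolynomial.X l : MvPolynomial (Fin k) K)) ^ a l) =
      C (-(a i : MvPolynomial (Fin k) K)) *
        ∏ l, (X - C (MvPolynomial.X l)) ^ Function.update a i (a i - 1) l := by
  rw [← Finset.mul_prod_erase _ _ (Finset.mem_univ i), Derivation.leibniz,
    coeffDerivation_eq_zero_of_prod, Derivation.leibniz_pow, coeffDerivation_X_sub_C,
    MvPolynomial.pderiv_X_self, ← Finset.mul_prod_erase _ (fun l => _ ^ Function.update _ _ _ l)
      (Finset.mem_univ i), Function.update_self]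
  · have h : ∏ l ∈ Finset.univ.erase i, (X - C (MvPolynomial.X l : MvPolynomial (Fin k) K)) ^
        Function.update a i (a i - 1) l =
        ∏ l ∈ Finset.univ.erase i, (X - C (MvPolynomial.X l)) ^ a l :=
      Finset.prod_congr rfl fun l hl => by
        rw [Function.update_of_ne (Finset.ne_of_mem_erase hl)]
    rw [h]
    simp
    ring
  · intro l hl
    rw [Derivation.leibniz_pow, coeffDerivation_X_sub_C,
      MvPolynomial.pderiv_X_of_ne (Finset.ne_of_mem_erase hl)]
    simp

theorem pderiv_eval_eq_jacobianIntegral [CharZero K] {k : ℕ} (a : Fin k → ℕ) (ha : ∀ i, 0 < a i)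
    (p : (MvPolynomial (Fin k) K)[X])
    (hp : derivative p = ∏ i, (X - C (MvPolynomial.X i)) ^ a i) (hp0 : p.coeff 0 = 0)
    (i j : Fin k) :
    MvPolynomial.pderiv i (p.eval (MvPolynomial.X j)) =
      jacobianIntegral K a MvPolynomial.X i j := by
  have h := integralZeroTo_derivative (K := K) (MvPolynomial.X j) p
  rw [← coeff_zero_eq_eval_zero, hp0, sub_zero] at h
  have h0 : (derivative p).eval (MvPolynomial.X j) = 0 := by
    rw [hp, eval_prod]
    exact Finset.prod_eq_zero (Finset.mem_univ j) (by simp [(ha j).ne'])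
  rw [← h, derivation_integralZeroTo, h0, zero_mul, add_zero, hp, coeffDerivation_prod_X_sub_C,
    integralZeroTo_C_mul, jacobianIntegral_apply]

end Jacobian

section Recursion

open Polynomial

variable {K S : Type*} [Field K] [CommRing S] [Algebra K S] {k : ℕ}

theorem prod_X_sub_C_pow_castSucc {z : Fin (k + 1) → S[X]} {y : Fin k → S}
    (hc : ∀ i, z i.castSucc = C (y i)) (hl : z (Fin.last k) = X) (b : Fin (k + 1) → ℕ) :
    ∏ l, (X - C (z l)) ^ b l =
      (∏ l, (X - C (y l)) ^ b l.castSucc).map C * (X - C X) ^ b (Fin.last k) := by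
  rw [Fin.prod_univ_castSucc, hl, Polynomial.map_prod]
  simp [hc]

theorem sum_update_sub_one_add_one {ι : Type*} [Fintype ι] [DecidableEq ι] (a : ι → ℕ) (i : ι)
    (h : 0 < a i) : ∑ l, Function.update a i (a i - 1) l + 1 = ∑ l, a l := by
  rw [Finset.sum_update_of_mem (Finset.mem_univ i), Finset.sdiff_singleton_eq_erase,
    ← Finset.add_sum_erase _ _ (Finset.mem_univ i)]
  omega

theorem monic_natDegree_prod_X_sub_C_pow {ι : Type*} [Fintype ι] [Nontrivial S] (y : ι → S)
    (b : ι → ℕ) : (∏ l, (X - C (y l)) ^ b l).Monic ∧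
      (∏ l, (X - C (y l)) ^ b l).natDegree = ∑ l, b l := by
  have h : ∀ l ∈ Finset.univ, ((X - C (y l)) ^ b l).Monic := fun l _ => (monic_X_sub_C _).pow _
  refine ⟨monic_prod_of_monic _ _ h, ?_⟩
  rw [natDegree_prod_of_monic _ _ h]
  exact Finset.sum_congr rfl fun l _ => by
    rw [(monic_X_sub_C _).natDegree_pow, natDegree_X_sub_C, mul_one]

theorem natDegree_le_and_coeff_jacobianIntegral_castSucc {a : Fin (k + 1) → ℕ}
    {z : Fin (k + 1) → S[X]}
    {y : Fin k → S} (hc : ∀ i, z i.castSucc = C (y i)) (hl : z (Fin.last k) = X)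
    (i : Fin (k + 1)) (j : Fin k) :
    (jacobianIntegral K a z i j.castSucc).natDegree ≤
        Function.update a i (a i - 1) (Fin.last k) ∧
      (jacobianIntegral K a z i j.castSucc).coeff (Function.update a i (a i - 1) (Fin.last k)) =
        -(a i : S) * ((-1) ^ Function.update a i (a i - 1) (Fin.last k) *
          integralZeroTo K (y j)
            (∏ l, (X - C (y l)) ^ Function.update a i (a i - 1) l.castSucc)) := by
  have hC : (-(a i : S[X])) = C (-(a i : S)) := by simp
  obtain ⟨h1, h2⟩ := natDegree_le_and_coeff_integralZeroTo_C (K := K) (y j)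
    (∏ l, (X - C (y l)) ^ Function.update a i (a i - 1) l.castSucc)
    (Function.update a i (a i - 1) (Fin.last k))
  rw [jacobianIntegral_apply, hc, prod_X_sub_C_pow_castSucc hc hl, hC, coeff_C_mul, h2]
  exact ⟨(natDegree_C_mul_le _ _).trans h1, rfl⟩

theorem natDegree_le_and_coeff_jacobianIntegral_last [CharZero K] [Nontrivial S]
    {a : Fin (k + 1) → ℕ}
    (ha : ∀ i, 0 < a i) {z : Fin (k + 1) → S[X]} {y : Fin k → S}
    (hc : ∀ i, z i.castSucc = C (y i)) (hl : z (Fin.last k) = X) (i : Fin (k + 1)) :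
    (jacobianIntegral K a z i (Fin.last k)).natDegree ≤ ∑ l, a l ∧
      (jacobianIntegral K a z i (Fin.last k)).coeff (∑ l, a l) =
        -(a i : S) * algebraMap K S ((-1) ^ Function.update a i (a i - 1) (Fin.last k) *
          ((∑ l : Fin k, Function.update a i (a i - 1) l.castSucc).factorial *
            (Function.update a i (a i - 1) (Fin.last k)).factorial) / (∑ l, a l).factorial) := by
  have hC : (-(a i : S[X])) = C (-(a i : S)) := by simp
  obtain ⟨hm, hd⟩ := monic_natDegree_prod_X_sub_C_pow y
    (fun l => Function.update a i (a i - 1) l.castSucc)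
  obtain ⟨h1, h2⟩ := natDegree_le_and_coeff_integralZeroTo_X (K := K) _ _
    (Function.update a i (a i - 1) (Fin.last k)) hd.le
  have hs := sum_update_sub_one_add_one a i (ha i)
  rw [Fin.sum_univ_castSucc] at hs
  rw [hs] at h1 h2
  rw [jacobianIntegral_apply, prod_X_sub_C_pow_castSucc hc hl, hl, hC, coeff_C_mul, h2, ← hd,
    hm.coeff_natDegree, mul_one]
  exact ⟨(natDegree_C_mul_le _ _).trans h1, rfl⟩

theorem exists_coeff_det_jacobianIntegral [CharZero K] [Nontrivial S] {a : Fin (k + 1) → ℕ}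
    (ha : ∀ i, 0 < a i) {z : Fin (k + 1) → S[X]} {y : Fin k → S}
    (hc : ∀ i, z i.castSucc = C (y i)) (hl : z (Fin.last k) = X) :
    ∃ N, (jacobianIntegral K a z).det.natDegree ≤ N ∧
      (jacobianIntegral K a z).det.coeff N =
        algebraMap K S ((-1) ^ ((k + 1) * a (Fin.last k)) *
          ((∑ l : Fin k, a l.castSucc).factorial * (a (Fin.last k)).factorial) /
            (∑ l, a l).factorial) * (jacobianIntegral K (a ∘ Fin.castSucc) y).det := by
  set d : Fin (k + 1) → ℕ := Fin.snoc (fun _ => a (Fin.last k)) (∑ l, a l) with hd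
  have hle (i : Fin (k + 1)) : Function.update a i (a i - 1) (Fin.last k) ≤ a (Fin.last k) := by
    rw [Function.update_apply]; split_ifs with h
    · rw [← h]; omega
    · rfl
  obtain ⟨h1, h2⟩ := Matrix.natDegree_det_le_and_coeff_det (jacobianIntegral K a z) d fun i j => by
    induction j using Fin.lastCases with
    | last => simpa [hd] using (natDegree_le_and_coeff_jacobianIntegral_last ha hc hl i).1
    | cast j =>
      simpa [hd] using
        (natDegree_le_and_coeff_jacobianIntegral_castSucc hc hl i j).1.trans (hle i)
  refine ⟨_, h1, ?_⟩
  rw [h2, Matrix.det_eq_mul_of_last_row_eq_zero]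
  · have hminor : (Matrix.of fun i j => (jacobianIntegral K a z i j).coeff (d j)).submatrix
        Fin.castSucc Fin.castSucc =
        ((-1) ^ a (Fin.last k) : S) • jacobianIntegral K (a ∘ Fin.castSucc) y := by
      ext i j
      have h := (natDegree_le_and_coeff_jacobianIntegral_castSucc (K := K) (a := a) hc hl
        i.castSucc j).2
      rw [Function.update_of_ne (Fin.castSucc_lt_last i).ne'] at h
      rw [Matrix.submatrix_apply, Matrix.of_apply, hd, Fin.snoc_castSucc, h,
        Matrix.smul_apply, jacobianIntegral_apply, smul_eq_mul, Function.comp_apply]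
      have hu (l : Fin k) : Function.update a i.castSucc (a i.castSucc - 1) l.castSucc =
          Function.update (a ∘ Fin.castSucc) i (a i.castSucc - 1) l := by
        simp [Function.update_apply]
      simp only [hu]
      ring
    have hcorner := (natDegree_le_and_coeff_jacobianIntegral_last (K := K) ha hc hl (Fin.last k)).2
    rw [Function.update_self] at hcorner
    have hu (l : Fin k) : Function.update a (Fin.last k) (a (Fin.last k) - 1) l.castSucc =
        a l.castSucc := Function.update_of_ne (Fin.castSucc_lt_last l).ne _ _
    simp only [hu] at hcorner
    obtain ⟨b, hb⟩ := Nat.exists_eq_add_of_le' (ha (Fin.last k))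
    rw [hminor, Matrix.det_smul, Fintype.card_fin, Matrix.of_apply, hd, Fin.snoc_last, hcorner,
      ← mul_assoc]
    congr 1
    rw [← map_natCast (algebraMap K S), ← map_neg, ← map_one (algebraMap K S), ← map_neg,
      ← map_pow, ← map_pow, ← map_mul, ← map_mul, hb, Nat.add_sub_cancel, Nat.factorial_succ]
    congr 1
    push_cast
    ring
  · intro j
    have hlt : Function.update a (Fin.last k) (a (Fin.last k) - 1) (Fin.last k) <
        a (Fin.last k) := by
      have := ha (Fin.last k)
      rw [Function.update_self]
      omega
    rw [Matrix.of_apply, hd, Fin.snoc_castSucc]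
    exact coeff_eq_zero_of_natDegree_lt
      ((natDegree_le_and_coeff_jacobianIntegral_castSucc hc hl (Fin.last k) j).1.trans_lt hlt)

theorem hasLexLeadingCoeff_det_jacobianIntegral [CharZero K] (k : ℕ) (a : Fin k → ℕ)
    (ha : ∀ i, 0 < a i) :
    HasLexLeadingCoeff
      (jacobianIntegral K a (MvPolynomial.X : Fin k → MvPolynomial (Fin k) K)).det
      ((-1) ^ (∑ i : Fin k, ((i : ℕ) + 1) * a i) * ((∏ i, (a i).factorial : ℕ) : K) /
        ((∑ i, a i).factorial : K)) := by
  induction k with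
  | zero =>
    refine ⟨0, by simp, fun E _ => Or.inl (Subsingleton.elim _ _)⟩
  | succ k ih =>
    obtain ⟨N, h1, h2⟩ := exists_coeff_det_jacobianIntegral (K := K) ha
      (z := finSuccLastEquiv K k ∘ MvPolynomial.X) finSuccLastEquiv_X_castSucc
      finSuccLastEquiv_X_last
    have hφ : finSuccLastEquiv K k (jacobianIntegral K a MvPolynomial.X).det =
        (jacobianIntegral K a (finSuccLastEquiv K k ∘ MvPolynomial.X)).det := by
      have h := map_jacobianIntegral (K := K) (finSuccLastEquiv K k).toAlgHom a MvPolynomial.X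
      exact (AlgHom.map_det (finSuccLastEquiv K k).toAlgHom _).trans (congrArg _ h)
    rw [← hφ] at h1 h2
    have h := HasLexLeadingCoeff.of_finSuccLastEquiv h1 h2
      (ih (a ∘ Fin.castSucc) fun i => ha _)
    convert h using 1
    have hne := Nat.cast_ne_zero (R := K).2 (∑ l : Fin k, a l.castSucc).factorial_ne_zero
    rw [Fin.sum_univ_castSucc (fun i : Fin (k + 1) => ((i : ℕ) + 1) * a i),
      Fin.prod_univ_castSucc]
    simp only [Fin.val_castSucc, Fin.val_last, Function.comp_apply, pow_add]
    push_cast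
    field_simp

end Recursion

/-- **Proposition (Constant coefficient).** For an `m`-tuple `a` of positive integers
with sum `n`, the leading term of `det J_a` in the lexicographic order `z_1 < ⋯ < z_m`
has coefficient `(-1)^{a_1 + 2 a_2 + ⋯ + m a_m} ⬝ (a_1! ⋯ a_m!) / n!`, i.e.
`(-1)^{Σ i ⬝ a_i}` divided by the multinomial coefficient. -/
theorem leadingCoeff_det_jacobian
    (m n : ℕ) (a : Fin m → ℕ) (ha : ∀ i, 0 < a i) (hn : n = ∑ i, a i)
    (p : Polynomial (MvPolynomial (Fin m) ℂ))
    (hp : Polynomial.derivative p =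
      ∏ i, (Polynomial.X - Polynomial.C (MvPolynomial.X i)) ^ a i)
    (hp0 : p.coeff 0 = 0)
    (J : Matrix (Fin m) (Fin m) (MvPolynomial (Fin m) ℂ))
    (hJ : ∀ i j, J i j = MvPolynomial.pderiv i (Polynomial.eval (MvPolynomial.X j) p)) :
    ∃ D ∈ J.det.support, (∀ E ∈ J.det.support, E = D ∨ MonLexLT E D) ∧
      MvPolynomial.coeff D J.det =
        (-1 : ℂ) ^ (∑ i : Fin m, ((i : ℕ) + 1) * a i) *
          ((∏ i, (a i).factorial : ℕ) : ℂ) / (n.factorial : ℂ) := by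
  have hJ' : J = jacobianIntegral ℂ a MvPolynomial.X := by
    ext1 i j
    rw [hJ, pderiv_eval_eq_jacobianIntegral a ha p hp hp0]
  obtain ⟨D, hD, hmax⟩ := hasLexLeadingCoeff_det_jacobianIntegral (K := ℂ) m a ha
  rw [hJ', hn]
  refine ⟨D, ?_, hmax, hD⟩
  rw [MvPolynomial.mem_support_iff, hD]
  refine div_ne_zero (mul_ne_zero (pow_ne_zero _ (by simp)) ?_)
    (Nat.cast_ne_zero.2 (Nat.factorial_ne_zero _))
  exact Nat.cast_ne_zero.2 (Finset.prod_ne_zero_iff.2 fun i _ => Nat.factorial_ne_zero _)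
end

section
/- (Dyson's conjecture, polynomial form.) Let a_1,…,a_m be positive integers with n = a_1+⋯+a_m. In the polynomial ∏_{j≠k, j,k ∈ [m]} (z_k − z_j)^{a_j} ∈ ℂ[z_1,…,z_m], the coefficient of the monomial ∏_{k=1}^m z_k^{n−a_k} equals the multinomial coefficient multinomial(n; a_1,…,a_m) = n!/(a_1!⋯a_m!). Equivalently, the constant term of the Laurent polynomial ∏_{j≠k} (1 − z_j/z_k)^{a_j} equals multinomial(n; a_1,…,a_m). -/
namespace Dyson

open Finset MvPolynomial

variable {σ R : Type*} [CommRing R]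

lemma degreeOf_X_sub_X_pow [Nontrivial R] {i j k : σ} (hj : i ≠ j) (hk : i ≠ k) (n : ℕ) :
    degreeOf i ((X k - X j : MvPolynomial σ R) ^ n) = 0 := by
  have h : degreeOf i (X k - X j : MvPolynomial σ R) ≤ 0 :=
    (degreeOf_sub_le _ _ _).trans (by simp [degreeOf_X_of_ne, hj, hk])
  exact Nat.le_zero.mp ((degreeOf_pow_le _ _ _).trans (by simp [Nat.le_zero.mp h]))

lemma coeff_X_sub_X_mul [Nontrivial R] {j l : σ} (hl : l ≠ j) {p : MvPolynomial σ R}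
    {d : σ →₀ ℕ} (hd : degreeOf j p ≤ d j) :
    coeff (d + Finsupp.single j 1) ((X j - X l) * p) = coeff d p := by
  rw [sub_mul, coeff_sub, add_comm d, coeff_X_mul, sub_eq_self, ← notMem_support_iff]
  intro h
  have h₁ := monomial_le_degreeOf j h
  have h₂ : degreeOf j (X l * p) ≤ d j :=
    (degreeOf_mul_le _ _ _).trans (by simpa [degreeOf_X_of_ne, hl.symm] using hd)
  simp only [Finsupp.add_apply, Finsupp.single_eq_same] at h₁
  lia

variable [DecidableEq σ]

/-- Dyson's product over the ordered pairs of distinct indices in `s`. -/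
noncomputable def product (R : Type*) [CommRing R] (s : Finset σ) (a : σ → ℕ) :
    MvPolynomial σ R :=
  ∏ j ∈ s, ∏ k ∈ s.erase j, (X k - X j) ^ a j

/-- The exponent `∑ i ∈ s \ {k}, a i` at each `k ∈ s`. -/
noncomputable def exponent (s : Finset σ) (a : σ → ℕ) : σ →₀ ℕ :=
  ∑ k ∈ s, Finsupp.single k (∑ i ∈ s.erase k, a i)

lemma exponent_apply (s : Finset σ) (a : σ → ℕ) (k : σ) :
    exponent s a k = if k ∈ s then ∑ i ∈ s.erase k, a i else 0 := by
  simp [exponent, Finsupp.finsetSum_apply, Finsupp.single_apply]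

lemma degreeOf_product [Nontrivial R] {s : Finset σ} {i : σ} (hi : i ∉ s) (a : σ → ℕ) :
    degreeOf i (product R s a) = 0 := by
  refine Nat.le_zero.mp ((degreeOf_prod_le _ _ _).trans ?_)
  refine (sum_eq_zero fun j hj ↦ ?_).le
  refine Nat.le_zero.mp ((degreeOf_prod_le _ _ _).trans ?_)
  refine (sum_eq_zero fun k hk ↦ ?_).le
  exact degreeOf_X_sub_X_pow (by rintro rfl; exact hi hj)
    (by rintro rfl; exact hi (mem_of_mem_erase hk)) _

lemma degreeOf_X_sub_X_mul_le [Nontrivial R] (j l : σ) (p : MvPolynomial σ R) :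
    degreeOf j ((X j - X l) * p) ≤ degreeOf j p + 1 := by
  refine (degreeOf_mul_le _ _ _).trans ?_
  have h : degreeOf j (X j - X l : MvPolynomial σ R) ≤ 1 := by
    refine (degreeOf_sub_le _ _ _).trans (max_le ?_ ?_) <;> rw [degreeOf_X] <;> split_ifs <;> simp
  lia

lemma coeff_X_sub_X_pow_mul [Nontrivial R] {j l : σ} (hl : l ≠ j) {p : MvPolynomial σ R}
    {d : σ →₀ ℕ} (hd : degreeOf j p ≤ d j) (n : ℕ) :
    degreeOf j ((X j - X l) ^ n * p) ≤ d j + n ∧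
      coeff (d + Finsupp.single j n) ((X j - X l) ^ n * p) = coeff d p := by
  induction n with
  | zero => simpa using hd
  | succ n ih =>
    rw [pow_succ', mul_assoc]
    refine ⟨(degreeOf_X_sub_X_mul_le _ _ _).trans (by lia), ?_⟩
    rw [Finsupp.single_add, ← add_assoc, coeff_X_sub_X_mul hl (by simpa using ih.1), ih.2]

lemma coeff_prod_X_sub_X_pow_mul [Nontrivial R] {j : σ} {t : Finset σ} (hj : j ∉ t)
    (a : σ → ℕ) {p : MvPolynomial σ R} {d : σ →₀ ℕ} (hd : degreeOf j p ≤ d j) :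
    degreeOf j ((∏ l ∈ t, (X j - X l) ^ a l) * p) ≤ d j + ∑ l ∈ t, a l ∧
      coeff (d + Finsupp.single j (∑ l ∈ t, a l)) ((∏ l ∈ t, (X j - X l) ^ a l) * p) =
        coeff d p := by
  induction t using Finset.induction_on with
  | empty => simpa using hd
  | insert l t hl ih =>
    rw [mem_insert, not_or] at hj
    obtain ⟨ih₁, ih₂⟩ := ih hj.2
    have h := coeff_X_sub_X_pow_mul (Ne.symm hj.1)
      (p := (∏ l ∈ t, (X j - X l) ^ a l) * p)
      (d := d + Finsupp.single j (∑ l ∈ t, a l)) (by simpa using ih₁) (a l)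
    rw [prod_insert hl, sum_insert hl, mul_assoc, add_comm (a l), Finsupp.single_add, ← add_assoc,
      ← add_assoc]
    exact ⟨by simpa using h.1, h.2.trans ih₂⟩

lemma product_insert_of_eq_zero {j : σ} {t : Finset σ} (hj : j ∉ t) {a : σ → ℕ}
    (haj : a j = 0) :
    product R (insert j t) a = (∏ l ∈ t, (X j - X l) ^ a l) * product R t a := by
  rw [product, prod_insert hj, product, ← prod_mul_distrib]
  simp only [haj, pow_zero, prod_const_one, one_mul]
  refine prod_congr rfl fun l hl ↦ ?_
  have hjl : j ≠ l := by rintro rfl; exact hj hl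
  rw [erase_insert_of_ne hjl, prod_insert (fun h ↦ hj (mem_of_mem_erase h))]

lemma exponent_insert_of_eq_zero {j : σ} {t : Finset σ} (hj : j ∉ t) {a : σ → ℕ}
    (haj : a j = 0) :
    exponent (insert j t) a = exponent t a + Finsupp.single j (∑ l ∈ t, a l) := by
  rw [exponent, sum_insert hj, erase_insert hj, add_comm, exponent]
  congr 1
  refine sum_congr rfl fun l hl ↦ ?_
  have hjl : j ≠ l := by rintro rfl; exact hj hl
  rw [erase_insert_of_ne hjl, sum_insert (fun h ↦ hj (mem_of_mem_erase h)), haj, zero_add]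

lemma coeff_product_insert_of_eq_zero [Nontrivial R] {j : σ} {t : Finset σ} (hj : j ∉ t)
    {a : σ → ℕ} (haj : a j = 0) :
    coeff (exponent (insert j t) a) (product R (insert j t) a) =
      coeff (exponent t a) (product R t a) := by
  rw [product_insert_of_eq_zero hj haj, exponent_insert_of_eq_zero hj haj]
  exact (coeff_prod_X_sub_X_pow_mul hj a (by simp [degreeOf_product hj])).2

lemma product_add_single {s : Finset σ} {j : σ} (hj : j ∈ s) (b : σ → ℕ) :
    product R s (b + Pi.single j 1) = product R s b * ∏ k ∈ s.erase j, (X k - X j) := by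
  simp only [product, Pi.add_apply, pow_add, prod_mul_distrib]
  congr 1
  rw [prod_eq_single_of_mem j hj]
  · simp
  · intro i _ hi
    simp [Pi.single_eq_of_ne hi]

lemma exponent_add_single {s : Finset σ} {j : σ} (hj : j ∈ s) (b : σ → ℕ) :
    exponent s (b + Pi.single j 1) =
      exponent s b + ∑ k ∈ s.erase j, Finsupp.single k 1 := by
  ext k
  simp only [Finsupp.add_apply, exponent_apply, Finsupp.finsetSum_apply, Finsupp.single_apply,
    Pi.add_apply, sum_add_distrib, sum_ite_eq', Finset.sum_pi_single', mem_erase]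
  split_ifs <;> simp_all [eq_comm]

lemma sum_prod_div_sub {K : Type*} [Field K] {s : Finset σ} (hs : s.Nonempty) {v : σ → K}
    (hv : Set.InjOn v s) :
    ∑ j ∈ s, ∏ k ∈ s.erase j, v k / (v k - v j) = 1 := by
  have h := congrArg (Polynomial.eval 0) (Lagrange.sum_basis hv hs)
  rw [Polynomial.eval_finsetSum, Polynomial.eval_one] at h
  rw [← h]
  refine sum_congr rfl fun j _ ↦ ?_
  rw [Lagrange.basis, Polynomial.eval_prod]
  refine prod_congr rfl fun k _ ↦ ?_
  rw [Lagrange.basisDivisor, Polynomial.eval_mul, Polynomial.eval_C, Polynomial.eval_sub,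
    Polynomial.eval_X, Polynomial.eval_C, zero_sub, ← neg_sub (v k), inv_neg, neg_mul_neg,
    div_eq_inv_mul]

lemma single_one_le {a : σ → ℕ} {j : σ} (hj : 0 < a j) : Pi.single j 1 ≤ a := by
  intro i
  obtain rfl | hi := eq_or_ne i j
  · simpa [Nat.one_le_iff_ne_zero] using hj.ne'
  · simp [Pi.single_eq_of_ne hi]

lemma product_eq_sum [IsDomain R] {s : Finset σ} (hs : s.Nonempty) {a : σ → ℕ}
    (ha : ∀ j ∈ s, 0 < a j) :
    product R s a = ∑ j ∈ s, product R s (a - Pi.single j 1) * ∏ k ∈ s.erase j, X k := by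
  let φ := algebraMap (MvPolynomial σ R) (FractionRing (MvPolynomial σ R))
  have hφ : Function.Injective φ := IsFractionRing.injective _ _
  have hv : Function.Injective fun i ↦ φ (X i) := hφ.comp X_injective
  apply hφ
  rw [map_sum, ← mul_one (φ (product R s a)), ← sum_prod_div_sub hs hv.injOn, mul_sum]
  refine sum_congr rfl fun j hj ↦ ?_
  have hle := single_one_le (ha j hj)
  conv_lhs => rw [← tsub_add_cancel_of_le hle, product_add_single hj]
  rw [map_mul, map_mul, map_prod, map_prod, mul_assoc, ← prod_mul_distrib]
  congr 1
  refine prod_congr rfl fun k hk ↦ ?_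
  rw [map_sub, mul_div_cancel₀]
  exact sub_ne_zero.mpr (hv.ne (ne_of_mem_erase hk))

lemma multinomial_eq_sum {s : Finset σ} (hs : s.Nonempty) {a : σ → ℕ}
    (ha : ∀ j ∈ s, 0 < a j) :
    Nat.multinomial s a = ∑ j ∈ s, Nat.multinomial s (a - Pi.single j 1) := by
  have hpos : 0 < ∏ i ∈ s, (a i).factorial := prod_pos fun i _ ↦ Nat.factorial_pos _
  refine Nat.eq_of_mul_eq_mul_left hpos ?_
  have hsum : 0 < ∑ i ∈ s, a i := sum_pos ha hs
  rw [Nat.multinomial_spec, mul_sum, ← Nat.mul_factorial_pred hsum.ne', sum_mul]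
  refine sum_congr rfl fun j hj ↦ ?_
  have herase (i) (hi : i ∈ s.erase j) : (a - Pi.single j 1 : σ → ℕ) i = a i := by
    simp [Pi.single_eq_of_ne (ne_of_mem_erase hi)]
  have hself : (a - Pi.single j 1 : σ → ℕ) j = a j - 1 := by simp
  have h := Nat.multinomial_spec s (a - Pi.single j 1)
  rw [← add_sum_erase s _ hj, ← mul_prod_erase s _ hj, sum_congr rfl herase,
    prod_congr rfl fun i hi ↦ congrArg Nat.factorial (herase i hi), hself] at h
  have hj' := ha j hj
  rw [← add_sum_erase s a hj, ← mul_prod_erase s _ hj, ← Nat.mul_factorial_pred hj'.ne',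
    Nat.sub_add_comm hj', ← h]
  ring

theorem coeff_product [IsDomain R] (s : Finset σ) (a : σ → ℕ) :
    coeff (exponent s a) (product R s a) = (Nat.multinomial s a : R) := by
  induction hN : #s + ∑ i ∈ s, a i using Nat.strong_induction_on generalizing s a with
  | _ N ih =>
    obtain rfl | hs := s.eq_empty_or_nonempty
    · simp [exponent, product]
    by_cases ha : ∀ j ∈ s, 0 < a j
    · rw [product_eq_sum hs ha, coeff_sum, multinomial_eq_sum hs ha, Nat.cast_sum]
      refine sum_congr rfl fun j hj ↦ ?_
      have hle := single_one_le (ha j hj)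
      have hX : ∏ k ∈ s.erase j, (X k : MvPolynomial σ R) =
          monomial (∑ k ∈ s.erase j, Finsupp.single k 1) 1 := by
        simp [monomial_sum_one, X]
      conv_lhs => rw [← tsub_add_cancel_of_le hle, exponent_add_single hj, hX,
        tsub_add_cancel_of_le hle, coeff_mul_monomial, mul_one]
      refine ih _ ?_ s _ rfl
      rw [← hN]
      refine Nat.add_lt_add_left (sum_lt_sum (fun i _ ↦ Nat.sub_le _ _) ⟨j, hj, ?_⟩) _
      simpa using ha j hj
    · push Not at ha
      obtain ⟨j, hj, haj⟩ := ha
      replace haj := Nat.le_zero.mp haj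
      rw [← insert_erase hj, coeff_product_insert_of_eq_zero (notMem_erase j s) haj,
        Nat.multinomial_insert (notMem_erase j s), haj]
      simp only [zero_add, Nat.choose_zero_right, one_mul]
      refine ih _ ?_ _ _ rfl
      rw [← hN, ← add_sum_erase s a hj, haj, zero_add]
      exact Nat.add_lt_add_right (card_erase_lt_of_mem hj) _

end Dyson

/-- **Dyson's conjecture (polynomial form).** For positive integers `a_1, …, a_m` with
sum `n`, the coefficient of the monomial `∏_k z_k^{n - a_k}` in the polynomial
`∏_{j ≠ k} (z_k - z_j)^{a_j}` equals the multinomial coefficient `n!/(a_1! ⋯ a_m!)`.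
(Equivalently, the constant term of the Laurent polynomial `∏_{j ≠ k} (1 - z_j/z_k)^{a_j}`
is the multinomial coefficient.) -/
theorem dyson_conjecture
    (m n : ℕ) (a : Fin m → ℕ) (ha : ∀ i, 0 < a i) (hn : n = ∑ i, a i) :
    MvPolynomial.coeff (Finsupp.equivFunOnFinite.symm fun k => n - a k)
      (∏ j, ∏ k ∈ Finset.univ \ {j},
        (MvPolynomial.X k - MvPolynomial.X j : MvPolynomial (Fin m) ℂ) ^ a j) =
      (Nat.multinomial Finset.univ a : ℂ) := by
  have h := Dyson.coeff_product (R := ℂ) Finset.univ a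
  rw [← h, Dyson.product]
  congr 1
  · ext k
    rw [Dyson.exponent_apply, if_pos (Finset.mem_univ k), Finsupp.equivFunOnFinite_symm_apply_apply,
      hn, ← Finset.add_sum_erase _ a (Finset.mem_univ k), Nat.add_sub_cancel_left]
  · simp only [Finset.sdiff_singleton_eq_erase]
end
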